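/- If m and n are both even positive integers, then cr(K_{1,1,m,n}) ≥ (1/2)(cr(K_{m+1,n+3}) + cr(K_{m+3,n+1}) − mn − (1/4)(m² + n²)). -/

import Mathlib

open SimpleGraph

variable {V : Type*}

/-- A drawing of a simple graph in the plane: an injective placement of the
vertices in `ℝ²` together with, for each edge, a continuous arc joining the
positions of its endpoints (parametrised compatibly in both directions),
such that no arc passes through the position of a vertex other than its
endpoints. -/
structure Drawing (G : SimpleGraph V) where
  pos : V → ℝ × ℝ
  pos_inj : Function.Injective pos
  arc : V → V → ℝ → ℝ × ℝ
  arc_cont : ∀ ⦃a b⦄, G.Adj a b → ContinuousOn (arc a b) (Set.Icc 0 1)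
  arc_zero : ∀ ⦃a b⦄, G.Adj a b → arc a b 0 = pos a
  arc_one : ∀ ⦃a b⦄, G.Adj a b → arc a b 1 = pos b
  arc_symm : ∀ ⦃a b⦄, G.Adj a b → ∀ t, arc b a t = arc a b (1 - t)
  arc_avoid : ∀ ⦃a b⦄, G.Adj a b → ∀ c, c ≠ a → c ≠ b →
      pos c ∉ arc a b '' Set.Icc 0 1

namespace Drawing

variable {G : SimpleGraph V} (D : Drawing G)

/-- The set of points of the plane used by the edge `e`. -/
def edgePoints (e : Sym2 V) : Set (ℝ × ℝ) :=
  {p | ∃ a b, e = s(a, b) ∧ G.Adj a b ∧ p ∈ D.arc a b '' Set.Icc 0 1}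

/-- The positions of the endpoints of an edge. -/
def ends (e : Sym2 V) : Set (ℝ × ℝ) := {p | ∃ a ∈ e, p = D.pos a}

/-- `p` is a crossing of the (distinct) edges `e` and `f` in the drawing `D`:
a common point of the two edges other than an endpoint. -/
def IsCrossing (e f : Sym2 V) (p : ℝ × ℝ) : Prop :=
  e ∈ G.edgeSet ∧ f ∈ G.edgeSet ∧ e ≠ f ∧
    p ∈ D.edgePoints e ∧ p ∈ D.edgePoints f ∧ p ∉ D.ends e ∧ p ∉ D.ends f

/-- The crossings between an edge of `A` and an edge of `B`: a crossing is
recorded as a point of the plane together with the unordered pair of edges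
crossing there. -/
def crossings (A B : Set (Sym2 V)) : Set ((ℝ × ℝ) × Sym2 (Sym2 V)) :=
  {q | ∃ e f, q.2 = s(e, f) ∧ e ∈ A ∧ f ∈ B ∧ D.IsCrossing e f q.1}

/-- `cr_D(A, B)`: the number of crossings between an edge of `A` and an
edge of `B`. -/
noncomputable def crBetween (A B : Set (Sym2 V)) : ℕ := Nat.card (D.crossings A B)

/-- `cr(D)`: the total number of crossings of the drawing `D`. -/
noncomputable def crNum : ℕ := D.crBetween G.edgeSet G.edgeSet

/-- A good drawing: no edge crosses itself (each arc is a simple arc),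
no two adjacent edges cross, no two edges cross more than once, and no three
edges cross at a common point. -/
structure IsGood : Prop where
  arc_inj : ∀ ⦃a b⦄, G.Adj a b → Set.InjOn (D.arc a b) (Set.Icc 0 1)
  adj_no_cross : ∀ e f : Sym2 V, (∃ a, a ∈ e ∧ a ∈ f) → ∀ p, ¬ D.IsCrossing e f p
  cross_once : ∀ e f : Sym2 V, {p | D.IsCrossing e f p}.Subsingleton
  no_triple : ∀ p, ∀ e f g : Sym2 V, e ≠ f → e ≠ g → f ≠ g →
      ¬ (D.IsCrossing e f p ∧ D.IsCrossing f g p ∧ D.IsCrossing e g p)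

end Drawing

/-- The crossing number of a graph: the minimum number of crossings among
all good drawings of `G` in the plane. -/
noncomputable def crossingNumber (G : SimpleGraph V) : ℕ :=
  sInf {n | ∃ D : Drawing G, D.IsGood ∧ D.crNum = n}

/-- The Zarankiewicz function `Z(m,n) = ⌊m/2⌋⌊(m-1)/2⌋⌊n/2⌋⌊(n-1)/2⌋`. -/
def Z (m n : ℕ) : ℕ := m / 2 * ((m - 1) / 2) * (n / 2) * ((n - 1) / 2)

/-- The complete bipartite graph `K_{a,b}`. -/
abbrev bipK (a b : ℕ) : SimpleGraph (Fin a ⊕ Fin b) :=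
  completeBipartiteGraph (Fin a) (Fin b)

/-- The complete tripartite graph `K_{a,b,c}`. -/
abbrev triK (a b c : ℕ) : SimpleGraph (Σ i : Fin 3, ![Fin a, Fin b, Fin c] i) :=
  completeMultipartiteGraph ![Fin a, Fin b, Fin c]

/-- The complete 4-partite graph `K_{a,b,c,d}`. -/
abbrev quadK (a b c d : ℕ) : SimpleGraph (Σ i : Fin 4, ![Fin a, Fin b, Fin c, Fin d] i) :=
  completeMultipartiteGraph ![Fin a, Fin b, Fin c, Fin d]

/-- `E(V₁, V₂)`: the set of pairs `{v₁, v₂}` with `v₁ ∈ V₁` and `v₂ ∈ V₂`. -/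
def pairEdges {α : Type*} (V₁ V₂ : Set α) : Set (Sym2 α) :=
  {e | ∃ a ∈ V₁, ∃ b ∈ V₂, e = s(a, b)}

open Filter Topology

/-! ## Plane geometry -/
namespace CrAux

/-- The determinant of two plane vectors. -/
def dt (v w : ℂ) : ℝ := v.re * w.im - v.im * w.re

/-- The dot product of two plane vectors. -/
def dp (v w : ℂ) : ℝ := v.re * w.re + v.im * w.im

lemma mem_sg {x y z : ℂ} : z ∈ segment ℝ x y ↔ ∃ θ : ℝ, 0 ≤ θ ∧ θ ≤ 1 ∧ z = x + θ • (y - x) := by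
  rw [segment_eq_image']
  constructor
  · rintro ⟨θ, ⟨h0, h1⟩, rfl⟩; exact ⟨θ, h0, h1, rfl⟩
  · rintro ⟨θ, h0, h1, rfl⟩; exact ⟨θ, ⟨h0, h1⟩, rfl⟩

lemma dt_cont : Continuous (fun p : ℂ × ℂ => dt p.1 p.2) := by
  unfold dt; fun_prop

lemma dp_cont : Continuous (fun p : ℂ × ℂ => dp p.1 p.2) := by
  unfold dp; fun_prop

lemma dt_tendsto {F : Filter ℝ} {P Q : ℝ → ℂ} {p q : ℂ} (hP : Tendsto P F (𝓝 p))
    (hQ : Tendsto Q F (𝓝 q)) : Tendsto (fun e => dt (P e) (Q e)) F (𝓝 (dt p q)) :=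
  (dt_cont.tendsto (p, q)).comp (hP.prodMk_nhds hQ)

lemma dp_tendsto {F : Filter ℝ} {P Q : ℝ → ℂ} {p q : ℂ} (hP : Tendsto P F (𝓝 p))
    (hQ : Tendsto Q F (𝓝 q)) : Tendsto (fun e => dp (P e) (Q e)) F (𝓝 (dp p q)) :=
  (dp_cont.tendsto (p, q)).comp (hP.prodMk_nhds hQ)

lemma seg_compact (x y : ℂ) : IsCompact (segment ℝ x y) := by
  rw [segment_eq_image']
  exact isCompact_Icc.image (by fun_prop)

lemma seg_thick {p q p' q' : ℂ} {δ : ℝ} (hp : Dist.dist p' p < δ) (hq : Dist.dist q' q < δ) :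
    segment ℝ p' q' ⊆ Metric.thickening δ (segment ℝ p q) := by
  intro z hz
  obtain ⟨θ, h0, h1, rfl⟩ := mem_sg.1 hz
  rw [Metric.mem_thickening_iff]
  refine ⟨p + θ • (q - p), mem_sg.2 ⟨θ, h0, h1, rfl⟩, ?_⟩
  rw [dist_eq_norm] at *
  have e : p' + θ • (q' - p') - (p + θ • (q - p)) = (1 - θ) • (p' - p) + θ • (q' - q) := by
    simp only [Complex.real_smul]; push_cast; ring
  rw [e]
  calc _ ≤ ‖(1 - θ) • (p' - p)‖ + ‖θ • (q' - q)‖ := norm_add_le _ _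
    _ = (1 - θ) * ‖p' - p‖ + θ * ‖q' - q‖ := by
      rw [norm_smul, norm_smul, Real.norm_of_nonneg h0, Real.norm_of_nonneg (by linarith)]
    _ < δ := by
      rcases eq_or_lt_of_le h0 with h | h
      · subst h; simpa using hp
      · nlinarith [mul_lt_mul_of_pos_left hq h, mul_le_mul_of_nonneg_left hp.le (by linarith : 0 ≤ 1 - θ)]

lemma seg_disj_ev {F : Filter ℝ} {P Q R T : ℝ → ℂ} {p q r t : ℂ} (hP : Tendsto P F (𝓝 p))
    (hQ : Tendsto Q F (𝓝 q)) (hR : Tendsto R F (𝓝 r)) (hT : Tendsto T F (𝓝 t))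
    (h : Disjoint (segment ℝ p q) (segment ℝ r t)) :
    ∀ᶠ e in F, Disjoint (segment ℝ (P e) (Q e)) (segment ℝ (R e) (T e)) := by
  obtain ⟨δ, hδ, hd⟩ := h.exists_thickenings (seg_compact _ _) (seg_compact _ _).isClosed
  have A : ∀ {P : ℝ → ℂ} {p : ℂ}, Tendsto P F (𝓝 p) → ∀ᶠ e in F, Dist.dist (P e) p < δ :=
    fun hP => (Metric.tendsto_nhds.1 hP) δ hδ
  filter_upwards [A hP, A hQ, A hR, A hT] with e h1 h2 h3 h4
  exact hd.mono (seg_thick h1 h2) (seg_thick h3 h4)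

lemma pt_seg_ev {F : Filter ℝ} {P Q R : ℝ → ℂ} {p q r : ℂ} (hP : Tendsto P F (𝓝 p))
    (hQ : Tendsto Q F (𝓝 q)) (hR : Tendsto R F (𝓝 r)) 
    (h : r ∉ segment ℝ p q) :
    ∀ᶠ e in F, R e ∉ segment ℝ (P e) (Q e) := by
  have := seg_disj_ev hP hQ hR hR (by rw [segment_same]; simpa using h)
  filter_upwards [this] with e he
  rw [segment_same] at he; simpa using he

/-- Two nondegenerate segments from `p` meet only in `p` iff they do not lie on the same ray. -/
lemma share_iff {p q r : ℂ} (hq : p ≠ q) (hr : p ≠ r) :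
    segment ℝ p q ∩ segment ℝ p r ⊆ {p} ↔ dt (q - p) (r - p) ≠ 0 ∨ dp (q - p) (r - p) < 0 := by
  have hq' : 0 < dp (q - p) (q - p) := by
    have : q - p ≠ 0 := sub_ne_zero.2 hq.symm
    have h2 : dp (q - p) (q - p) = Complex.normSq (q - p) := by
      simp [dp, Complex.normSq_apply]
    rw [h2]; exact Complex.normSq_pos.2 this
  have hr' : 0 < dp (r - p) (r - p) := by
    have : r - p ≠ 0 := sub_ne_zero.2 hr.symm
    have h2 : dp (r - p) (r - p) = Complex.normSq (r - p) := by
      simp [dp, Complex.normSq_apply]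
    rw [h2]; exact Complex.normSq_pos.2 this
  constructor
  · intro h
    by_contra! hc
    obtain ⟨h1, h2⟩ := hc
    set Q := q - p with hQ
    set R := r - p with hR
    -- scale: point p + (dp R R / M) Q
    set A := dp Q R with hA
    set B := dp R R with hB
    have hAB : A * A = dp Q Q * B := by
      have : A * A + dt Q R * dt Q R = dp Q Q * B := by
        simp only [hA, hB, dp, dt]; ring
      rw [h1] at this; linarith
    have hApos : 0 < A := by
      rcases h2.lt_or_eq with h | h
      · exact h
      · rw [← h] at hAB; nlinarith [mul_pos hq' hr']
    have key : (B / (A + B)) • Q = (A / (A + B)) • R := by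
      have : B • Q = A • R := by
        apply Complex.ext
        · simp only [Complex.smul_re, smul_eq_mul, hA, hB, dp]
          have := h1; simp only [dt] at this
          linear_combination R.im * this
        · simp only [Complex.smul_im, smul_eq_mul, hA, hB, dp]
          have := h1; simp only [dt] at this
          linear_combination -R.re * this
      rw [div_eq_inv_mul, div_eq_inv_mul, mul_smul, mul_smul, this]
    have hs : 0 < A + B := by positivity
    have hin : p + (B / (A + B)) • Q ∈ segment ℝ p q ∩ segment ℝ p r := by
      refine ⟨mem_sg.2 ⟨_, by positivity, ?_, rfl⟩, mem_sg.2 ⟨A / (A+B), by positivity, ?_, ?_⟩⟩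
      · rw [div_le_one hs]; linarith
      · rw [div_le_one hs]; linarith
      · rw [key]
    have := h hin
    simp only [Set.mem_singleton_iff, add_eq_left, smul_eq_zero] at this
    rcases this with h | h
    · have : 0 < B / (A + B) := by positivity
      linarith
    · exact hq (sub_eq_zero.1 h).symm
  · rintro h z ⟨h1, h2⟩
    obtain ⟨a, ha, -, rfl⟩ := mem_sg.1 h1
    obtain ⟨b, hb, -, he⟩ := mem_sg.1 h2
    have he : a • (q - p) = b • (r - p) := by simpa using he
    by_contra hz
    have ha0 : 0 < a := by
      rcases ha.lt_or_eq with h | h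
      · exact h
      · subst h; simp at hz
    have hb0 : 0 < b := by
      rcases hb.lt_or_eq with h | h
      · exact h
      · subst h; rw [zero_smul] at he; simp [he] at hz
    have e1 := congrArg Complex.re he
    have e2 := congrArg Complex.im he
    simp only [Complex.smul_re, Complex.smul_im, smul_eq_mul] at e1 e2
    rcases h with h | h
    · apply h
      have : a * dt (q - p) (r - p) = 0 := by
        simp only [dt]; linear_combination (r - p).im * e1 - (r - p).re * e2
      rcases mul_eq_zero.1 this with h | h
      · linarith
      · exact h
    · have : a * dp (q - p) (r - p) = b * dp (r - p) (r - p) := by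
        simp only [dp]; linear_combination (r - p).re * e1 + (r - p).im * e2
      nlinarith [mul_pos hb0 hr', mul_neg_of_pos_of_neg ha0 h]

lemma share_ev {F : Filter ℝ} {P Q R : ℝ → ℂ} {p q r : ℂ} (hP : Tendsto P F (𝓝 p))
    (hQ : Tendsto Q F (𝓝 q)) (hR : Tendsto R F (𝓝 r)) (hq : p ≠ q) (hr : p ≠ r)
    (h : segment ℝ p q ∩ segment ℝ p r ⊆ {p}) :
    ∀ᶠ e in F, segment ℝ (P e) (Q e) ∩ segment ℝ (P e) (R e) ⊆ {P e} := by
  have n1 := (hP.prodMk_nhds hQ).eventually (isOpen_ne_fun continuous_fst continuous_snd |>.mem_nhds (show (p, q) ∈ {x : ℂ × ℂ | x.1 ≠ x.2} from hq))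
  have n2 := (hP.prodMk_nhds hR).eventually (isOpen_ne_fun continuous_fst continuous_snd |>.mem_nhds (show (p, r) ∈ {x : ℂ × ℂ | x.1 ≠ x.2} from hr))
  rcases (share_iff hq hr).1 h with h | h
  · have := (dt_tendsto (hQ.sub hP) (hR.sub hP)).eventually_ne h
    filter_upwards [n1, n2, this] with e h1 h2 h3
    exact (share_iff h1 h2).2 (Or.inl h3)
  · have := (dp_tendsto (hQ.sub hP) (hR.sub hP)).eventually_lt_const h
    filter_upwards [n1, n2, this] with e h1 h2 h3
    exact (share_iff h1 h2).2 (Or.inr h3)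

lemma dt_seg {d o x y z : ℂ} (hz : z ∈ segment ℝ x y) :
    ∃ θ : ℝ, 0 ≤ θ ∧ θ ≤ 1 ∧ z = x + θ • (y - x) ∧
      dt d (z - o) = (1 - θ) * dt d (x - o) + θ * dt d (y - o) := by
  obtain ⟨θ, h0, h1, rfl⟩ := mem_sg.1 hz
  refine ⟨θ, h0, h1, rfl, ?_⟩
  simp only [dt, Complex.sub_re, Complex.sub_im, Complex.add_re, Complex.add_im, Complex.smul_re,
    Complex.smul_im, smul_eq_mul]
  ring

lemma side_pos {d o x y z : ℂ} (k : ℝ) (hz : z ∈ segment ℝ x y) (hx : 0 < k * dt d (x - o))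
    (hy : 0 < k * dt d (y - o)) : 0 < k * dt d (z - o) := by
  obtain ⟨θ, h0, h1, -, h⟩ := dt_seg (d := d) (o := o) hz
  rw [h]
  rcases h0.lt_or_eq with h | h
  · nlinarith [mul_pos h hy, mul_nonneg (by linarith : 0 ≤ 1 - θ) hx.le]
  · subst h; simpa using hx

lemma side_nonneg {d o x y z : ℂ} (k : ℝ) (hz : z ∈ segment ℝ x y) (hx : 0 ≤ k * dt d (x - o))
    (hy : 0 ≤ k * dt d (y - o)) : 0 ≤ k * dt d (z - o) := by
  obtain ⟨θ, h0, h1, -, h⟩ := dt_seg (d := d) (o := o) hz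
  rw [h]
  nlinarith [mul_nonneg h0 hy, mul_nonneg (by linarith : 0 ≤ 1 - θ) hx]

/-- The start point may lie on the separating line. -/
lemma side_pos_left {d o x y z : ℂ} (k : ℝ) (hz : z ∈ segment ℝ x y) (hx : 0 ≤ k * dt d (x - o))
    (hy : 0 < k * dt d (y - o)) : z = x ∨ 0 < k * dt d (z - o) := by
  obtain ⟨θ, h0, h1, e, h⟩ := dt_seg (d := d) (o := o) hz
  rw [h]
  rcases h0.lt_or_eq with h | h
  · right
    nlinarith [mul_pos h hy, mul_nonneg (by linarith : 0 ≤ 1 - θ) hx]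
  · subst h; left; simpa using e

lemma side_pos_right {d o x y z : ℂ} (k : ℝ) (hz : z ∈ segment ℝ x y) (hx : 0 < k * dt d (x - o))
    (hy : 0 ≤ k * dt d (y - o)) : z = y ∨ 0 < k * dt d (z - o) := by
  rw [segment_symm] at hz
  exact side_pos_left k hz hy hx

/-- Transversal segments meet at most once. -/
lemma transv_unique {p q r t z z' : ℂ} (h : dt (q - p) (t - r) ≠ 0)
    (h1 : z ∈ segment ℝ p q) (h2 : z ∈ segment ℝ r t) (h1' : z' ∈ segment ℝ p q)
    (h2' : z' ∈ segment ℝ r t) : z = z' := by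
  obtain ⟨a, -, -, rfl⟩ := mem_sg.1 h1
  obtain ⟨b, -, -, hb⟩ := mem_sg.1 h2
  obtain ⟨a', -, -, rfl⟩ := mem_sg.1 h1'
  obtain ⟨b', -, -, hb'⟩ := mem_sg.1 h2'
  have e : (a - a') • (q - p) = (b - b') • (t - r) := by
    simp only [Complex.real_smul] at *; push_cast
    linear_combination hb - hb'
  have e1 := congrArg Complex.re e
  have e2 := congrArg Complex.im e
  simp only [Complex.smul_re, Complex.smul_im, smul_eq_mul] at e1 e2
  have : (a - a') * dt (q - p) (t - r) = 0 := by
    simp only [dt]; linear_combination (t - r).im * e1 - (t - r).re * e2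
  rcases mul_eq_zero.1 this with h' | h'
  · rw [sub_eq_zero.1 h']
  · exact absurd h' h

/-- A common left direction at a bend. -/
lemma exists_bend {d e : ℂ} (hd : d ≠ 0) (he : e ≠ 0) (h : dt d e ≠ 0 ∨ 0 < dp d e) :
    ∃ w, 0 < dt d w ∧ 0 < dt e w := by
  -- w = I * (|e| d + |d| e)
  have hd' : 0 < dp d d := by
    have h2 : dp d d = Complex.normSq d := by simp [dp, Complex.normSq_apply]
    rw [h2]; exact Complex.normSq_pos.2 hd
  have he' : 0 < dp e e := by
    have h2 : dp e e = Complex.normSq e := by simp [dp, Complex.normSq_apply]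
    rw [h2]; exact Complex.normSq_pos.2 he
  set A := Real.sqrt (dp d d) with hA
  set B := Real.sqrt (dp e e) with hB
  have hA0 : 0 < A := Real.sqrt_pos.2 hd'
  have hB0 : 0 < B := Real.sqrt_pos.2 he'
  have hA2 : A * A = dp d d := Real.mul_self_sqrt hd'.le
  have hB2 : B * B = dp e e := Real.mul_self_sqrt he'.le
  have key : 0 < A * B + dp d e := by
    rcases h with h | h
    · have hid : dp d e * dp d e + dt d e * dt d e = (A * B) * (A * B) := by
        rw [show A * B * (A * B) = (A * A) * (B * B) by ring, hA2, hB2]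
        simp only [dp, dt]; ring
      have h2 : 0 < dt d e * dt d e := mul_self_pos.2 h
      have h3 : |dp d e| < |A * B| := by
        rw [← sq_lt_sq]; nlinarith
      rw [abs_of_pos (mul_pos hA0 hB0)] at h3
      linarith [(abs_lt.1 h3).1]
    · positivity
  refine ⟨Complex.I * (B • d + A • e), ?_, ?_⟩
  · have : dt d (Complex.I * (B • d + A • e)) = A * (A * B + dp d e) := by
      rw [show A * (A * B + dp d e) = (A * A) * B + A * dp d e by ring, hA2]; simp [dt, dp]; ring
    rw [this]; positivity
  · have : dt e (Complex.I * (B • d + A • e)) = B * (A * B + dp d e) := by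
      rw [show B * (A * B + dp d e) = (B * B) * A + B * dp d e by ring, hB2]; simp [dt, dp]; ring
    rw [this]; positivity

end CrAux

namespace CrAux

/-! ## Polygonal drawings in general position -/

/-- A polygonal drawing in general position: every edge is a simple polygonal chain. -/
structure PD (V E : Type) where
  pos : V → ℂ
  s : E → V
  t : E → V
  N : E → ℕ
  ch : E → ℕ → ℂ
  pos_inj : Function.Injective pos
  st : ∀ e, s e ≠ t e
  Npos : ∀ e, 0 < N e
  ch_zero : ∀ e, ch e 0 = pos (s e)
  ch_N : ∀ e, ch e (N e) = pos (t e)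
  sep : ∀ e i j, i + 1 < j → j < N e →
    Disjoint (segment ℝ (ch e i) (ch e (i + 1))) (segment ℝ (ch e j) (ch e (j + 1)))
  adj : ∀ e i, i + 1 < N e →
    segment ℝ (ch e i) (ch e (i + 1)) ∩ segment ℝ (ch e (i + 1)) (ch e (i + 1 + 1)) ⊆ {ch e (i + 1)}
  ne : ∀ e i, i < N e → ch e i ≠ ch e (i + 1)
  avoid : ∀ e v i, i < N e → pos v ∈ segment ℝ (ch e i) (ch e (i + 1)) → v = s e ∨ v = t e
  pair : ∀ e f, e ≠ f → ∀ i j z, i < N e → j < N f → z ∈ segment ℝ (ch e i) (ch e (i + 1)) →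
    z ∈ segment ℝ (ch f j) (ch f (j + 1)) → (∃ v, z = pos v) ∨
    (dt (ch e (i + 1) - ch e i) (ch f (j + 1) - ch f j) ≠ 0 ∧
      (s e ≠ s f ∧ s e ≠ t f ∧ t e ≠ s f ∧ t e ≠ t f) ∧
      ∀ i' j', i' < N e → j' < N f → (segment ℝ (ch e i') (ch e (i' + 1)) ∩
        segment ℝ (ch f j') (ch f (j' + 1))).Nonempty → i' = i ∧ j' = j)
  triple : ∀ e f g, e ≠ f → e ≠ g → f ≠ g → ∀ i j k z, i < N e → j < N f → k < N g →
    z ∈ segment ℝ (ch e i) (ch e (i + 1)) → z ∈ segment ℝ (ch f j) (ch f (j + 1)) →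
    z ∈ segment ℝ (ch g k) (ch g (k + 1)) → ∃ v, z = pos v

namespace PD
variable {V E : Type} (D : PD V E)

/-- A segment of an edge. -/
abbrev sg (e : E) (i : ℕ) : Set ℂ := segment ℝ (D.ch e i) (D.ch e (i + 1))

/-- The point set of an edge. -/
def K (e : E) : Set ℂ := {z | ∃ i < D.N e, z ∈ D.sg e i}

lemma end_s {e : E} {i : ℕ} (hi : i < D.N e) (h : D.pos (D.s e) ∈ D.sg e i) : i = 0 := by
  rw [← D.ch_zero] at h
  have h0 : D.ch e 0 ∈ D.sg e 0 := left_mem_segment _ _ _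
  rcases i with _ | _ | i
  · rfl
  · have := D.adj e 0 hi ⟨h0, h⟩
    exact absurd this (D.ne e 0 (by omega))
  · exact absurd h (Set.disjoint_left.1 (D.sep e 0 (i + 2) (by omega) hi) h0)

lemma end_t {e : E} {i : ℕ} (hi : i < D.N e) (h : D.pos (D.t e) ∈ D.sg e i) : i + 1 = D.N e := by
  rw [← D.ch_N] at h
  obtain ⟨n, hn⟩ : ∃ n, D.N e = n + 1 := ⟨D.N e - 1, by have := D.Npos e; omega⟩
  rw [hn] at h
  have h0 : D.ch e (n + 1) ∈ D.sg e n := right_mem_segment _ _ _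
  by_contra hc
  rcases Nat.lt_or_ge (i + 1) n with h1 | h1
  · exact Set.disjoint_left.1 (D.sep e i n h1 (by omega)) h h0
  · have : n = i + 1 := by omega
    subst this
    have := D.adj e i (by omega) ⟨h, h0⟩
    exact D.ne e (i + 1) (by omega) this.symm

/-- common points of edges sharing an end -/
lemma common {e f : E} (hef : e ≠ f) {i j : ℕ} {z : ℂ} (hi : i < D.N e) (hj : j < D.N f)
    (h1 : z ∈ D.sg e i) (h2 : z ∈ D.sg f j)
    (hsh : D.s e = D.s f ∨ D.s e = D.t f ∨ D.t e = D.s f ∨ D.t e = D.t f) :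
    ∃ v, z = D.pos v ∧ (v = D.s e ∨ v = D.t e) ∧ (v = D.s f ∨ v = D.t f) := by
  rcases D.pair e f hef i j z hi hj h1 h2 with ⟨v, rfl⟩ | ⟨-, h, -⟩
  · exact ⟨v, rfl, D.avoid e v i hi h1, D.avoid f v j hj h2⟩
  · tauto

lemma star {a : V} (ha : ∀ e, D.t e ≠ a) {e f : E} (hef : e ≠ f) (he : D.s e = a) (hf : D.s f = a)
    (ht : D.t e ≠ D.t f) {i j : ℕ} {z : ℂ} (hi : i < D.N e) (hj : j < D.N f)
    (h1 : z ∈ D.sg e i) (h2 : z ∈ D.sg f j) : z = D.pos a ∧ i = 0 ∧ j = 0 := by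
  obtain ⟨v, rfl, h3, h4⟩ := D.common hef hi hj h1 h2 (Or.inl (he.trans hf.symm))
  have hv : v = a := by
    rcases h3 with h | h
    · rw [h, he]
    · rcases h4 with h' | h'
      · rw [h', hf]
      · exact absurd (h.symm.trans h') ht
  subst hv
  exact ⟨rfl, D.end_s hi (he ▸ h1), D.end_s hj (hf ▸ h2)⟩

end PD

lemma evN {F : Filter ℝ} {n : ℕ} {P : ℕ → ℝ → Prop} (h : ∀ i < n, ∀ᶠ e in F, P i e) :
    ∀ᶠ e in F, ∀ i < n, P i e :=
  (Filter.eventually_all_finite (Set.finite_lt_nat n)).2 h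

lemma evN2 {F : Filter ℝ} {n m : ℕ} {P : ℕ → ℕ → ℝ → Prop} (h : ∀ i < n, ∀ j < m, ∀ᶠ e in F, P i j e) :
    ∀ᶠ e in F, ∀ i < n, ∀ j < m, P i j e :=
  evN fun i hi => evN fun j hj => h i hi j hj

section dup
variable {V E : Type} (D : PD V E)

/-- Offset data along an edge. -/
structure Off (u : ℂ) (x : E) (w : ℕ → ℂ) (k : ℝ) : Prop where
  w0 : w 0 = u
  wN : w (D.N x) = 0
  left : ∀ i < D.N x, 0 < k * dt (D.ch x (i + 1) - D.ch x i) (w i)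
  right : ∀ i, i + 1 < D.N x → 0 < k * dt (D.ch x (i + 1) - D.ch x i) (w (i + 1))

lemma exists_off (u : ℂ) (x : E) (hu : dt u (D.ch x 1 - D.ch x 0) ≠ 0) :
    ∃ w k, Off D u x w k := by
  have hanti : ∀ v w : ℂ, dt v w = - dt w v := fun v w => by simp only [dt]; ring
  obtain ⟨k, hk, hk0⟩ : ∃ k : ℝ, 0 < k * dt (D.ch x 1 - D.ch x 0) u ∧ k ≠ 0 := by
    rw [hanti] at hu
    have : dt (D.ch x 1 - D.ch x 0) u ≠ 0 := by intro h; apply hu; rw [h]; simp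
    exact ⟨dt (D.ch x 1 - D.ch x 0) u, mul_self_pos.2 this, this⟩
  have hb : ∀ i, ∃ w : ℂ, i + 1 < D.N x → 0 < k * dt (D.ch x (i + 1) - D.ch x i) w ∧
      0 < k * dt (D.ch x (i + 1 + 1) - D.ch x (i + 1)) w := by
    intro i
    by_cases hi : i + 1 < D.N x
    · have n1 := D.ne x i (by omega)
      have n2 := D.ne x (i + 1) hi
      have h := D.adj x i hi
      rw [segment_symm] at h
      have := (share_iff n1.symm n2).1 h
      have e1 : dt (D.ch x i - D.ch x (i + 1)) (D.ch x (i + 1 + 1) - D.ch x (i + 1)) =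
        - dt (D.ch x (i + 1) - D.ch x i) (D.ch x (i + 1 + 1) - D.ch x (i + 1)) := by
          simp [dt]; ring
      have e2 : dp (D.ch x i - D.ch x (i + 1)) (D.ch x (i + 1 + 1) - D.ch x (i + 1)) =
        - dp (D.ch x (i + 1) - D.ch x i) (D.ch x (i + 1 + 1) - D.ch x (i + 1)) := by
          simp [dp]; ring
      rw [e1, e2] at this
      obtain ⟨w, h1, h2⟩ := exists_bend (sub_ne_zero.2 n1.symm) (sub_ne_zero.2 n2.symm)
        (this.imp (by intro h h'; apply h; rw [h']; simp) (by intro h; linarith))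
      refine ⟨(SignType.sign k : ℝ) • w, fun _ => ?_⟩
      have hs : ∀ v, k * dt v ((SignType.sign k : ℝ) • w) = |k| * dt v w := by
        intro v
        have hk2 : k * (SignType.sign k : ℝ) = |k| := self_mul_sign k
        simp only [dt, Complex.smul_re, Complex.smul_im, smul_eq_mul]
        linear_combination (v.re * w.im - v.im * w.re) * hk2
      rw [hs, hs]
      exact ⟨mul_pos (abs_pos.2 hk0) h1, mul_pos (abs_pos.2 hk0) h2⟩
    · exact ⟨0, fun h => absurd h hi⟩
  choose W hW using hb
  refine ⟨fun i => if i = 0 then u else if i = D.N x then 0 else W (i - 1), k, ?_, ?_, ?_, ?_⟩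
  · simp
  · have := D.Npos x; simp [this.ne']
  · intro i hi
    rcases i with _ | i
    · simpa using hk
    · simpa [hi.ne] using (hW i hi).2
  · intro i hi
    simpa [hi.ne] using (hW i hi).1

variable {D}
variable {a : V} {u : ℂ} {x : E} {w : ℕ → ℂ} {k : ℝ}

lemma tw (p w : ℂ) : Tendsto (fun ε : ℝ => p + ε • w) (𝓝[>] 0) (𝓝 p) := by
  have : Continuous (fun ε : ℝ => p + ε • w) := by fun_prop
  have h := this.tendsto 0
  simp only [zero_smul, add_zero] at h
  exact h.mono_left nhdsWithin_le_nhds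

lemma tc (p : ℂ) : Tendsto (fun _ : ℝ => p) (𝓝[>] 0) (𝓝 p) := tendsto_const_nhds

lemma evpos : ∀ᶠ ε : ℝ in 𝓝[>] 0, 0 < ε := eventually_mem_nhdsWithin

/-- Offset segment. -/
abbrev osg (D : PD V E) (x : E) (w : ℕ → ℂ) (ε : ℝ) (i : ℕ) : Set ℂ :=
  segment ℝ (D.ch x i + ε • w i) (D.ch x (i + 1) + ε • w (i + 1))

lemma F1 (x : E) (w : ℕ → ℂ) : ∀ᶠ ε : ℝ in 𝓝[>] 0, ∀ i < D.N x, ∀ j < D.N x, i + 1 < j →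
    Disjoint (osg D x w ε i) (osg D x w ε j) := by
  refine evN2 fun i hi j hj => ?_
  by_cases h : i + 1 < j
  · filter_upwards [seg_disj_ev (tw _ _) (tw _ _) (tw _ _) (tw _ _) (D.sep x i j h hj)] with ε h1 _
    exact h1
  · exact Eventually.of_forall fun ε h' => absurd h' h

lemma F2 (x : E) (w : ℕ → ℂ) : ∀ᶠ ε : ℝ in 𝓝[>] 0, ∀ i < D.N x, i + 1 < D.N x →
    osg D x w ε i ∩ osg D x w ε (i + 1) ⊆ {D.ch x (i + 1) + ε • w (i + 1)} := by
  refine evN fun i hi => ?_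
  by_cases h : i + 1 < D.N x
  · have h0 := D.adj x i h
    rw [segment_symm] at h0
    filter_upwards [share_ev (tw _ (w (i + 1))) (tw _ (w i)) (tw _ (w (i + 1 + 1))) (D.ne x i hi).symm
      (D.ne x (i + 1) h) h0] with ε h1 _
    rw [osg, segment_symm]
    exact h1
  · exact Eventually.of_forall fun ε h' => absurd h' h

lemma F3 (x : E) (w : ℕ → ℂ) : ∀ᶠ ε : ℝ in 𝓝[>] 0, ∀ i < D.N x,
    D.ch x i + ε • w i ≠ D.ch x (i + 1) + ε • w (i + 1) := by
  refine evN fun i hi => ?_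
  have := pt_seg_ev (tw (D.ch x i) (w i)) (tw (D.ch x i) (w i)) (tw (D.ch x (i + 1)) (w (i + 1)))
    (by rw [segment_same]; simpa using (D.ne x i hi).symm)
  filter_upwards [this] with ε h
  rw [segment_same] at h
  intro h'; exact h h'.symm

/-- basic position of the first offset segment w.r.t. the line through `a` in direction `u` -/
lemma F0 (hx : D.s x = a) (hu : dt u (D.ch x 1 - D.ch x 0) ≠ 0) (hw : Off D u x w k) :
    ∀ᶠ ε : ℝ in 𝓝[>] 0, ∀ z ∈ osg D x w ε 0, z = D.pos a + ε • u ∨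
      0 < dt u (D.ch x 1 - D.ch x 0) * dt u (z - D.pos a) := by
  have h1 : Tendsto (fun ε : ℝ => dt u (D.ch x 1 - D.ch x 0) * dt u (D.ch x 1 + ε • w 1 - D.pos a))
      (𝓝[>] 0) (𝓝 (dt u (D.ch x 1 - D.ch x 0) * dt u (D.ch x 1 - D.pos a))) :=
    (dt_tendsto (tc u) ((tw _ _).sub (tc _))).const_mul _
  have h0 : D.ch x 0 = D.pos a := by rw [D.ch_zero, hx]
  have h2 : 0 < dt u (D.ch x 1 - D.ch x 0) * dt u (D.ch x 1 - D.pos a) := by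
    rw [← h0]; exact mul_self_pos.2 hu
  filter_upwards [h1.eventually_const_lt h2] with ε h3 z hz
  have := side_pos_left (d := u) (o := D.pos a) (dt u (D.ch x 1 - D.ch x 0)) hz ?_ h3
  · rw [h0, hw.w0] at this; rw [h0]; exact this
  · rw [hw.w0, h0]
    have : dt u (D.pos a + ε • u - D.pos a) = 0 := by simp [dt]; ring
    rw [this]; simp

lemma a_notin_succ (hx : D.s x = a) {i : ℕ} (hi : i + 1 < D.N x) : D.pos a ∉ D.sg x (i + 1) := by
  intro h
  have := D.end_s hi (hx.symm ▸ h)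
  omega

lemma a_notin (ha : ∀ e, D.t e ≠ a) {f : E} (hf : D.s f ≠ a) {i : ℕ} (hi : i < D.N f) :
    D.pos a ∉ D.sg f i := by
  intro h
  rcases D.avoid f a i hi h with h | h
  · exact hf h.symm
  · exact ha f h.symm

lemma F4 (hx : D.s x = a) (hu : dt u (D.ch x 1 - D.ch x 0) ≠ 0) (hw : Off D u x w k) (v : V)
    (hv : v ≠ D.t x) :
    ∀ᶠ ε : ℝ in 𝓝[>] 0, ∀ i < D.N x, D.pos v ∉ osg D x w ε i := by
  have hu0 : u ≠ 0 := by rintro rfl; simp [dt] at hu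
  by_cases hva : v = a
  · subst hva
    have : ∀ᶠ ε : ℝ in 𝓝[>] 0, ∀ i < D.N x, i ≠ 0 → D.pos v ∉ osg D x w ε i := by
      refine evN fun i hi => ?_
      rcases i with _ | i
      · simp
      · filter_upwards [pt_seg_ev (tw _ (w (i + 1))) (tw _ (w (i + 1 + 1))) (tc _) (a_notin_succ hx hi)] with ε h _
        exact h
    filter_upwards [this, F0 hx hu hw, evpos] with ε h1 h2 h3 i hi
    rcases i with _ | i
    · intro hz
      rcases h2 _ hz with h | h
      · have : ε • u = 0 := by simpa using h
        rcases smul_eq_zero.1 this with h | h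
        · exact h3.ne' h
        · exact hu0 h
      · simp [dt] at h
    · exact h1 _ hi (by omega)
  · refine evN fun i hi => pt_seg_ev (tw _ _) (tw _ _) (tc _) ?_
    intro h
    rcases D.avoid x v i hi h with h | h
    · exact hva (h.trans hx)
    · exact hv h

/-- an edge direction at `a` is not on the ray of `u` -/
def NR (D : PD V E) (u : ℂ) (f : E) : Prop :=
  dt u (D.ch f 1 - D.ch f 0) ≠ 0 ∨ ∃ c : ℝ, 0 < c ∧ D.ch f 1 - D.ch f 0 = -(c • u)

lemma NR_key {f : E} (hu : u ≠ 0) (h : NR D u f) {p q : ℝ} (hp : 0 ≤ p) (hq : 0 ≤ q)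
    (he : p • u = q • (D.ch f 1 - D.ch f 0)) : p = 0 ∧ q = 0 := by
  have hq0 : q = 0 := by
    rcases h with h | ⟨c, hc, h⟩
    · have e1 := congrArg Complex.re he
      have e2 := congrArg Complex.im he
      simp only [Complex.smul_re, Complex.smul_im, smul_eq_mul] at e1 e2
      have : q * dt u (D.ch f 1 - D.ch f 0) = 0 := by
        simp only [dt]; linear_combination u.im * e1 - u.re * e2
      exact (mul_eq_zero.1 this).resolve_right h
    · rw [h] at he
      have : (p + q * c) • u = 0 := by
        rw [add_smul, he, mul_smul]; simp
      have := (smul_eq_zero.1 this).resolve_right hu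
      nlinarith [mul_nonneg hq hc.le]
  subst hq0
  refine ⟨?_, rfl⟩
  rw [zero_smul] at he
  exact (smul_eq_zero.1 he).resolve_right hu

/-- the little segment `[a, a + ε u]` against old edges -/
lemma F12 (hu : u ≠ 0) {f : E} (hf : D.s f = a) (hn : NR D u f) :
    ∀ᶠ ε : ℝ in 𝓝[>] 0, ∀ i < D.N f, ∀ z ∈ segment ℝ (D.pos a) (D.pos a + ε • u),
      z ∈ D.sg f i → z = D.pos a := by
  refine evN fun i hi => ?_
  rcases i with _ | i
  · filter_upwards [evpos] with ε hε z h1 h2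
    obtain ⟨p, hp, -, rfl⟩ := mem_sg.1 h1
    obtain ⟨q, hq, -, h⟩ := mem_sg.1 h2
    rw [D.ch_zero, hf] at h
    have := (NR_key (D := D) (f := f) hu hn (p := p * ε) (q := q) (by positivity) hq (by
      rw [D.ch_zero, hf]
      have := add_left_cancel h
      rw [← this, mul_smul]; simp)).1
    rw [add_sub_cancel_left, ← mul_smul, this]; simp
  · have := seg_disj_ev (tc (D.pos a)) (tw (D.pos a) u) (tc (D.ch f (i + 1))) (tc (D.ch f (i + 1 + 1)))
      (by rw [segment_same]; simpa using (a_notin_succ hf hi))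
    filter_upwards [this] with ε h z h1 h2
    exact absurd h2 (Set.disjoint_left.1 h h1)

lemma F11 (ha : ∀ e, D.t e ≠ a) {f : E} (hf : D.s f ≠ a) :
    ∀ᶠ ε : ℝ in 𝓝[>] 0, ∀ i < D.N f, ∀ z ∈ segment ℝ (D.pos a) (D.pos a + ε • u), z ∉ D.sg f i := by
  refine evN fun i hi => ?_
  have := seg_disj_ev (tc (D.pos a)) (tw (D.pos a) u) (tc (D.ch f i)) (tc (D.ch f (i + 1)))
      (by rw [segment_same]; simpa using (a_notin ha hf hi))
  filter_upwards [this] with ε h z h1 h2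
  exact absurd h2 (Set.disjoint_left.1 h h1)

lemma F5 (hu : u ≠ 0) (ha : ∀ e, D.t e ≠ a) {f : E} (hn : D.s f = a → NR D u f) :
    ∀ᶠ ε : ℝ in 𝓝[>] 0, ∀ i < D.N f, D.pos a + ε • u ∉ D.sg f i := by
  by_cases hf : D.s f = a
  · filter_upwards [F12 hu hf (hn hf), evpos] with ε h hε i hi h1
    have := h i hi _ (right_mem_segment _ _ _) h1
    have : ε • u = 0 := by simpa using this
    rcases smul_eq_zero.1 this with h | h
    · exact hε.ne' h
    · exact hu h
  · filter_upwards [F11 (u := u) ha hf] with ε h i hi h1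
    exact h i hi _ (right_mem_segment _ _ _) h1

lemma F5' (hu : u ≠ 0) (v : V) : ∀ᶠ ε : ℝ in 𝓝[>] 0, D.pos a + ε • u ≠ D.pos v := by
  by_cases hv : v = a
  · subst hv
    filter_upwards [evpos] with ε hε h
    have : ε • u = 0 := by simpa using h
    rcases smul_eq_zero.1 this with h | h
    · exact hε.ne' h
    · exact hu h
  · exact (tw (D.pos a) u).eventually_ne (fun h => hv (D.pos_inj h).symm)

lemma F13 (hx : D.s x = a) (hu : dt u (D.ch x 1 - D.ch x 0) ≠ 0) (hw : Off D u x w k) :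
    ∀ᶠ ε : ℝ in 𝓝[>] 0, ∀ i < D.N x, ∀ z ∈ segment ℝ (D.pos a) (D.pos a + ε • u),
      z ∈ osg D x w ε i → z = D.pos a + ε • u := by
  refine evN fun i hi => ?_
  rcases i with _ | i
  · filter_upwards [F0 hx hu hw] with ε h z h1 h2
    rcases h z h2 with h | h
    · exact h
    · obtain ⟨p, hp, -, rfl⟩ := mem_sg.1 h1
      have : dt u (D.pos a + p • (D.pos a + ε • u - D.pos a) - D.pos a) = 0 := by
        simp [dt]; ring
      rw [this] at h; simp at h
  · have := seg_disj_ev (tc (D.pos a)) (tw (D.pos a) u) (tw (D.ch x (i + 1)) (w (i + 1)))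
      (tw (D.ch x (i + 1 + 1)) (w (i + 1 + 1)))
      (by rw [segment_same]; simpa using (a_notin_succ hx hi))
    filter_upwards [this] with ε h z h1 h2
    exact absurd h2 (Set.disjoint_left.1 h h1)

lemma F6 (ha : ∀ e, D.t e ≠ a) {y : E} {w' : ℕ → ℂ} {k' : ℝ} (hxy : x ≠ y) (ht : D.t x ≠ D.t y)
    (hx : D.s x = a) (hy : D.s y = a) (hw : Off D u x w k) (hw' : Off D u y w' k') :
    ∀ᶠ ε : ℝ in 𝓝[>] 0, ∀ i < D.N x, ∀ j < D.N y, ∀ z ∈ osg D x w ε i, z ∈ osg D y w' ε j →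
      z = D.pos a + ε • u := by
  refine evN2 fun i hi j hj => ?_
  by_cases h : i = 0 ∧ j = 0
  · obtain ⟨rfl, rfl⟩ := h
    have h0 : D.ch x 0 = D.pos a := by rw [D.ch_zero, hx]
    have h0' : D.ch y 0 = D.pos a := by rw [D.ch_zero, hy]
    have := share_ev (tw (D.pos a) u) (tw (D.ch x 1) (w 1)) (tw (D.ch y 1) (w' 1))
      (by rw [← h0]; exact D.ne x 0 hi) (by rw [← h0']; exact D.ne y 0 hj) (by
        rintro z ⟨h1, h2⟩
        exact (D.star ha hxy hx hy ht hi hj (z := z) (by rw [PD.sg, h0]; exact h1)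
          (by rw [PD.sg, h0']; exact h2)).1)
    filter_upwards [this] with ε h z h1 h2
    rw [osg, h0, hw.w0] at h1
    rw [osg, h0', hw'.w0] at h2
    exact h ⟨h1, h2⟩
  · have := seg_disj_ev (tw (D.ch x i) (w i)) (tw (D.ch x (i + 1)) (w (i + 1)))
      (tw (D.ch y j) (w' j)) (tw (D.ch y (j + 1)) (w' (j + 1))) (by
        rw [Set.disjoint_left]
        intro z h1 h2
        exact h (D.star ha hxy hx hy ht hi hj h1 h2).2)
    filter_upwards [this] with ε h z h1 h2
    exact absurd h2 (Set.disjoint_left.1 h h1)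

end dup
end CrAux

namespace CrAux
section dup
variable {V E : Type} {D : PD V E}
variable {a : V} {u : ℂ} {x : E} {w : ℕ → ℂ} {k : ℝ}

lemma dt_self_add (d o : ℂ) (θ : ℝ) : dt d (o + θ • d - o) = 0 := by
  simp [dt]; ring

lemma dt_off (ε k : ℝ) (d w o : ℂ) : ε * (k * dt d w) = k * dt d (o + ε • w - o) := by
  simp only [dt, add_sub_cancel_left, Complex.smul_re, Complex.smul_im, smul_eq_mul]; ring

lemma dt_off2 (ε k : ℝ) (d w o : ℂ) : ε * (k * dt d w) = k * dt d (o + d + ε • w - o) := by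
  simp only [dt, Complex.add_re, Complex.add_im, Complex.sub_re, Complex.sub_im,
    Complex.smul_re, Complex.smul_im, smul_eq_mul]; ring

lemma G1 (hw : Off D u x w k) {ε : ℝ} (hε : 0 < ε) {i : ℕ} (hi : i < D.N x) {z : ℂ}
    (hz : z ∈ osg D x w ε i) : z = D.ch x (D.N x) ∨
      0 < k * dt (D.ch x (i + 1) - D.ch x i) (z - D.ch x i) := by
  have e1 : k * dt (D.ch x (i + 1) - D.ch x i) (D.ch x i + ε • w i - D.ch x i) =
      ε * (k * dt (D.ch x (i + 1) - D.ch x i) (w i)) := by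
    simp [dt]; ring
  have e2 : k * dt (D.ch x (i + 1) - D.ch x i) (D.ch x (i + 1) + ε • w (i + 1) - D.ch x i) =
      ε * (k * dt (D.ch x (i + 1) - D.ch x i) (w (i + 1))) := by
    simp [dt]; ring
  have h1 := mul_pos hε (hw.left i hi)
  rw [← e1] at h1
  by_cases h : i + 1 < D.N x
  · have h2 := mul_pos hε (hw.right i h)
    rw [← e2] at h2
    exact Or.inr (side_pos k hz h1 h2)
  · have hN : i + 1 = D.N x := by omega
    have h2 : 0 ≤ k * dt (D.ch x (i + 1) - D.ch x i) (D.ch x (i + 1) + ε • w (i + 1) - D.ch x i) := by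
      rw [e2, hN, hw.wN]; simp [dt]
    rcases side_pos_right k hz h1 h2 with h | h
    · left; rw [h, hN, hw.wN]; simp
    · exact Or.inr h

lemma F7 (hw : Off D u x w k) : ∀ᶠ ε : ℝ in 𝓝[>] 0, ∀ i < D.N x, ∀ j < D.N x,
    ∀ z ∈ osg D x w ε i, z ∈ D.sg x j → z = D.pos (D.t x) := by
  refine evN2 fun i hi j hj => ?_
  rw [← D.ch_N]
  rcases lt_trichotomy i j with h | h | h
  · rcases Nat.lt_or_ge (i + 1) j with h' | h'
    · have := seg_disj_ev (tw (D.ch x i) (w i)) (tw (D.ch x (i + 1)) (w (i + 1))) (tc _) (tc _)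
        (D.sep x i j h' hj)
      filter_upwards [this] with ε h z h1 h2
      exact absurd h2 (Set.disjoint_left.1 h h1)
    · obtain rfl : j = i + 1 := by omega
      set T := k * dt (D.ch x (i + 1) - D.ch x i) (D.ch x (i + 1 + 1) - D.ch x (i + 1)) with hT
      rcases le_or_gt T 0 with hT0 | hT0
      · filter_upwards [evpos] with ε hε z h1 h2
        rcases G1 hw hε hi h1 with h3 | h3
        · exact h3
        · exfalso
          obtain ⟨θ, hθ, -, rfl⟩ := mem_sg.1 h2
          have : k * dt (D.ch x (i + 1) - D.ch x i) (D.ch x (i + 1) + θ • (D.ch x (i + 1 + 1) - D.ch x (i + 1)) - D.ch x i) = θ * T := by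
            rw [hT]; simp [dt]; ring
          rw [this] at h3
          nlinarith [mul_nonneg hθ (neg_nonneg.2 hT0)]
      · have l1 : Tendsto (fun ε : ℝ => k * dt (D.ch x (i + 1 + 1) - D.ch x (i + 1))
            (D.ch x i + ε • w i - D.ch x (i + 1))) (𝓝[>] 0) (𝓝 (k * dt (D.ch x (i + 1 + 1) - D.ch x (i + 1)) (D.ch x i - D.ch x (i + 1)))) :=
          (dt_tendsto (tc _) ((tw _ _).sub (tc _))).const_mul _
        have l2 : 0 < k * dt (D.ch x (i + 1 + 1) - D.ch x (i + 1)) (D.ch x i - D.ch x (i + 1)) := by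
          have : k * dt (D.ch x (i + 1 + 1) - D.ch x (i + 1)) (D.ch x i - D.ch x (i + 1)) = T := by
            rw [hT]; simp only [dt, Complex.sub_re, Complex.sub_im, Complex.add_re, Complex.add_im, Complex.smul_re,
              Complex.smul_im, smul_eq_mul]; ring
          rwa [this]
        filter_upwards [evpos, l1.eventually_const_lt l2] with ε hε h3 z h1 h2
        have h4 := mul_pos hε (hw.left (i + 1) hj)
        have := side_pos (d := D.ch x (i + 1 + 1) - D.ch x (i + 1)) (o := D.ch x (i + 1)) k h1 h3 (lt_of_lt_of_eq h4 (dt_off _ _ _ _ _))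
        obtain ⟨θ, hθ, -, rfl⟩ := mem_sg.1 h2
        rw [dt_self_add] at this; simp at this
  · subst h
    filter_upwards [evpos] with ε hε z h1 h2
    rcases G1 hw hε hi h1 with h3 | h3
    · exact h3
    · obtain ⟨θ, hθ, -, rfl⟩ := mem_sg.1 h2
      rw [dt_self_add] at h3; simp at h3
  · rcases Nat.lt_or_ge (j + 1) i with h' | h'
    · have := seg_disj_ev (tw (D.ch x i) (w i)) (tw (D.ch x (i + 1)) (w (i + 1))) (tc _) (tc _)
        (D.sep x j i h' hi).symm
      filter_upwards [this] with ε h z h1 h2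
      exact absurd h2 (Set.disjoint_left.1 h h1)
    · obtain rfl : i = j + 1 := by omega
      set T := k * dt (D.ch x (j + 1) - D.ch x j) (D.ch x (j + 1 + 1) - D.ch x (j + 1)) with hT
      rcases le_or_gt T 0 with hT0 | hT0
      · filter_upwards [evpos] with ε hε z h1 h2
        rcases G1 hw hε hi h1 with h3 | h3
        · exact h3
        · exfalso
          obtain ⟨θ, hθ, hθ1, rfl⟩ := mem_sg.1 h2
          have : k * dt (D.ch x (j + 1 + 1) - D.ch x (j + 1)) (D.ch x j + θ • (D.ch x (j + 1) - D.ch x j) - D.ch x (j + 1)) = (1 - θ) * T := by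
            rw [hT]; simp [dt]; ring
          rw [this] at h3
          nlinarith [mul_nonneg (sub_nonneg.2 hθ1) (neg_nonneg.2 hT0)]
      · have l1 : Tendsto (fun ε : ℝ => k * dt (D.ch x (j + 1) - D.ch x j)
            (D.ch x (j + 1 + 1) + ε • w (j + 1 + 1) - D.ch x j)) (𝓝[>] 0) (𝓝 (k * dt (D.ch x (j + 1) - D.ch x j) (D.ch x (j + 1 + 1) - D.ch x j))) :=
          (dt_tendsto (tc _) ((tw _ _).sub (tc _))).const_mul _
        have l2 : 0 < k * dt (D.ch x (j + 1) - D.ch x j) (D.ch x (j + 1 + 1) - D.ch x j) := by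
          have : k * dt (D.ch x (j + 1) - D.ch x j) (D.ch x (j + 1 + 1) - D.ch x j) = T := by
            rw [hT]; simp only [dt, Complex.sub_re, Complex.sub_im, Complex.add_re, Complex.add_im, Complex.smul_re,
              Complex.smul_im, smul_eq_mul]; ring
          rwa [this]
        filter_upwards [evpos, l1.eventually_const_lt l2] with ε hε h3 z h1 h2
        have h4 := mul_pos hε (hw.right j hi)
        have := side_pos (d := D.ch x (j + 1) - D.ch x j) (o := D.ch x j) k h1 (by
          have e := dt_off2 ε k (D.ch x (j + 1) - D.ch x j) (w (j + 1)) (D.ch x j)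
          rw [add_sub_cancel] at e
          exact lt_of_lt_of_eq h4 e) h3
        obtain ⟨θ, hθ, -, rfl⟩ := mem_sg.1 h2
        rw [dt_self_add] at this; simp at this

lemma F8 (ha : ∀ e, D.t e ≠ a) (hx : D.s x = a) (hw : Off D u x w k) {f : E} (hf : D.s f ≠ a)
    (hfx : x ≠ f) (ht : D.t x = D.s f ∨ D.t x = D.t f) :
    ∀ᶠ ε : ℝ in 𝓝[>] 0, ∀ i < D.N x, ∀ j < D.N f,
    ∀ z ∈ osg D x w ε i, z ∈ D.sg f j → z = D.pos (D.t x) := by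
  refine evN2 fun i hi j hj => ?_
  have base : ∀ z, z ∈ D.sg x i → z ∈ D.sg f j → z = D.pos (D.t x) := by
    intro z h1 h2
    obtain ⟨v, rfl, h3, h4⟩ := D.common hfx hi hj h1 h2 (by tauto)
    rcases h3 with h | h
    · exfalso
      rcases h4 with h' | h'
      · exact hf (h'.symm.trans (h.trans hx))
      · exact ha f (h'.symm.trans (h.trans hx))
    · rw [h]
  by_cases hz : (D.sg x i ∩ D.sg f j).Nonempty
  · obtain ⟨z, h1, h2⟩ := hz
    obtain rfl := base z h1 h2
    have hN := D.end_t hi h1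
    obtain ⟨q, hq, hsg⟩ : ∃ q, D.pos (D.t x) ≠ q ∧ D.sg f j = segment ℝ (D.pos (D.t x)) q := by
      rcases ht with h | h
      · rw [h] at h2
        have := D.end_s hj h2
        subst this
        refine ⟨D.ch f 1, ?_, ?_⟩
        · rw [h, ← D.ch_zero]; exact D.ne f 0 hj
        · rw [h, ← D.ch_zero]
      · rw [h] at h2
        have := D.end_t hj h2
        refine ⟨D.ch f j, ?_, ?_⟩
        · rw [h, ← D.ch_N, ← this]; exact (D.ne f j hj).symm
        · rw [h, ← D.ch_N, ← this, segment_symm]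
    have hc : D.ch x (i + 1) = D.pos (D.t x) := by rw [hN, D.ch_N]
    have := share_ev (tc (D.pos (D.t x))) (tw (D.ch x i) (w i)) (tc q)
      (by rw [← hc]; exact (D.ne x i hi).symm) hq (by
        rintro z ⟨h1, h2⟩
        refine base z ?_ (by rw [hsg]; exact h2)
        rw [PD.sg, hc, segment_symm]; exact h1)
    filter_upwards [this] with ε h z h1 h2
    rw [osg, hc, hN, hw.wN, segment_symm, smul_zero, add_zero] at h1
    rw [hsg] at h2
    exact h ⟨h1, h2⟩
  · have := seg_disj_ev (tw (D.ch x i) (w i)) (tw (D.ch x (i + 1)) (w (i + 1))) (tc (D.ch f j)) (tc (D.ch f (j + 1)))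
      (Set.disjoint_iff_inter_eq_empty.2 (Set.not_nonempty_iff_eq_empty.1 hz))
    filter_upwards [this] with ε h z h1 h2
    exact absurd h2 (Set.disjoint_left.1 h h1)

lemma F9 (x : E) (w : ℕ → ℂ) {f : E} (hfx : x ≠ f)
    (hna : D.s x ≠ D.s f ∧ D.s x ≠ D.t f ∧ D.t x ≠ D.s f ∧ D.t x ≠ D.t f) :
    ∀ᶠ ε : ℝ in 𝓝[>] 0, ∀ i < D.N x, ∀ j < D.N f,
      (osg D x w ε i ∩ D.sg f j).Nonempty → (D.sg x i ∩ D.sg f j).Nonempty ∧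
      dt (D.ch x (i + 1) + ε • w (i + 1) - (D.ch x i + ε • w i)) (D.ch f (j + 1) - D.ch f j) ≠ 0 := by
  refine evN2 fun i hi j hj => ?_
  by_cases hz : (D.sg x i ∩ D.sg f j).Nonempty
  · obtain ⟨z, h1, h2⟩ := hz
    rcases D.pair x f hfx i j z hi hj h1 h2 with ⟨v, rfl⟩ | ⟨h, -, -⟩
    · exfalso
      have := D.avoid x v i hi h1
      have := D.avoid f v j hj h2
      grind
    · have l : Tendsto (fun ε : ℝ => dt (D.ch x (i + 1) + ε • w (i + 1) - (D.ch x i + ε • w i)) (D.ch f (j + 1) - D.ch f j))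
        (𝓝[>] 0) (𝓝 (dt (D.ch x (i + 1) - D.ch x i) (D.ch f (j + 1) - D.ch f j))) :=
        dt_tendsto ((tw _ _).sub (tw _ _)) (tc _)
      filter_upwards [l.eventually_ne h] with ε h3 _
      exact ⟨⟨z, h1, h2⟩, h3⟩
  · have := seg_disj_ev (tw (D.ch x i) (w i)) (tw (D.ch x (i + 1)) (w (i + 1))) (tc (D.ch f j)) (tc (D.ch f (j + 1)))
      (Set.disjoint_iff_inter_eq_empty.2 (Set.not_nonempty_iff_eq_empty.1 hz))
    filter_upwards [this] with ε h ⟨z, h1, h2⟩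
    exact absurd h2 (Set.disjoint_left.1 h h1)

lemma F10 (ha : ∀ e, D.t e ≠ a) (hx : D.s x = a) (hu : dt u (D.ch x 1 - D.ch x 0) ≠ 0)
    (hw : Off D u x w k) {f : E} (hf : D.s f = a) (hfx : x ≠ f) (ht : D.t x ≠ D.t f) (hn : NR D u f) :
    ∀ᶠ ε : ℝ in 𝓝[>] 0, ∀ i < D.N x, ∀ j < D.N f,
      (osg D x w ε i ∩ D.sg f j).Nonempty → i = 0 ∧ j = 0 ∧
      dt (D.ch x (i + 1) + ε • w (i + 1) - (D.ch x i + ε • w i)) (D.ch f (j + 1) - D.ch f j) ≠ 0 ∧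
      0 < dt u (D.ch x 1 - D.ch x 0) * dt u (D.ch f 1 - D.ch f 0) ∧
      0 < dt u (D.ch x 1 - D.ch x 0) * dt (D.ch f 1 - D.ch f 0) (D.ch x 1 - D.ch x 0) := by
  have hu0 : u ≠ 0 := by rintro rfl; simp [dt] at hu
  have hx0 : D.ch x 0 = D.pos a := by rw [D.ch_zero, hx]
  have hf0 : D.ch f 0 = D.pos a := by rw [D.ch_zero, hf]
  refine evN2 fun i hi j hj => ?_
  by_cases hij : i = 0 ∧ j = 0
  · obtain ⟨rfl, rfl⟩ := hij
    -- same side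
    have same : ∀ᶠ ε : ℝ in 𝓝[>] 0, (osg D x w ε 0 ∩ D.sg f 0).Nonempty →
        0 < dt u (D.ch x 1 - D.ch x 0) * dt u (D.ch f 1 - D.ch f 0) := by
      filter_upwards [F0 hx hu hw, F5 hu0 ha (f := f) (fun _ => hn)] with ε h1 h2 ⟨z, h3, h4⟩
      rcases h1 z h3 with h | h
      · subst h; exact absurd h4 (h2 0 hj)
      · obtain ⟨q, hq, -, rfl⟩ := mem_sg.1 h4
        have e : dt u (D.ch f 0 + q • (D.ch f (0 + 1) - D.ch f 0) - D.pos a) = q * dt u (D.ch f 1 - D.ch f 0) := by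
          rw [hf0]; simp [dt]; ring
        rw [e] at h
        by_contra hc
        push Not at hc
        nlinarith [mul_nonneg hq (neg_nonneg.2 hc)]
    by_cases hss : 0 < dt u (D.ch x 1 - D.ch x 0) * dt u (D.ch f 1 - D.ch f 0)
    swap
    · filter_upwards [same] with ε h h'
      exact absurd (h h') hss
    have hd : dt (D.ch f 1 - D.ch f 0) (D.ch x 1 - D.ch x 0) ≠ 0 := by
      intro h0
      have hsh : segment ℝ (D.pos a) (D.ch f 1) ∩ segment ℝ (D.pos a) (D.ch x 1) ⊆ {D.pos a} := by
        rintro z ⟨h1, h2⟩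
        exact (D.star ha hfx hx hf ht hi hj (z := z) (by rw [PD.sg, hx0]; exact h2)
          (by rw [PD.sg, hf0]; exact h1)).1
      have := (share_iff (by rw [← hf0]; exact D.ne f 0 hj) (by rw [← hx0]; exact D.ne x 0 hi)).1 hsh
      rw [← hx0] at this
      nth_rw 1 [hx0, ← hf0] at this
      nth_rw 2 [hx0] at this
      rw [← hf0] at this
      rcases this with h | h
      · apply h; rw [← hx0] at hf0; rw [hf0] at h0 ⊢; exact h0
      · rw [hf0, ← hx0] at h h0 hss
        set X := D.ch x 1 - D.ch x 0
        set Y := D.ch f 1 - D.ch x 0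
        have id : dp Y X * dt u X - dt Y X * dp u X  = dp X X * dt u Y := by
          simp only [dp, dt]; ring
        have hXX : 0 ≤ dp X X := by simp only [dp]; nlinarith [sq_nonneg X.re, sq_nonneg X.im]
        rw [h0] at id
        have : dp Y X * (dt u X * dt u X) = dp X X * (dt u X * dt u Y) := by
          linear_combination dt u X * id
        nlinarith [mul_self_pos.2 hu, mul_nonneg hXX hss.le]
    have l1 : Tendsto (fun ε : ℝ => dt (D.ch x (0 + 1) + ε • w (0 + 1) - (D.ch x 0 + ε • w 0)) (D.ch f (0 + 1) - D.ch f 0))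
        (𝓝[>] 0) (𝓝 (dt (D.ch x (0 + 1) - D.ch x 0) (D.ch f (0 + 1) - D.ch f 0))) :=
        dt_tendsto ((tw _ _).sub (tw _ _)) (tc _)
    have hd' : dt (D.ch x (0 + 1) - D.ch x 0) (D.ch f (0 + 1) - D.ch f 0) ≠ 0 := by
      intro h; apply hd
      have : dt (D.ch f 1 - D.ch f 0) (D.ch x 1 - D.ch x 0) = - dt (D.ch x (0 + 1) - D.ch x 0) (D.ch f (0 + 1) - D.ch f 0) := by
        simp [dt]; ring
      rw [this, h]; simp
    by_cases hpos : 0 < dt u (D.ch x 1 - D.ch x 0) * dt (D.ch f 1 - D.ch f 0) (D.ch x 1 - D.ch x 0)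
    · filter_upwards [l1.eventually_ne hd'] with ε h _
      exact ⟨rfl, rfl, h, hss, hpos⟩
    · have hneg : 0 < - dt u (D.ch x 1 - D.ch x 0) * dt (D.ch f 1 - D.ch f 0) (D.ch x 1 - D.ch x 0) := by
        have := lt_of_le_of_ne (not_lt.1 hpos) (mul_ne_zero hu hd)
        linarith
      have l2 : Tendsto (fun ε : ℝ => - dt u (D.ch x 1 - D.ch x 0) * dt (D.ch f 1 - D.ch f 0) (D.ch x 1 + ε • w 1 - D.ch f 0))
        (𝓝[>] 0) (𝓝 (- dt u (D.ch x 1 - D.ch x 0) * dt (D.ch f 1 - D.ch f 0) (D.ch x 1 - D.ch f 0))) :=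
        (dt_tendsto (tc _) ((tw _ _).sub (tc _))).const_mul _
      rw [hf0, ← hx0] at l2 hneg
      filter_upwards [evpos, l2.eventually_const_lt hneg] with ε hε h3 ⟨z, h4, h5⟩
      exfalso
      have := side_pos (d := D.ch f 1 - D.pos a) (o := D.pos a) (- dt u (D.ch x 1 - D.ch x 0)) h4 (by
        rw [hx0, hw.w0]
        rw [hx0, hf0] at hss
        have := mul_pos hε hss
        refine lt_of_lt_of_eq this ?_
        simp only [dt, add_sub_cancel_left, Complex.smul_re, Complex.smul_im, smul_eq_mul]; ring) (by rw [hx0] at h3 ⊢; exact h3)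
      obtain ⟨q, hq, -, rfl⟩ := mem_sg.1 h5
      rw [hf0, dt_self_add] at this
      simp at this
  · have := seg_disj_ev (tw (D.ch x i) (w i)) (tw (D.ch x (i + 1)) (w (i + 1)))
      (tc (D.ch f j)) (tc (D.ch f (j + 1))) (by
        rw [Set.disjoint_left]
        intro z h1 h2
        exact hij (D.star ha hfx hx hf ht hi hj h1 h2).2)
    filter_upwards [this] with ε h ⟨z, h1, h2⟩
    exact absurd h2 (Set.disjoint_left.1 h h1)

lemma F14 (x : E) (w : ℕ → ℂ) {f g : E} (hfx : x ≠ f) (hgx : x ≠ g) (hfg : f ≠ g) :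
    ∀ᶠ ε : ℝ in 𝓝[>] 0, ∀ i < D.N x, ∀ j < D.N f, ∀ l < D.N g,
      ∀ z ∈ osg D x w ε i, z ∈ D.sg f j → z ∈ D.sg g l → ∃ v, z = D.pos v := by
  refine evN2 fun i hi j hj => evN fun l hl => ?_
  by_cases h : ∃ z, z ∈ D.sg f j ∧ z ∈ D.sg g l ∧ ¬ ∃ v, z = D.pos v
  · obtain ⟨z, h1, h2, h3⟩ := h
    have hz : z ∉ D.sg x i := fun h => h3 (D.triple x f g hfx hgx hfg i j l z hi hj hl h h1 h2)
    filter_upwards [pt_seg_ev (tw _ (w i)) (tw _ (w (i + 1))) (tc z) hz] with ε h4 z' h5 h6 h7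
    rcases D.pair f g hfg j l z hj hl h1 h2 with h | ⟨h, -, -⟩
    · exact absurd h h3
    · obtain rfl := transv_unique h h1 h2 h6 h7
      exact absurd h5 h4
  · push Not at h
    exact Eventually.of_forall fun ε z _ h1 h2 => h z h1 h2

end dup
end CrAux

namespace CrAux

/-- raw chain data -/
structure Ch (V : Type) where
  s : V
  t : V
  N : ℕ
  ch : ℕ → ℂ

abbrev Ch.sg {V : Type} (e : Ch V) (i : ℕ) : Set ℂ := segment ℝ (e.ch i) (e.ch (i + 1))

def POK {V : Type} (pos : V → ℂ) (e f : Ch V) : Prop :=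
  ∀ i j z, i < e.N → j < f.N → z ∈ e.sg i → z ∈ f.sg j → (∃ v, z = pos v) ∨
    (dt (e.ch (i + 1) - e.ch i) (f.ch (j + 1) - f.ch j) ≠ 0 ∧
      (e.s ≠ f.s ∧ e.s ≠ f.t ∧ e.t ≠ f.s ∧ e.t ≠ f.t) ∧
      ∀ i' j', i' < e.N → j' < f.N → (e.sg i' ∩ f.sg j').Nonempty → i' = i ∧ j' = j)

def QOK {V : Type} (pos : V → ℂ) (e f : Ch V) : Prop :=
  ∀ i j z, i < e.N → j < f.N → z ∈ e.sg i → z ∈ f.sg j → ∃ v, z = pos v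

def TOK {V : Type} (pos : V → ℂ) (e f g : Ch V) : Prop :=
  ∀ i j k z, i < e.N → j < f.N → k < g.N → z ∈ e.sg i → z ∈ f.sg j → z ∈ g.sg k → ∃ v, z = pos v

section
variable {V : Type} {pos : V → ℂ} {e f g : Ch V}

lemma dt_anti (v w : ℂ) : dt v w = - dt w v := by simp only [dt]; ring

lemma POK.symm (h : POK pos e f) : POK pos f e := by
  intro i j z hi hj h1 h2
  rcases h j i z hj hi h2 h1 with h | ⟨h3, h4, h5⟩
  · exact Or.inl h
  · refine Or.inr ⟨by rw [dt_anti]; simpa using h3, ⟨h4.1.symm, h4.2.2.1.symm, h4.2.1.symm, h4.2.2.2.symm⟩, ?_⟩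
    intro i' j' hi' hj' hn
    rw [Set.inter_comm] at hn
    exact (h5 j' i' hj' hi' hn).symm

lemma QOK.POK (h : QOK pos e f) : POK pos e f := fun i j z hi hj h1 h2 => Or.inl (h i j z hi hj h1 h2)
lemma QOK.symm (h : QOK pos e f) : QOK pos f e := fun i j z hi hj h1 h2 => (h j i z hj hi h2 h1)
lemma QOK.T12 (h : QOK pos e f) : TOK pos e f g := fun i j _ z hi hj _ h1 h2 _ => h i j z hi hj h1 h2
lemma QOK.T13 (h : QOK pos e g) : TOK pos e f g := fun i _ j z hi _ hj h1 _ h2 => h i j z hi hj h1 h2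
lemma QOK.T23 (h : QOK pos f g) : TOK pos e f g := fun _ i j z _ hi hj _ h1 h2 => h i j z hi hj h1 h2
lemma TOK.r1 (h : TOK pos e f g) : TOK pos f e g := fun i j k z hi hj hk h1 h2 h3 => h j i k z hj hi hk h2 h1 h3
lemma TOK.r2 (h : TOK pos e f g) : TOK pos f g e := fun i j k z hi hj hk h1 h2 h3 => h k i j z hk hi hj h3 h1 h2
end

/-- assembling -/
def PD.ofCh {V E : Type} (pos : V → ℂ) (c : E → Ch V) (pos_inj : Function.Injective pos)
    (st : ∀ e, (c e).s ≠ (c e).t) (Npos : ∀ e, 0 < (c e).N) (ch_zero : ∀ e, (c e).ch 0 = pos (c e).s)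
    (ch_N : ∀ e, (c e).ch (c e).N = pos (c e).t)
    (sep : ∀ e i j, i + 1 < j → j < (c e).N → Disjoint ((c e).sg i) ((c e).sg j))
    (adj : ∀ e i, i + 1 < (c e).N → (c e).sg i ∩ (c e).sg (i + 1) ⊆ {(c e).ch (i + 1)})
    (ne : ∀ e i, i < (c e).N → (c e).ch i ≠ (c e).ch (i + 1))
    (avoid : ∀ e v i, i < (c e).N → pos v ∈ (c e).sg i → v = (c e).s ∨ v = (c e).t)
    (pair : ∀ e f, e ≠ f → POK pos (c e) (c f))
    (triple : ∀ e f g, e ≠ f → e ≠ g → f ≠ g → TOK pos (c e) (c f) (c g)) : PD V E where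
  pos := pos
  s e := (c e).s
  t e := (c e).t
  N e := (c e).N
  ch e := (c e).ch
  pos_inj := pos_inj
  st := st
  Npos := Npos
  ch_zero := ch_zero
  ch_N := ch_N
  sep := sep
  adj := adj
  ne := ne
  avoid := avoid
  pair := pair
  triple := triple

section dup
variable {V E : Type}

noncomputable def cOld (D : PD V E) (e : E) : Ch (Option V) := ⟨some (D.s e), some (D.t e), D.N e, D.ch e⟩
noncomputable def cCopy (D : PD V E) (w : E → ℕ → ℂ) (ε : ℝ) (x : E) : Ch (Option V) :=
  ⟨none, some (D.t x), D.N x, fun i => D.ch x i + ε • w x i⟩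
noncomputable def cG (D : PD V E) (a : V) (u : ℂ) (ε : ℝ) : Ch (Option V) :=
  ⟨some a, none, 1, fun i => if i = 0 then D.pos a else D.pos a + ε • u⟩
noncomputable def pos' (D : PD V E) (a : V) (u : ℂ) (ε : ℝ) : Option V → ℂ
  | some v => D.pos v
  | none => D.pos a + ε • u

/-- Duplicating a vertex. -/
theorem dup [Finite V] [Finite E] (D : PD V E) (a : V) (u : ℂ) (hu0 : u ≠ 0) (ha : ∀ e, D.t e ≠ a)
    (hinj : ∀ e f, D.s e = a → D.s f = a → D.t e = D.t f → e = f) (X : Set E)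
    (hXs : ∀ x ∈ X, D.s x = a) (hXu : ∀ x ∈ X, dt u (D.ch x 1 - D.ch x 0) ≠ 0)
    (hNR : ∀ f, D.s f = a → NR D u f) :
    ∃ D' : PD (Option V) (E ⊕ (X ⊕ Unit)),
      (∀ v, D'.pos (some v) = D.pos v) ∧
      (∀ e, D'.s (.inl e) = some (D.s e) ∧ D'.t (.inl e) = some (D.t e) ∧ D'.N (.inl e) = D.N e ∧
        D'.ch (.inl e) = D.ch e) ∧
      (∀ x : X, D'.s (.inr (.inl x)) = none ∧ D'.t (.inr (.inl x)) = some (D.t x)) ∧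
      (D'.s (.inr (.inr ())) = some a ∧ D'.t (.inr (.inr ())) = none ∧
        ∃ ε : ℝ, 0 < ε ∧ D'.ch (.inr (.inr ())) 1 - D'.ch (.inr (.inr ())) 0 = ε • u) ∧
      (∀ (x : X) f, D.s f ≠ a → D.t x ≠ D.s f → D.t x ≠ D.t f →
        (D'.K (.inr (.inl x)) ∩ D'.K (.inl f)).Nonempty → (D.K x ∩ D.K f).Nonempty) ∧
      (∀ (x : X) f, D.s f = a → f ≠ x → (D'.K (.inr (.inl x)) ∩ D'.K (.inl f)).Nonempty →
        0 < dt u (D.ch x 1 - D.ch x 0) * dt u (D.ch f 1 - D.ch f 0) ∧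
        0 < dt u (D.ch x 1 - D.ch x 0) * dt (D.ch f 1 - D.ch f 0) (D.ch x 1 - D.ch x 0)) ∧
      (∀ f, D.s f ≠ a → D'.K (.inr (.inr ())) ∩ D'.K (.inl f) = ∅) := by
  classical
  have hoff : ∀ x, ∃ w, ∃ k, x ∈ X → Off D u x w k := by
    intro x
    by_cases hx : x ∈ X
    · obtain ⟨w, k, h⟩ := exists_off D u x (hXu x hx)
      exact ⟨w, k, fun _ => h⟩
    · exact ⟨0, 0, fun h => absurd h hx⟩
  choose w k hw using hoff
  have imp : ∀ {p : Prop} {q : ℝ → Prop}, (p → ∀ᶠ ε in 𝓝[>] (0:ℝ), q ε) →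
      ∀ᶠ ε in 𝓝[>] (0:ℝ), p → q ε := fun h => eventually_imp_distrib_left.2 h
  have H1 := eventually_all.2 fun x => F1 (D := D) x (w x)
  have H2 := eventually_all.2 fun x => F2 (D := D) x (w x)
  have H3 := eventually_all.2 fun x => F3 (D := D) x (w x)
  have H4 := eventually_all.2 fun x => imp fun (hx : x ∈ X) => eventually_all.2 fun v => imp fun (hv : v ≠ D.t x) =>
    F4 (hXs x hx) (hXu x hx) (hw x hx) v hv
  have H5 := eventually_all.2 fun f => F5 (f := f) hu0 ha (hNR f)
  have H5' := eventually_all.2 fun v => F5' (D := D) (a := a) hu0 v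
  have H6 := eventually_all.2 fun x => imp fun (hx : x ∈ X) => eventually_all.2 fun y =>
    imp fun (hy : y ∈ X) => imp fun (hxy : x ≠ y) => F6 ha hxy
      (fun h => hxy (hinj x y (hXs x hx) (hXs y hy) h)) (hXs x hx) (hXs y hy) (hw x hx) (hw y hy)
  have H7 := eventually_all.2 fun x => imp fun (hx : x ∈ X) => F7 (hw x hx)
  have H8 := eventually_all.2 fun x => imp fun (hx : x ∈ X) => eventually_all.2 fun f =>
    imp fun (hf : D.s f ≠ a) => imp fun (hfx : x ≠ f) => imp fun (ht : D.t x = D.s f ∨ D.t x = D.t f) =>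
      F8 ha (hXs x hx) (hw x hx) hf hfx ht
  have H9 := eventually_all.2 fun x => eventually_all.2 fun f =>
    imp fun (hfx : x ≠ f) => imp fun (hna : D.s x ≠ D.s f ∧ D.s x ≠ D.t f ∧ D.t x ≠ D.s f ∧ D.t x ≠ D.t f) =>
      F9 x (w x) hfx hna
  have H10 := eventually_all.2 fun x => imp fun (hx : x ∈ X) => eventually_all.2 fun f =>
    imp fun (hf : D.s f = a) => imp fun (hfx : x ≠ f) => F10 ha (hXs x hx) (hXu x hx) (hw x hx) hf hfx
      (fun h => hfx (hinj x f (hXs x hx) hf h)) (hNR f hf)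
  have H11 := eventually_all.2 fun f => imp fun (hf : D.s f ≠ a) => F11 (u := u) ha hf
  have H12 := eventually_all.2 fun f => imp fun (hf : D.s f = a) => F12 hu0 hf (hNR f hf)
  have H13 := eventually_all.2 fun x => imp fun (hx : x ∈ X) => F13 (hXs x hx) (hXu x hx) (hw x hx)
  have H14 := eventually_all.2 fun x => eventually_all.2 fun f => eventually_all.2 fun g =>
    imp fun (hfx : x ≠ f) => imp fun (hgx : x ≠ g) => imp fun (hfg : f ≠ g) => F14 (D := D) x (w x) hfx hgx hfg
  have H15 : ∀ᶠ ε : ℝ in 𝓝[>] 0, ∀ v, v ≠ a → D.pos v ∉ segment ℝ (D.pos a) (D.pos a + ε • u) :=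
    eventually_all.2 fun v => imp fun hv => pt_seg_ev (tc _) (tw _ u) (tc _) (by
      rw [segment_same]; simpa using fun h => hv (D.pos_inj h))
  obtain ⟨ε, hε, h1, h2, h3, h4, h5, h5', h6, h7, h8, h9, h10, h11, h12, h13, h14, h15⟩ :=
    (evpos.and (H1.and (H2.and (H3.and (H4.and (H5.and (H5'.and (H6.and (H7.and (H8.and
      (H9.and (H10.and (H11.and (H12.and (H13.and (H14.and H15)))))))))))))))).exists
  clear H1 H2 H3 H4 H5 H5' H6 H7 H8 H9 H10 H11 H12 H13 H14 H15
  set P := pos' D a u ε with hP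
  have hgs : (cG D a u ε).sg 0 = segment ℝ (D.pos a) (D.pos a + ε • u) := by
    simp [cG, Ch.sg]
  -- pair facts
  have q_cc : ∀ x ∈ X, ∀ y ∈ X, x ≠ y → QOK P (cCopy D w ε x) (cCopy D w ε y) := by
    intro x hx y hy hxy i j z hi hj hz1 hz2
    exact ⟨none, h6 x hx y hy hxy i hi j hj z hz1 hz2⟩
  have q_cg : ∀ x ∈ X, QOK P (cCopy D w ε x) (cG D a u ε) := by
    intro x hx i j z hi hj hz1 hz2
    obtain rfl : j = 0 := by simp [cG] at hj; exact hj
    rw [hgs] at hz2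
    exact ⟨none, h13 x hx i hi z hz2 hz1⟩
  have q_og : ∀ f, QOK P (cOld D f) (cG D a u ε) := by
    intro f i j z hi hj hz1 hz2
    obtain rfl : j = 0 := by simp [cG] at hj; exact hj
    rw [hgs] at hz2
    by_cases hf : D.s f = a
    · exact ⟨some a, h12 f hf i hi z hz2 hz1⟩
    · exact absurd hz1 (h11 f hf i hi z hz2)
  have q_cx : ∀ x ∈ X, QOK P (cCopy D w ε x) (cOld D x) := by
    intro x hx i j z hi hj hz1 hz2
    exact ⟨some (D.t x), h7 x hx i hi j hj z hz1 hz2⟩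
  have p_oo : ∀ e f, e ≠ f → POK P (cOld D e) (cOld D f) := by
    intro e f hef i j z hi hj hz1 hz2
    rcases D.pair e f hef i j z hi hj hz1 hz2 with ⟨v, h⟩ | ⟨hh1, hh2, hh3⟩
    · exact Or.inl ⟨some v, h⟩
    · exact Or.inr ⟨hh1, by simpa [cOld] using hh2, hh3⟩
  have p_co : ∀ x ∈ X, ∀ f, POK P (cCopy D w ε x) (cOld D f) := by
    intro x hx f
    by_cases hfx : x = f
    · subst hfx; exact (q_cx x hx).POK
    by_cases hf : D.s f = a
    · intro i j z hi hj hz1 hz2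
      have hh := h10 x hx f hf hfx
      obtain ⟨rfl, rfl, hd, -, -⟩ := hh i hi j hj ⟨z, hz1, hz2⟩
      refine Or.inr ⟨hd, ?_, fun i' j' hi' hj' hn => ?_⟩
      · refine ⟨by simp [cCopy, cOld], by simp [cCopy, cOld], ?_, ?_⟩
        · simp only [cCopy, cOld, ne_eq, Option.some.injEq]; rw [hf]; exact ha x
        · simp only [cCopy, cOld, ne_eq, Option.some.injEq]
          exact fun h => hfx (hinj x f (hXs x hx) hf h)
      · have := hh i' hi' j' hj' hn
        exact ⟨this.1, this.2.1⟩
    by_cases ht : D.t x = D.s f ∨ D.t x = D.t f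
    · intro i j z hi hj hz1 hz2
      exact Or.inl ⟨some (D.t x), h8 x hx f hf hfx ht i hi j hj z hz1 hz2⟩
    · push Not at ht
      have hna : D.s x ≠ D.s f ∧ D.s x ≠ D.t f ∧ D.t x ≠ D.s f ∧ D.t x ≠ D.t f :=
        ⟨by rw [hXs x hx]; exact fun h => hf h.symm, by rw [hXs x hx]; exact (ha f).symm, ht.1, ht.2⟩
      have hh := h9 x f hfx hna
      intro i j z hi hj hz1 hz2
      obtain ⟨⟨z0, hz01, hz02⟩, hd⟩ := hh i hi j hj ⟨z, hz1, hz2⟩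
      refine Or.inr ⟨hd, ⟨by simp [cCopy, cOld], by simp [cCopy, cOld], by simpa [cCopy, cOld] using ht.1,
        by simpa [cCopy, cOld] using ht.2⟩, fun i' j' hi' hj' hn => ?_⟩
      rcases D.pair x f hfx i j z0 hi hj hz01 hz02 with ⟨v, rfl⟩ | ⟨-, -, hu⟩
      · exfalso
        have := D.avoid x v i hi hz01
        have := D.avoid f v j hj hz02
        grind
      · exact hu i' j' hi' hj' (hh i' hi' j' hj' hn).1
  have t_coo : ∀ x ∈ X, ∀ f g, f ≠ g → TOK P (cCopy D w ε x) (cOld D f) (cOld D g) := by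
    intro x hx f g hfg
    by_cases hfx : x = f
    · subst hfx; exact (q_cx x hx).T12
    by_cases hgx : x = g
    · subst hgx; exact (q_cx x hx).T13
    intro i j l z hi hj hl hz1 hz2 hz3
    obtain ⟨v, hv⟩ := h14 x f g hfx hgx hfg i hi j hj l hl z hz1 hz2 hz3
    exact ⟨some v, hv⟩
  have t_ooo : ∀ e f g, e ≠ f → e ≠ g → f ≠ g → TOK P (cOld D e) (cOld D f) (cOld D g) := by
    intro e f g hef heg hfg i j l z hi hj hl hz1 hz2 hz3
    obtain ⟨v, hv⟩ := D.triple e f g hef heg hfg i j l z hi hj hl hz1 hz2 hz3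
    exact ⟨some v, hv⟩
  let c : E ⊕ (X ⊕ Unit) → Ch (Option V) := fun e => match e with
    | .inl e => cOld D e
    | .inr (.inl x) => cCopy D w ε x
    | .inr (.inr _) => cG D a u ε
  have hεu : ε • u ≠ 0 := smul_ne_zero hε.ne' hu0
  refine ⟨PD.ofCh P c ?_ ?_ ?_ ?_ ?_ ?_ ?_ ?_ ?_ ?_ ?_, ?_, ?_, ?_, ?_, ?_, ?_, ?_⟩
  · -- pos_inj
    rintro (_ | v) (_ | v') h
    · rfl
    · exact absurd h (h5' v')
    · exact absurd h.symm (h5' v)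
    · rw [D.pos_inj h]
  · rintro (e | x | _)
    · simpa [c, cOld] using D.st e
    · simp [c, cCopy]
    · simp [c, cG]
  · rintro (e | x | _)
    · exact D.Npos e
    · exact D.Npos x
    · simp [c, cG]
  · rintro (e | x | _)
    · exact D.ch_zero e
    · simp [c, cCopy, P, pos', D.ch_zero, (hw x x.2).w0, hXs x x.2]
    · simp [c, cG, P, pos']
  · rintro (e | x | _)
    · exact D.ch_N e
    · simp [c, cCopy, P, pos', D.ch_N, (hw x x.2).wN]
    · simp [c, cG, P, pos']
  · rintro (e | x | _) i j hij hj
    · exact D.sep e i j hij hj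
    · exact h1 x i (by have : j < D.N x := hj; omega) j hj hij
    · simp [c, cG] at hj; omega
  · rintro (e | x | _) i hi
    · exact D.adj e i hi
    · exact h2 x i (by have : i + 1 < D.N x := hi; omega) hi
    · simp [c, cG] at hi
  · rintro (e | x | _) i hi
    · exact D.ne e i hi
    · exact h3 x i hi
    · simp [c, cG] at hi; subst hi; simp [c, cG, hε.ne', hu0]
  · rintro (e | x | _) (_ | v) i hi h
    · exact absurd h (h5 e i hi)
    · simpa [c, cOld] using D.avoid e v i hi h
    · left; rfl
    · right
      by_contra hc
      exact h4 x x.2 v (fun h => hc (by rw [h]; rfl)) i hi h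
    · right; rfl
    · left
      by_contra hc
      have : i = 0 := by simpa [c, cG] using hi
      subst this
      have h : P (some v) ∈ (cG D a u ε).sg 0 := h
      rw [hgs] at h
      exact h15 v (fun h => hc (by rw [h]; rfl)) h
  · rintro (e | x | _) (f | y | _) hef
    · exact p_oo e f (fun h => hef (by rw [h]))
    · exact (p_co y y.2 e).symm
    · exact (q_og e).POK
    · exact p_co x x.2 f
    · exact (q_cc x x.2 y y.2 (fun h => hef (by rw [Subtype.ext h]))).POK
    · exact (q_cg x x.2).POK
    · exact (q_og f).symm.POK
    · exact (q_cg y y.2).symm.POK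
    · exact absurd rfl hef
  · rintro (e | x | _) (f | y | _) (g | y' | _) hef heg hfg
    · exact t_ooo e f g (fun h => hef (by rw [h])) (fun h => heg (by rw [h])) (fun h => hfg (by rw [h]))
    · exact (t_coo y' y'.2 e f (fun h => hef (by rw [h]))).r2
    · exact (q_og e).T13
    · exact (t_coo y y.2 e g (fun h => heg (by rw [h]))).r1
    · exact (q_cc y y.2 y' y'.2 (fun h => hfg (by rw [Subtype.ext h]))).T23
    · exact (q_og e).T13
    · exact (q_og e).T12
    · exact (q_og e).T12
    · exact absurd rfl hfg
    · exact t_coo x x.2 f g (fun h => hfg (by rw [h]))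
    · exact (q_cc x x.2 y' y'.2 (fun h => heg (by rw [Subtype.ext h]))).T13
    · exact (q_cg x x.2).T13
    · exact (q_cc x x.2 y y.2 (fun h => hef (by rw [Subtype.ext h]))).T12
    · exact (q_cc x x.2 y y.2 (fun h => hef (by rw [Subtype.ext h]))).T12
    · exact (q_cg x x.2).T13
    · exact (q_cg x x.2).T12
    · exact (q_cg x x.2).T12
    · exact absurd rfl hfg
    · exact (q_og f).symm.T12
    · exact (q_og f).symm.T12
    · exact absurd rfl heg
    · exact (q_cg y y.2).symm.T12
    · exact (q_cg y y.2).symm.T12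
    · exact absurd rfl heg
    · exact absurd rfl hef
    · exact absurd rfl hef
    · exact absurd rfl hef
  · intro v; rfl
  · intro e; exact ⟨rfl, rfl, rfl, rfl⟩
  · intro e; exact ⟨rfl, rfl⟩
  · exact ⟨rfl, rfl, ε, hε, by simp [PD.ofCh, c, cG]⟩
  · rintro x f hf ht1 ht2 ⟨z, ⟨i, hi, hz1⟩, ⟨j, hj, hz2⟩⟩
    have hfx : (x : E) ≠ f := by rintro rfl; exact hf (hXs x x.2)
    obtain ⟨z0, hz01, hz02⟩ := (h9 x f hfx ⟨by rw [hXs x x.2]; exact fun h => hf h.symm,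
      by rw [hXs x x.2]; exact (ha f).symm, ht1, ht2⟩ i hi j hj ⟨z, hz1, hz2⟩).1
    exact ⟨z0, ⟨i, hi, hz01⟩, ⟨j, hj, hz02⟩⟩
  · rintro x f hf hfx ⟨z, ⟨i, hi, hz1⟩, ⟨j, hj, hz2⟩⟩
    exact (h10 x x.2 f hf (fun h => hfx h.symm) i hi j hj ⟨z, hz1, hz2⟩).2.2.2
  · intro f hf
    rw [Set.eq_empty_iff_forall_notMem]
    rintro z ⟨⟨i, hi, hz1⟩, ⟨j, hj, hz2⟩⟩
    have hi : i < 1 := hi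
    have : i = 0 := by omega
    subst this
    have hz1 : z ∈ (cG D a u ε).sg 0 := hz1
    rw [hgs] at hz1
    exact h11 f hf j hj z hz1 hz2

end dup
end CrAux

namespace CrAux

section arc

/-- clamp to the unit interval -/
noncomputable def cl (x : ℝ) : ℝ := max 0 (min 1 x)

/-- piecewise linear parametrisation of a chain -/
noncomputable def pl (c : ℕ → ℂ) (N : ℕ) (t : ℝ) : ℂ :=
  c 0 + ∑ i ∈ Finset.range N, cl (t - i) • (c (i + 1) - c i)

lemma pl_cont (c : ℕ → ℂ) (N : ℕ) : Continuous (pl c N) := by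
  unfold pl cl; fun_prop

lemma pl_seg (c : ℕ → ℂ) (N : ℕ) {i : ℕ} (hi : i < N) {t : ℝ} (h0 : (i : ℝ) ≤ t) (h1 : t ≤ i + 1) :
    pl c N t = c i + (t - i) • (c (i + 1) - c i) := by
  have h : ∀ n ≤ i, c 0 + ∑ j ∈ Finset.range n, cl (t - j) • (c (j + 1) - c j) = c n := by
    intro n
    induction n with
    | zero => intro _; simp
    | succ n ih =>
      intro hn
      rw [Finset.sum_range_succ, ← add_assoc, ih (by omega)]
      have : cl (t - n) = 1 := by
        have : (n : ℝ) + 1 ≤ i := by exact_mod_cast hn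
        unfold cl
        rw [min_eq_left (by linarith)]; simp
      rw [this, one_smul]; ring
  have h2 : ∀ n, i < n → c 0 + ∑ j ∈ Finset.range n, cl (t - j) • (c (j + 1) - c j) =
      c i + (t - i) • (c (i + 1) - c i) := by
    intro n hn
    induction n, hn using Nat.le_induction with
    | base =>
      rw [Nat.succ_eq_add_one, Finset.sum_range_succ, ← add_assoc, h i le_rfl]
      have : cl (t - i) = t - i := by
        unfold cl
        rw [min_eq_right (by linarith), max_eq_right (by linarith)]
      rw [this]
    | succ n hn ih =>
      rw [Finset.sum_range_succ, ← add_assoc, ih]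
      have : cl (t - n) = 0 := by
        have : (i : ℝ) + 1 ≤ n := by exact_mod_cast hn
        unfold cl
        exact max_eq_left ((min_le_right _ _).trans (by linarith))
      rw [this]; simp
  exact h2 N hi

lemma exists_idx {N : ℕ} (hN : 0 < N) {t : ℝ} (h0 : 0 ≤ t) (h1 : t ≤ N) :
    ∃ i < N, (i : ℝ) ≤ t ∧ t ≤ i + 1 := by
  rcases h1.lt_or_eq with h | h
  · refine ⟨⌊t⌋₊, (Nat.floor_lt h0).2 h, Nat.floor_le h0, (Nat.lt_floor_add_one t).le⟩
  · refine ⟨N - 1, by omega, ?_, ?_⟩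
    · rw [h]; exact_mod_cast Nat.sub_le _ _
    · rw [h, Nat.cast_sub hN]; simp

lemma pl_mem (c : ℕ → ℂ) (N : ℕ) {i : ℕ} (hi : i < N) {t : ℝ} (h0 : (i : ℝ) ≤ t) (h1 : t ≤ i + 1) :
    pl c N t ∈ segment ℝ (c i) (c (i + 1)) := by
  rw [pl_seg c N hi h0 h1]
  exact mem_sg.2 ⟨t - i, by linarith, by linarith, rfl⟩

variable {V E : Type} (D : PD V E)

lemma pl_inj_le (e : E) {t t' : ℝ} (h0 : 0 ≤ t) (h1 : t' ≤ D.N e) (htt : t ≤ t')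
    (heq : pl (D.ch e) (D.N e) t = pl (D.ch e) (D.N e) t') : t = t' := by
  obtain ⟨i, hi, hi0, hi1⟩ := exists_idx (D.Npos e) h0 (htt.trans h1)
  obtain ⟨j, hj, hj0, hj1⟩ := exists_idx (D.Npos e) (h0.trans htt) h1
  have m1 := pl_mem (D.ch e) (D.N e) hi hi0 hi1
  have m2 := pl_mem (D.ch e) (D.N e) hj hj0 hj1
  have e1 := pl_seg (D.ch e) (D.N e) hi hi0 hi1
  have e2 := pl_seg (D.ch e) (D.N e) hj hj0 hj1
  have hne : ∀ l < D.N e, ∀ p q : ℝ, p • (D.ch e (l + 1) - D.ch e l) = q • (D.ch e (l + 1) - D.ch e l) → p = q := by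
    intro l hl p q h
    exact smul_left_injective ℝ (sub_ne_zero.2 (D.ne e l hl).symm) h
  rcases lt_trichotomy i j with h | h | h
  · rcases Nat.lt_or_ge (i + 1) j with h' | h'
    · rw [heq] at m1
      exact absurd m2 (Set.disjoint_left.1 (D.sep e i j h' hj) m1)
    · obtain rfl : j = i + 1 := by omega
      have hm := D.adj e i hj ⟨heq ▸ m1, m2⟩
      have hm : pl (D.ch e) (D.N e) t' = D.ch e (i + 1) := hm
      have k1 : t' - (i + 1 : ℕ) = 0 := by
        apply hne (i + 1) hj
        rw [hm] at e2
        simpa using e2.symm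
      have k2 : t - i = 1 := by
        apply hne i hi
        rw [heq, hm] at e1
        rw [one_smul, eq_sub_iff_add_eq']; exact e1.symm
      push_cast at k1; linarith
  · subst h
    rw [heq, e2] at e1
    have := hne i hi _ _ (add_left_cancel e1)
    linarith
  · have : (j : ℝ) + 1 ≤ i := by exact_mod_cast h
    linarith

theorem exists_arc (e : E) : ∃ g : ℝ → ℂ, Continuous g ∧ g 0 = D.pos (D.s e) ∧ g 1 = D.pos (D.t e) ∧
    Set.InjOn g (Set.Icc 0 1) ∧ ∀ t ∈ Set.Icc (0:ℝ) 1, g t ∈ D.K e := by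
  have hN : (0:ℝ) < D.N e := by exact_mod_cast D.Npos e
  refine ⟨fun t => pl (D.ch e) (D.N e) (D.N e * t), (pl_cont _ _).comp (by fun_prop), ?_, ?_, ?_, ?_⟩
  · have := pl_seg (D.ch e) (D.N e) (D.Npos e) (t := 0) (by simp) (by simp)
    simp only [mul_zero]; rw [this]; simp [D.ch_zero]
  · obtain ⟨n, hn⟩ : ∃ n, D.N e = n + 1 := ⟨D.N e - 1, by have := D.Npos e; omega⟩
    have := pl_seg (D.ch e) (D.N e) (i := n) (by omega) (t := D.N e) (by rw [hn]; simp) (by rw [hn]; simp)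
    simp only [mul_one]
    rw [this, ← D.ch_N, hn]; simp
  · intro t ht t' ht' h
    have b : ∀ t ∈ Set.Icc (0:ℝ) 1, 0 ≤ D.N e * t ∧ D.N e * t ≤ D.N e := fun t ht =>
      ⟨mul_nonneg hN.le ht.1, mul_le_of_le_one_right hN.le ht.2⟩
    have := b t ht
    have := b t' ht'
    have : (D.N e : ℝ) * t = D.N e * t' := by
      rcases le_total (D.N e * t : ℝ) (D.N e * t') with hl | hl
      · exact pl_inj_le D e (b t ht).1 (b t' ht').2 hl h
      · exact (pl_inj_le D e (b t' ht').1 (b t ht).2 hl h.symm).symm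
    exact mul_left_cancel₀ hN.ne' this
  · intro t ht
    obtain ⟨i, hi, hi0, hi1⟩ := exists_idx (D.Npos e) (mul_nonneg hN.le ht.1)
      (mul_le_of_le_one_right hN.le ht.2)
    exact ⟨i, hi, pl_mem _ _ hi hi0 hi1⟩

end arc

section draw
variable {V E V' : Type} (D : PD V E) (G : SimpleGraph V') (f : V' → V)

/-- a chosen parametrization of a PD edge -/
noncomputable def garc {V E : Type} (D : PD V E) (e : E) : ℝ → ℂ := Classical.choose (exists_arc D e)

open Classical in
/-- an arc along a PD edge, in the real plane -/
noncomputable def darc (η : G.edgeSet → E) (a b : V') (t : ℝ) : ℝ × ℝ :=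
  if h : G.Adj a b then
    if D.s (η ⟨s(a, b), h⟩) = f a then
      Complex.equivRealProdCLM (garc D (η ⟨s(a, b), h⟩) t)
    else Complex.equivRealProdCLM (garc D (η ⟨s(a, b), h⟩) (1 - t))
  else 0

theorem toDrawing (hf : Function.Injective f) (η : G.edgeSet → E)
    (hη : ∀ σ, s(D.s (η σ), D.t (η σ)) = σ.1.map f) :
    ∃ D' : Drawing G, D'.IsGood ∧ ∀ σ τ : G.edgeSet, (∃ p, D'.IsCrossing σ τ p) →
      (D.s (η σ) ≠ D.s (η τ) ∧ D.s (η σ) ≠ D.t (η τ) ∧ D.t (η σ) ≠ D.s (η τ) ∧ D.t (η σ) ≠ D.t (η τ)) ∧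
      (D.K (η σ) ∩ D.K (η τ)).Nonempty := by
  classical
  set φ := Complex.equivRealProdCLM with hφ
  have hcase : ∀ a b (h : G.Adj a b), (D.s (η ⟨s(a, b), h⟩) = f a ∧ D.t (η ⟨s(a, b), h⟩) = f b) ∨
      (D.s (η ⟨s(a, b), h⟩) ≠ f a ∧ D.s (η ⟨s(a, b), h⟩) = f b ∧ D.t (η ⟨s(a, b), h⟩) = f a) := by
    intro a b h
    have := hη ⟨s(a, b), h⟩
    simp only [Sym2.map_mk] at this
    rcases Sym2.eq_iff.1 this with h' | h'
    · exact Or.inl h'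
    · refine Or.inr ⟨?_, h'⟩
      rw [h'.1]; exact fun h' => h.ne (hf h').symm
  have hspec : ∀ a b (h : G.Adj a b), ∃ g : ℝ → ℂ, Continuous g ∧ g 0 = D.pos (f a) ∧ g 1 = D.pos (f b) ∧
      Set.InjOn g (Set.Icc 0 1) ∧ (∀ t ∈ Set.Icc (0:ℝ) 1, g t ∈ D.K (η ⟨s(a, b), h⟩)) ∧
      darc D G f η a b = fun t => φ (g t) := by
    intro a b h
    obtain ⟨c1, c2, c3, c4, c5⟩ : Continuous (garc D (η ⟨s(a, b), h⟩)) ∧ garc D (η ⟨s(a, b), h⟩) 0 = D.pos (D.s (η ⟨s(a, b), h⟩)) ∧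
        garc D (η ⟨s(a, b), h⟩) 1 = D.pos (D.t (η ⟨s(a, b), h⟩)) ∧
        Set.InjOn (garc D (η ⟨s(a, b), h⟩)) (Set.Icc 0 1) ∧
        ∀ t ∈ Set.Icc (0:ℝ) 1, garc D (η ⟨s(a, b), h⟩) t ∈ D.K (η ⟨s(a, b), h⟩) :=
      Classical.choose_spec (exists_arc D (η ⟨s(a, b), h⟩))
    rcases hcase a b h with ⟨h1, h2⟩ | ⟨h0, h1, h2⟩
    · refine ⟨_, c1, by rw [c2, h1], by rw [c3, h2], c4, c5, ?_⟩
      funext t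
      simp only [darc, dif_pos h, if_pos h1]; rfl
    · refine ⟨fun t => garc D (η ⟨s(a, b), h⟩) (1 - t), by fun_prop, ?_, ?_, ?_, ?_, ?_⟩
      · simp only [sub_zero]; rw [c3, h2]
      · simp only [sub_self]; rw [c2, h1]
      · intro t ht t' ht' he
        have := c4 (show 1 - t ∈ Set.Icc (0:ℝ) 1 from ⟨by linarith [ht.2], by linarith [ht.1]⟩)
          (show 1 - t' ∈ Set.Icc (0:ℝ) 1 from ⟨by linarith [ht'.2], by linarith [ht'.1]⟩) he
        linarith
      · intro t ht
        exact c5 (1 - t) ⟨by linarith [ht.2], by linarith [ht.1]⟩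
      · funext t
        simp only [darc, dif_pos h, if_neg h0]; rfl
  let D' : Drawing G :=
    { pos := fun v => φ (D.pos (f v))
      pos_inj := fun v w h => hf (D.pos_inj (φ.injective h))
      arc := darc D G f η
      arc_cont := by
        intro a b h
        obtain ⟨g, h1, h2, h3, h4, h5, h6⟩ := hspec a b h
        rw [h6]; exact (φ.continuous.comp h1).continuousOn
      arc_zero := by
        intro a b h
        obtain ⟨g, h1, h2, h3, h4, h5, h6⟩ := hspec a b h
        rw [h6, ← h2]
      arc_one := by
        intro a b h
        obtain ⟨g, h1, h2, h3, h4, h5, h6⟩ := hspec a b h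
        rw [h6, ← h3]
      arc_symm := by
        intro a b h t
        have hs : (⟨s(b, a), h.symm⟩ : G.edgeSet) = ⟨s(a, b), h⟩ := Subtype.ext Sym2.eq_swap
        have hb := hcase a b h
        unfold darc
        rw [dif_pos h, dif_pos h.symm, hs]
        rcases hb with ⟨h1, h2⟩ | ⟨h0, h1, h2⟩
        · rw [if_pos h1, if_neg]
          rw [h1]; exact fun h' => h.ne (hf h')
        · rw [if_neg h0, if_pos h1, sub_sub_cancel]
      arc_avoid := by
        rintro a b h c hca hcb ⟨t, ht, he⟩
        obtain ⟨g, h1, h2, h3, h4, h5, h6⟩ := hspec a b h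
        rw [h6] at he
        have he := φ.injective he
        obtain ⟨i, hi, hm⟩ := h5 t ht
        rw [he] at hm
        have := D.avoid _ (f c) i hi hm
        rcases hcase a b h with ⟨h1, h2⟩ | ⟨h0, h1, h2⟩
        · rw [h1, h2] at this
          rcases this with h | h
          · exact hca (hf h)
          · exact hcb (hf h)
        · rw [h1, h2] at this
          rcases this with h | h
          · exact hcb (hf h)
          · exact hca (hf h) }
  -- points
  have hpts : ∀ (σ : G.edgeSet) p, p ∈ D'.edgePoints σ → φ.symm p ∈ D.K (η σ) := by
    rintro ⟨σ, hσ⟩ p ⟨a, b, hab, h, t, ht, rfl⟩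
    simp only at hab
    subst hab
    obtain ⟨g, h1, h2, h3, h4, h5, h6⟩ := hspec a b h
    have : D'.arc a b t = φ (g t) := congrFun h6 t
    rw [this]; simpa using h5 t ht
  have hends : ∀ (σ : G.edgeSet) v, (v = D.s (η σ) ∨ v = D.t (η σ)) → φ (D.pos v) ∈ D'.ends σ := by
    rintro ⟨σ, hσ⟩ v hv
    have : v ∈ σ.map f := by
      have h2 := hη ⟨σ, hσ⟩
      simp only at h2
      rw [← h2]; simpa using hv
    obtain ⟨c, hc, rfl⟩ := Sym2.mem_map.1 this
    exact ⟨c, hc, rfl⟩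
  have hηinj : Function.Injective η := by
    intro σ τ h
    have h1 := hη σ
    rw [h, hη τ] at h1
    exact Subtype.ext (Sym2.map.injective hf h1).symm
  have key : ∀ (σ τ : G.edgeSet) p, D'.IsCrossing σ τ p → ∃ i j, i < D.N (η σ) ∧ j < D.N (η τ) ∧
      φ.symm p ∈ D.sg (η σ) i ∧ φ.symm p ∈ D.sg (η τ) j ∧
      dt (D.ch (η σ) (i + 1) - D.ch (η σ) i) (D.ch (η τ) (j + 1) - D.ch (η τ) j) ≠ 0 ∧
      (D.s (η σ) ≠ D.s (η τ) ∧ D.s (η σ) ≠ D.t (η τ) ∧ D.t (η σ) ≠ D.s (η τ) ∧ D.t (η σ) ≠ D.t (η τ)) ∧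
      ∀ i' j', i' < D.N (η σ) → j' < D.N (η τ) → (D.sg (η σ) i' ∩ D.sg (η τ) j').Nonempty → i' = i ∧ j' = j := by
    rintro σ τ p ⟨-, -, hne, h1, h2, h3, h4⟩
    obtain ⟨i, hi, hm1⟩ := hpts σ p h1
    obtain ⟨j, hj, hm2⟩ := hpts τ p h2
    rcases D.pair (η σ) (η τ) (fun h => hne (congrArg Subtype.val (hηinj h))) i j _ hi hj hm1 hm2 with ⟨v, hv⟩ | h
    · exfalso
      rw [hv] at hm1
      have := hends σ v (D.avoid _ v i hi hm1)
      rw [← hv] at this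
      exact h3 (by simpa using this)
    · exact ⟨i, j, hi, hj, hm1, hm2, h⟩
  refine ⟨D', ⟨?_, ?_, ?_, ?_⟩, ?_⟩
  · intro a b h
    obtain ⟨g, h1, h2, h3, h4, h5, h6⟩ := hspec a b h
    change Set.InjOn (darc D G f η a b) _
    rw [h6]
    exact fun t ht t' ht' he => h4 ht ht' (φ.injective he)
  · rintro e e' ⟨a, ha1, ha2⟩ p hp
    obtain ⟨i, j, -, -, -, -, -, hna, -⟩ := key ⟨e, hp.1⟩ ⟨e', hp.2.1⟩ p hp
    have g1 : f a ∈ s(D.s (η ⟨e, hp.1⟩), D.t (η ⟨e, hp.1⟩)) := by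
      rw [hη]; exact Sym2.mem_map.2 ⟨a, ha1, rfl⟩
    have g2 : f a ∈ s(D.s (η ⟨e', hp.2.1⟩), D.t (η ⟨e', hp.2.1⟩)) := by
      rw [hη]; exact Sym2.mem_map.2 ⟨a, ha2, rfl⟩
    rw [Sym2.mem_iff] at g1 g2
    grind
  · intro e e' p hp p' hp'
    obtain ⟨i, j, hi, hj, hm1, hm2, hd, -, hu⟩ := key ⟨e, hp.1⟩ ⟨e', hp.2.1⟩ p hp
    obtain ⟨i', j', hi', hj', hm1', hm2', -⟩ := key ⟨e, hp.1⟩ ⟨e', hp.2.1⟩ p' hp'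
    obtain ⟨rfl, rfl⟩ := hu i' j' hi' hj' ⟨_, hm1', hm2'⟩
    exact φ.symm.injective (transv_unique hd hm1 hm2 hm1' hm2')
  · rintro p e e' e'' h1 h2 h3 ⟨c1, c2, c3⟩
    obtain ⟨i, hi, hm⟩ := hpts ⟨e, c1.1⟩ p c1.2.2.2.1
    obtain ⟨j, hj, hm'⟩ := hpts ⟨e', c2.1⟩ p c2.2.2.2.1
    obtain ⟨k, hk, hm''⟩ := hpts ⟨e'', c2.2.1⟩ p c2.2.2.2.2.1
    obtain ⟨v, hv⟩ := D.triple _ _ _ (fun h => h1 (congrArg Subtype.val (hηinj h)))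
      (fun h => h2 (congrArg Subtype.val (hηinj h))) (fun h => h3 (congrArg Subtype.val (hηinj h)))
      i j k _ hi hj hk hm hm' hm''
    rw [hv] at hm
    have := hends ⟨e, c1.1⟩ v (D.avoid _ v i hi hm)
    rw [← hv] at this
    exact c1.2.2.2.2.2.1 (by simpa using this)
  · rintro σ τ ⟨p, hp⟩
    obtain ⟨i, j, hi, hj, hm1, hm2, hd, hna, hu⟩ := key σ τ p hp
    exact ⟨hna, ⟨_, ⟨i, hi, hm1⟩, ⟨j, hj, hm2⟩⟩⟩

end draw
end CrAux

namespace CrAux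

/-! ## Polygonal paths as lists -/

/-- the polygonal curve through a list of points -/
def poly : List ℂ → Set ℂ
  | [] => ∅
  | [x] => {x}
  | x :: y :: L => segment ℝ x y ∪ poly (y :: L)

/-- a simple polygonal curve -/
def Simple : List ℂ → Prop
  | [] => True
  | [_] => True
  | x :: y :: L => x ≠ y ∧ segment ℝ x y ∩ poly (y :: L) ⊆ {y} ∧ Simple (y :: L)

/-- consecutive pairs of a list -/
def SegIn : List ℂ → ℂ → ℂ → Prop
  | [], _, _ => False
  | [_], _, _ => False
  | a :: b :: L, x, y => (x = a ∧ y = b) ∨ SegIn (b :: L) x y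

lemma head_mem_poly (x : ℂ) (L : List ℂ) : x ∈ poly (x :: L) := by
  cases L with
  | nil => simp [poly]
  | cons y L => exact Or.inl (left_mem_segment _ _ _)

lemma head_mem {L : List ℂ} {x : ℂ} (h : L.head? = some x) : x ∈ poly L := by
  cases L with
  | nil => simp at h
  | cons y L => simp at h; subst h; exact head_mem_poly _ _

lemma last_mem {L : List ℂ} {x : ℂ} (h : L.getLast? = some x) : x ∈ poly L := by
  induction L with
  | nil => simp at h
  | cons y L ih =>
    cases L with
    | nil => simp at h; simp [poly, h]
    | cons z L => exact Or.inr (ih (by simpa using h))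

lemma poly_closed (L : List ℂ) : IsCompact (poly L) := by
  induction L with
  | nil => exact isCompact_empty
  | cons x L ih =>
    cases L with
    | nil => exact isCompact_singleton
    | cons y L => exact (seg_compact x y).union ih

lemma segIn_sub {L : List ℂ} {x y : ℂ} (h : SegIn L x y) : segment ℝ x y ⊆ poly L := by
  induction L with
  | nil => exact h.elim
  | cons a L ih =>
    cases L with
    | nil => exact h.elim
    | cons b L =>
      rcases h with ⟨rfl, rfl⟩ | h
      · exact Set.subset_union_left
      · exact (ih h).trans Set.subset_union_right

lemma mem_poly_seg {L : List ℂ} {z : ℂ} (h : z ∈ poly L) (hL : 2 ≤ L.length) :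
    ∃ x y, SegIn L x y ∧ z ∈ segment ℝ x y := by
  induction L with
  | nil => simp at hL
  | cons a L ih =>
    cases L with
    | nil => simp at hL
    | cons b L =>
      rcases h with h | h
      · exact ⟨a, b, Or.inl ⟨rfl, rfl⟩, h⟩
      · cases L with
        | nil =>
          simp [poly] at h; subst h
          exact ⟨a, z, Or.inl ⟨rfl, rfl⟩, right_mem_segment _ _ _⟩
        | cons c L =>
          obtain ⟨x, y, h1, h2⟩ := ih h (by simp)
          exact ⟨x, y, Or.inr h1, h2⟩

lemma suffix_path {L : List ℂ} {w t : ℂ} (hs : Simple L) (hw : w ∈ poly L) (ht : L.getLast? = some t) :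
    ∃ L', Simple (w :: L') ∧ poly (w :: L') ⊆ poly L ∧ (w :: L').getLast? = some t := by
  induction L with
  | nil => exact hw.elim
  | cons x L ih =>
    cases L with
    | nil =>
      simp [poly] at hw; subst hw
      exact ⟨[], trivial, subset_rfl, ht⟩
    | cons y L =>
      by_cases h : w ∈ poly (y :: L)
      · obtain ⟨L', h1, h2, h3⟩ := ih hs.2.2 h (by simpa using ht)
        exact ⟨L', h1, h2.trans Set.subset_union_right, h3⟩
      · have hw' : w ∈ segment ℝ x y := hw.resolve_right h
        have hsub : segment ℝ w y ⊆ segment ℝ x y :=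
          (convex_segment x y).segment_subset hw' (right_mem_segment _ _ _)
        refine ⟨y :: L, ⟨?_, ?_, hs.2.2⟩, ?_, by simpa using ht⟩
        · rintro rfl; exact h (head_mem_poly _ _)
        · exact fun z hz => hs.2.1 ⟨hsub hz.1, hz.2⟩
        · exact Set.union_subset_union_left _ hsub

/-- reachability by simple polygonal curves inside a set -/
def Reach (R : Set ℂ) (x t : ℂ) : Prop :=
  ∃ L, Simple L ∧ L.head? = some x ∧ L.getLast? = some t ∧ poly L ⊆ R

lemma Reach.prepend {R : Set ℂ} {x y t : ℂ} (h : Reach R y t) (hxy : segment ℝ x y ⊆ R) : Reach R x t := by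
  obtain ⟨L, h1, h2, h3, h4⟩ := h
  have hc : IsCompact (segment ℝ x y ∩ poly L) := (seg_compact x y).inter (poly_closed L)
  obtain ⟨w, hw, hmin⟩ := hc.exists_isMinOn ⟨y, right_mem_segment _ _ _, head_mem h2⟩
    (f := fun z => Dist.dist z x) (by fun_prop)
  obtain ⟨L', g1, g2, g3⟩ := suffix_path h1 hw.2 h3
  by_cases hx : w = x
  · subst hx
    exact ⟨_, g1, rfl, g3, g2.trans h4⟩
  have hsub : segment ℝ x w ⊆ segment ℝ x y :=
    (convex_segment x y).segment_subset (left_mem_segment _ _ _) hw.1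
  refine ⟨x :: w :: L', ⟨Ne.symm hx, ?_, g1⟩, rfl, by simpa using g3, ?_⟩
  · rintro z ⟨hz1, hz2⟩
    have hz := hmin (show z ∈ _ from ⟨hsub hz1, g2 hz2⟩)
    simp only [Set.mem_setOf_eq] at hz
    obtain ⟨θ, h0, h1, rfl⟩ := mem_sg.1 hz1
    have e : Dist.dist (x + θ • (w - x)) x = θ * Dist.dist w x := by
      rw [dist_eq_norm, add_sub_cancel_left, norm_smul, Real.norm_of_nonneg h0, dist_eq_norm]
    rw [e] at hz
    have hp : 0 < Dist.dist w x := dist_pos.2 hx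
    have : θ = 1 := by nlinarith
    subst this
    simp
  · exact Set.union_subset (hsub.trans hxy) (g2.trans h4)

lemma poly_append {P Q : List ℂ} {x y : ℂ} (hP : P.getLast? = some x) (hQ : Q.head? = some y) :
    poly (P ++ Q) = poly P ∪ segment ℝ x y ∪ poly Q := by
  induction P with
  | nil => simp at hP
  | cons a P ih =>
    cases P with
    | nil =>
      simp at hP; subst hP
      cases Q with
      | nil => simp at hQ
      | cons b Q =>
        simp at hQ; subst hQ
        simp only [List.cons_append, List.nil_append, poly]
        rw [Set.union_eq_self_of_subset_left (s := {a})]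
        simpa using left_mem_segment ℝ a b
    | cons b P =>
      have := ih (by simpa using hP)
      simp only [List.cons_append, poly] at this ⊢
      rw [this]
      simp only [Set.union_assoc]

lemma simple_append {P Q : List ℂ} {x y : ℂ} (hP : P.getLast? = some x) (hQ : Q.head? = some y)
    (sP : Simple P) (sQ : Simple Q) (hxy : x ≠ y) (h1 : segment ℝ x y ∩ poly P ⊆ {x})
    (h2 : segment ℝ x y ∩ poly Q ⊆ {y}) (h3 : Disjoint (poly P) (poly Q)) : Simple (P ++ Q) := by
  induction P with
  | nil => simpa using sQ
  | cons a P ih =>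
    cases P with
    | nil =>
      simp at hP; subst hP
      cases Q with
      | nil => trivial
      | cons b Q =>
        simp at hQ; subst hQ
        exact ⟨hxy, h2, sQ⟩
    | cons b P =>
      have hl : (b :: P).getLast? = some x := by simpa using hP
      have sub : poly (b :: P) ⊆ poly (a :: b :: P) := Set.subset_union_right
      have := ih hl sP.2.2 (fun z hz => h1 ⟨hz.1, sub hz.2⟩) (h3.mono_left sub)
      refine ⟨sP.1, ?_, this⟩
      rintro z ⟨hz1, hz2⟩
      change z ∈ poly ((b :: P) ++ Q) at hz2
      rw [poly_append hl hQ] at hz2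
      rcases hz2 with (hz2 | hz2) | hz2
      · exact sP.2.1 ⟨hz1, hz2⟩
      · have : z = x := h1 ⟨hz2, Or.inl hz1⟩
        subst this
        exact sP.2.1 ⟨hz1, last_mem hl⟩
      · exact absurd hz2 (Set.disjoint_left.1 h3 (Or.inl hz1))

lemma segIn_append {P Q : List ℂ} {x y a b : ℂ} (hP : P.getLast? = some x) (hQ : Q.head? = some y)
    (h : SegIn (P ++ Q) a b) : SegIn P a b ∨ (a = x ∧ b = y) ∨ SegIn Q a b := by
  induction P with
  | nil => simp at hP
  | cons c P ih =>
    cases P with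
    | nil =>
      simp at hP; subst hP
      cases Q with
      | nil => simp at hQ
      | cons d Q =>
        simp at hQ; subst hQ
        rcases h with h | h
        · exact Or.inr (Or.inl h)
        · exact Or.inr (Or.inr h)
    | cons d P =>
      rcases h with h | h
      · exact Or.inl (Or.inl h)
      · rcases ih (by simpa using hP) h with h | h | h
        · exact Or.inl (Or.inr h)
        · exact Or.inr (Or.inl h)
        · exact Or.inr (Or.inr h)

/-! index form -/

lemma getD_segIn {L : List ℂ} {i : ℕ} (h : i + 1 < L.length) : SegIn L (L.getD i 0) (L.getD (i + 1) 0) := by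
  induction L generalizing i with
  | nil => simp at h
  | cons a L ih =>
    cases L with
    | nil => simp at h
    | cons b L =>
      cases i with
      | zero => exact Or.inl ⟨by simp, by simp⟩
      | succ i =>
        right
        have := ih (i := i) (by simpa using h)
        simpa only [List.getD_cons_succ] using this

lemma simple_ne {L : List ℂ} (hs : Simple L) {x y : ℂ} (h : SegIn L x y) : x ≠ y := by
  induction L with
  | nil => exact h.elim
  | cons a L ih =>
    cases L with
    | nil => exact h.elim
    | cons b L =>
      rcases h with ⟨rfl, rfl⟩ | h
      · exact hs.1
      · exact ih hs.2.2 h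

lemma simple_adj {L : List ℂ} (hs : Simple L) {i : ℕ} (h : i + 2 < L.length) :
    segment ℝ (L.getD i 0) (L.getD (i + 1) 0) ∩ segment ℝ (L.getD (i + 1) 0) (L.getD (i + 1 + 1) 0) ⊆
      {L.getD (i + 1) 0} := by
  induction L generalizing i with
  | nil => simp at h
  | cons a L ih =>
    cases L with
    | nil => simp at h
    | cons b L =>
      cases i with
      | succ i =>
        have := ih hs.2.2 (i := i) (by simpa using h)
        simpa only [List.getD_cons_succ] using this
      | zero =>
        have h' : 0 + 1 < (b :: L).length := by simpa using h
        have := segIn_sub (getD_segIn h')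
        simp only [List.getD_cons_succ, List.getD_cons_zero] at this ⊢
        exact fun z hz => hs.2.1 ⟨hz.1, this hz.2⟩

lemma simple_head {L : List ℂ} (hs : Simple L) {j : ℕ} (hj : 0 < j) (h : j + 1 < L.length) :
    L.getD 0 0 ∉ segment ℝ (L.getD j 0) (L.getD (j + 1) 0) := by
  cases L with
  | nil => simp at h
  | cons a L =>
    cases L with
    | nil => simp at h
    | cons b L =>
      cases j with
      | zero => simp at hj
      | succ j =>
        have h' : j + 1 < (b :: L).length := by simpa using h
        have := segIn_sub (getD_segIn h')
        simp only [List.getD_cons_succ, List.getD_cons_zero] at this ⊢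
        intro hz
        exact hs.1 (hs.2.1 ⟨left_mem_segment _ _ _, this hz⟩)

lemma simple_sep {L : List ℂ} (hs : Simple L) {i j : ℕ} (hij : i + 1 < j) (h : j + 1 < L.length) :
    Disjoint (segment ℝ (L.getD i 0) (L.getD (i + 1) 0)) (segment ℝ (L.getD j 0) (L.getD (j + 1) 0)) := by
  induction L generalizing i j with
  | nil => simp at h
  | cons a L ih =>
    cases L with
    | nil => simp at h
    | cons b L =>
      obtain ⟨j, rfl⟩ : ∃ j', j = j' + 1 := ⟨j - 1, by omega⟩
      have h' : j + 1 < (b :: L).length := by simpa using h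
      cases i with
      | succ i =>
        have := ih hs.2.2 (i := i) (j := j) (by omega) h'
        simpa only [List.getD_cons_succ] using this
      | zero =>
        have h1 := segIn_sub (getD_segIn h')
        have h2 := simple_head hs.2.2 (j := j) (by omega) h'
        rw [Set.disjoint_left]
        simp only [List.getD_cons_succ, List.getD_cons_zero] at h1 h2 ⊢
        intro z hz1 hz2
        have : z = b := hs.2.1 ⟨hz1, h1 hz2⟩
        subst this
        exact h2 hz2

/-! concatenation of many lists -/

/-- concatenation of `A 0, …, A k` -/
def cat (A : ℕ → List ℂ) : ℕ → List ℂ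
  | 0 => A 0
  | k + 1 => cat A k ++ A (k + 1)

theorem cat_spec (A : ℕ → List ℂ) (hd lt : ℕ → ℂ) (k : ℕ) (h1 : ∀ i ≤ k, (A i).head? = some (hd i))
    (h2 : ∀ i ≤ k, (A i).getLast? = some (lt i)) (hs : ∀ i ≤ k, Simple (A i))
    (hdis : ∀ i j, i < j → j ≤ k → Disjoint (poly (A i)) (poly (A j)))
    (hne : ∀ i < k, lt i ≠ hd (i + 1))
    (hc : ∀ i j, i < k → j ≤ k → segment ℝ (lt i) (hd (i + 1)) ∩ poly (A j) ⊆
      {z | (j = i ∧ z = lt i) ∨ (j = i + 1 ∧ z = hd (i + 1))})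
    (hcc : ∀ i j, i < j → j < k → Disjoint (segment ℝ (lt i) (hd (i + 1))) (segment ℝ (lt j) (hd (j + 1)))) :
    Simple (cat A k) ∧ (cat A k).head? = some (hd 0) ∧ (cat A k).getLast? = some (lt k) ∧
    (∀ z ∈ poly (cat A k), (∃ i ≤ k, z ∈ poly (A i)) ∨ ∃ i < k, z ∈ segment ℝ (lt i) (hd (i + 1))) ∧
    (∀ x y, SegIn (cat A k) x y → (∃ i ≤ k, SegIn (A i) x y) ∨ ∃ i < k, x = lt i ∧ y = hd (i + 1)) := by
  induction k with
  | zero =>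
    refine ⟨hs 0 le_rfl, h1 0 le_rfl, h2 0 le_rfl, fun z hz => Or.inl ⟨0, le_rfl, hz⟩,
      fun x y h => Or.inl ⟨0, le_rfl, h⟩⟩
  | succ k ih =>
    obtain ⟨i1, i2, i3, i4, i5⟩ := ih (fun i hi => h1 i (by omega)) (fun i hi => h2 i (by omega))
      (fun i hi => hs i (by omega)) (fun i j hij hj => hdis i j hij (by omega)) (fun i hi => hne i (by omega))
      (fun i j hi hj => hc i j (by omega) (by omega)) (fun i j hij hj => hcc i j hij (by omega))
    have hh := h1 (k + 1) le_rfl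
    refine ⟨?_, ?_, ?_, ?_, ?_⟩
    · refine simple_append i3 hh i1 (hs _ le_rfl) (hne k (by omega)) ?_ ?_ ?_
      · rintro z ⟨hz1, hz2⟩
        rcases i4 z hz2 with ⟨i, hi, hz⟩ | ⟨i, hi, hz⟩
        · rcases hc k i (by omega) (by omega) ⟨hz1, hz⟩ with h | h
          · exact h.2
          · omega
        · exact absurd hz1 (Set.disjoint_left.1 (hcc i k hi (by omega)) hz)
      · rintro z ⟨hz1, hz2⟩
        rcases hc k (k + 1) (by omega) le_rfl ⟨hz1, hz2⟩ with h | h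
        · omega
        · exact h.2
      · rw [Set.disjoint_left]
        intro z hz1 hz2
        rcases i4 z hz1 with ⟨i, hi, hz⟩ | ⟨i, hi, hz⟩
        · exact Set.disjoint_left.1 (hdis i (k + 1) (by omega) le_rfl) hz hz2
        · rcases hc i (k + 1) (by omega) le_rfl ⟨hz, hz2⟩ with h | h <;> omega
    · simp [cat, i2]
    · simp [cat, List.getLast?_append, h2 (k + 1) le_rfl]
    · intro z hz
      rw [cat, poly_append i3 hh] at hz
      rcases hz with (hz | hz) | hz
      · rcases i4 z hz with ⟨i, hi, hz⟩ | ⟨i, hi, hz⟩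
        · exact Or.inl ⟨i, by omega, hz⟩
        · exact Or.inr ⟨i, by omega, hz⟩
      · exact Or.inr ⟨k, by omega, hz⟩
      · exact Or.inl ⟨k + 1, le_rfl, hz⟩
    · intro x y h
      rcases segIn_append i3 hh h with h | h | h
      · rcases i5 x y h with ⟨i, hi, hz⟩ | ⟨i, hi, hz⟩
        · exact Or.inl ⟨i, by omega, hz⟩
        · exact Or.inr ⟨i, by omega, hz⟩
      · exact Or.inr ⟨k, by omega, h⟩
      · exact Or.inl ⟨k + 1, le_rfl, h⟩

end CrAux

namespace CrAux

/-! ## Polygonal approximation of arcs between special points -/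

lemma spoke_mem {c a z : ℂ} {ρ : ℝ} (hd : Dist.dist a c = 2 * ρ) (hz : z ∈ segment ℝ (midpoint ℝ c a) a) :
    ∃ θ : ℝ, 1 / 2 ≤ θ ∧ θ ≤ 1 ∧ z = c + θ • (a - c) ∧ Dist.dist z c = θ * (2 * ρ) := by
  obtain ⟨θ, h0, h1, rfl⟩ := mem_sg.1 hz
  have e : midpoint ℝ c a + θ • (a - midpoint ℝ c a) = c + (1 / 2 + θ / 2) • (a - c) := by
    rw [midpoint_eq_smul_add]
    simp only [invOf_eq_inv, Complex.real_smul]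
    push_cast; ring
  refine ⟨1 / 2 + θ / 2, by linarith, by linarith, e, ?_⟩
  rw [e, dist_eq_norm, add_sub_cancel_left, norm_smul, Real.norm_of_nonneg (by linarith), ← dist_eq_norm, hd]

theorem core {I : Type} [Finite I] (S : Set ℂ) (hS : S.Finite) (ρ : ℝ) (hρ : 0 < ρ)
    (hsep : ∀ p ∈ S, ∀ q ∈ S, p ≠ q → 2 * (2 * ρ) < Dist.dist p q) (mid : I → Set ℂ)
    (hcpt : ∀ i, IsCompact (mid i)) (hpre : ∀ i, IsPreconnected (mid i)) (c tp : I → Bool → ℂ)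
    (hc : ∀ i β, c i β ∈ S) (htp : ∀ i β, tp i β ∈ mid i) (hd : ∀ i β, Dist.dist (tp i β) (c i β) = 2 * ρ)
    (hmid : ∀ i, ∀ z ∈ mid i, ∀ q ∈ S, 2 * ρ ≤ Dist.dist z q ∧ (Dist.dist z q = 2 * ρ → ∃ β, c i β = q ∧ z = tp i β))
    (hdis : ∀ i j, i ≠ j → Disjoint (mid i) (mid j)) :
    ∃ A : I → List ℂ, (∀ i, Simple (A i) ∧ (A i).head? = some (midpoint ℝ (c i false) (tp i false)) ∧
      (A i).getLast? = some (midpoint ℝ (c i true) (tp i true)) ∧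
      (∀ z ∈ poly (A i), ∀ q ∈ S, ρ ≤ Dist.dist z q ∧
        (Dist.dist z q = ρ → ∃ β, c i β = q ∧ z = midpoint ℝ (c i β) (tp i β)))) ∧
      ∀ i j, i ≠ j → Disjoint (poly (A i)) (poly (A j)) := by
  let sp : I → Bool → Set ℂ := fun i β => segment ℝ (midpoint ℝ (c i β) (tp i β)) (tp i β)
  let M : I → Set ℂ := fun i => mid i ∪ (sp i false ∪ sp i true)
  have hMc : ∀ i, IsCompact (M i) := fun i => (hcpt i).union ((seg_compact _ _).union (seg_compact _ _))
  have hM : ∀ i z, z ∈ M i → z ∈ mid i ∨ ∃ β, z ∈ sp i β := by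
    rintro i z (h | h | h)
    exacts [Or.inl h, Or.inr ⟨_, h⟩, Or.inr ⟨_, h⟩]
  have hsm : ∀ i j, i ≠ j → ∀ β z, z ∈ sp i β → z ∉ mid j := by
    intro i j hij β z hz hz'
    obtain ⟨θ, h0, h1, rfl, h3⟩ := spoke_mem (hd i β) hz
    have := (hmid j _ hz' _ (hc i β)).1
    rw [h3] at this
    have : θ = 1 := by nlinarith
    subst this
    apply Set.disjoint_left.1 (hdis i j hij) (htp i β)
    simpa using hz'
  have hMdis : ∀ i j, i ≠ j → Disjoint (M i) (M j) := by
    intro i j hij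
    rw [Set.disjoint_left]
    intro z hz hz'
    rcases hM i z hz with h | ⟨β, h⟩ <;> rcases hM j z hz' with h' | ⟨β', h'⟩
    · exact Set.disjoint_left.1 (hdis i j hij) h h'
    · exact hsm j i hij.symm β' z h' h
    · exact hsm i j hij β z h h'
    · obtain ⟨θ, h0, h1, h2, h3⟩ := spoke_mem (hd i β) h
      obtain ⟨θ', h0', h1', h2', h3'⟩ := spoke_mem (hd j β') h'
      have hcc : c i β = c j β' := by
        by_contra hne
        have := hsep _ (hc i β) _ (hc j β') hne
        have t := _root_.dist_triangle_left (c i β) (c j β') z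
        nlinarith
      rw [hcc] at h3
      have : θ = θ' := by
        have : θ * (2 * ρ) = θ' * (2 * ρ) := h3.symm.trans h3'
        exact mul_right_cancel₀ (by positivity) this
      subst this
      rw [h2', hcc] at h2
      have h4 := smul_right_injective ℂ (r := θ) (by linarith) (add_left_cancel h2)
      have : tp j β' = tp i β := sub_left_injective h4
      exact Set.disjoint_left.1 (hdis i j hij) (htp i β) (this ▸ htp j β')
  have hev : ∀ᶠ δ in 𝓝[>] (0:ℝ), ∀ i j, i ≠ j → Disjoint (Metric.thickening δ (M i)) (Metric.thickening δ (M j)) := by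
    rw [eventually_all]; intro i
    rw [eventually_all]; intro j
    by_cases hij : i = j
    · simp [hij]
    obtain ⟨δ, hδ, h⟩ := (hMdis i j hij).exists_thickenings (hMc i) (hMc j).isClosed
    filter_upwards [Ioo_mem_nhdsGT hδ] with δ' hδ' _
    exact h.mono (Metric.thickening_mono hδ'.2.le _) (Metric.thickening_mono hδ'.2.le _)
  obtain ⟨δ, hδ1, hδ0, hδ⟩ := (hev.and (Ioo_mem_nhdsGT hρ)).exists
  let R : I → Set ℂ := fun i => Metric.thickening δ (mid i) ∪ (sp i false ∪ sp i true)
  have hRM : ∀ i, R i ⊆ Metric.thickening δ (M i) := by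
    intro i
    apply Set.union_subset
    · exact Metric.thickening_subset_of_subset _ Set.subset_union_left
    · exact Set.subset_union_right.trans (Metric.self_subset_thickening hδ0 _)
  have hR : ∀ i, ∀ z ∈ R i, ∀ q ∈ S, ρ ≤ Dist.dist z q ∧
        (Dist.dist z q = ρ → ∃ β, c i β = q ∧ z = midpoint ℝ (c i β) (tp i β)) := by
    intro i z hz q hq
    have : z ∈ Metric.thickening δ (mid i) ∨ ∃ β, z ∈ sp i β := by
      rcases hz with h | h | h
      exacts [Or.inl h, Or.inr ⟨_, h⟩, Or.inr ⟨_, h⟩]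
    rcases this with h | ⟨β, h⟩
    · obtain ⟨w, hw, hzw⟩ := Metric.mem_thickening_iff.1 h
      have h1 := (hmid i w hw q hq).1
      have h2 := _root_.dist_triangle_left w q z
      have : ρ < Dist.dist z q := by linarith
      exact ⟨this.le, fun h => absurd h this.ne'⟩
    · obtain ⟨θ, h0, h1, h2, h3⟩ := spoke_mem (hd i β) h
      by_cases hcq : c i β = q
      · rw [← hcq, h3]
        refine ⟨by nlinarith, fun h => ⟨β, rfl, ?_⟩⟩
        have : θ = 1 / 2 := by nlinarith
        rw [h2, this, midpoint_eq_smul_add]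
        simp only [invOf_eq_inv, Complex.real_smul]
        push_cast; ring
      · have := hsep _ (hc i β) _ hq hcq
        have t := _root_.dist_triangle_left (c i β) q z
        have : ρ < Dist.dist z q := by nlinarith
        exact ⟨this.le, fun h => absurd h this.ne'⟩
  have hreach : ∀ i, Reach (R i) (midpoint ℝ (c i false) (tp i false)) (midpoint ℝ (c i true) (tp i true)) := by
    intro i
    have hne : tp i true ≠ midpoint ℝ (c i true) (tp i true) := by
      intro h
      have h1 := hd i true
      have : tp i true = c i true := by
        rw [midpoint_eq_smul_add] at h
        simp only [invOf_eq_inv, Complex.real_smul] at h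
        push_cast at h
        linear_combination 2 * h
      rw [this, _root_.dist_self] at h1
      linarith
    have b : Reach (R i) (tp i true) (midpoint ℝ (c i true) (tp i true)) := by
      refine ⟨[_, _], ⟨hne, ?_, trivial⟩, rfl, rfl, ?_⟩
      · simp [poly]
      · simp only [poly]
        rw [Set.union_eq_self_of_subset_right (by simpa using right_mem_segment ℝ _ _), segment_symm]
        exact Set.subset_union_right.trans Set.subset_union_right
    have a : Reach (R i) (tp i false) (midpoint ℝ (c i true) (tp i true)) := by
      refine (hpre i).induction₂' (fun x y => Reach (R i) x (midpoint ℝ (c i true) (tp i true)) →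
        Reach (R i) y (midpoint ℝ (c i true) (tp i true))) ?_ (fun _ _ _ _ _ _ h1 h2 h => h2 (h1 h)) (htp i true) (htp i false) b
      intro x hx
      have hb : Metric.ball x δ ⊆ R i := fun z hz => Or.inl (Metric.mem_thickening_iff.2 ⟨x, hx, hz⟩)
      filter_upwards [mem_nhdsWithin_of_mem_nhds (Metric.ball_mem_nhds x hδ0)] with y hy
      have := (convex_ball x δ).segment_subset hy (Metric.mem_ball_self hδ0)
      refine ⟨fun h => h.prepend (this.trans hb), fun h => h.prepend ?_⟩
      rw [segment_symm]; exact this.trans hb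
    refine a.prepend ?_
    exact Set.subset_union_left.trans Set.subset_union_right
  choose A h1 h2 h3 h4 using hreach
  exact ⟨A, fun i => ⟨h1 i, h2 i, h3 i, fun z hz => hR i z (h4 i hz)⟩,
    fun i j hij => (hδ1 i j hij).mono ((h4 i).trans (hRM i)) ((h4 j).trans (hRM j))⟩

lemma last_exit {g : ℝ → ℂ} {l r : ℝ} (hlr : l ≤ r) (hg : ContinuousOn g (Set.Icc l r)) {p : ℂ} {ρ : ℝ}
    (hl : Dist.dist (g l) p ≤ ρ) (hr : ρ < Dist.dist (g r) p) :
    ∃ t ∈ Set.Icc l r, Dist.dist (g t) p = ρ ∧ ∀ t' ∈ Set.Icc l r, t < t' → ρ < Dist.dist (g t') p := by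
  have hcont : ContinuousOn (fun t => Dist.dist (g t) p) (Set.Icc l r) := fun t ht => (hg t ht).dist continuousWithinAt_const
  have hcl : IsCompact (Set.Icc l r ∩ (fun t => Dist.dist (g t) p) ⁻¹' Set.Iic ρ) :=
    isCompact_Icc.of_isClosed_subset (hcont.preimage_isClosed_of_isClosed isClosed_Icc isClosed_Iic)
      Set.inter_subset_left
  obtain ⟨t, ⟨ht, htρ⟩, hmax⟩ := hcl.exists_isGreatest ⟨l, ⟨le_rfl, hlr⟩, hl⟩
  have hmax' : ∀ t' ∈ Set.Icc l r, t < t' → ρ < Dist.dist (g t') p := by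
    intro t' ht' h
    by_contra hc
    exact absurd (hmax ⟨ht', not_lt.1 hc⟩) (not_le.2 h)
  refine ⟨t, ht, ?_, hmax'⟩
  obtain ⟨t', ht', he⟩ := intermediate_value_Icc ht.2 (hcont.mono (Set.Icc_subset_Icc_left ht.1))
    ⟨htρ, hr.le⟩
  have : t' ≤ t := hmax ⟨⟨ht.1.trans ht'.1, ht'.2⟩, he.le⟩
  have : t' = t := le_antisymm this ht'.1
  subst this; exact he

lemma first_entry {g : ℝ → ℂ} {l r : ℝ} (hlr : l ≤ r) (hg : ContinuousOn g (Set.Icc l r)) {p : ℂ} {ρ : ℝ}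
    (hl : Dist.dist (g r) p ≤ ρ) (hr : ρ < Dist.dist (g l) p) :
    ∃ t ∈ Set.Icc l r, Dist.dist (g t) p = ρ ∧ ∀ t' ∈ Set.Icc l r, t' < t → ρ < Dist.dist (g t') p := by
  obtain ⟨t, ht, h1, h2⟩ := last_exit (g := fun t => g (-t)) (l := -r) (r := -l) (p := p) (ρ := ρ) (by linarith)
    (hg.comp continuousOn_neg (fun t ht => ⟨by linarith [ht.2], by linarith [ht.1]⟩)) (by simpa) (by simpa)
  refine ⟨-t, ⟨by linarith [ht.2], by linarith [ht.1]⟩, h1, fun t' ht' h => ?_⟩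
  have := h2 (-t') ⟨by linarith [ht'.2], by linarith [ht'.1]⟩ (by linarith)
  simpa using this

theorem polygonalize {I : Type} [Finite I] (S : Set ℂ) (hS : S.Finite) (γ : I → ℝ → ℂ) (l r : I → ℝ)
    (hlr : ∀ i, l i < r i) (hcont : ∀ i, ContinuousOn (γ i) (Set.Icc (l i) (r i)))
    (hl : ∀ i, γ i (l i) ∈ S) (hr : ∀ i, γ i (r i) ∈ S) (hne : ∀ i, γ i (l i) ≠ γ i (r i))
    (hav : ∀ i, ∀ t ∈ Set.Ioo (l i) (r i), γ i t ∉ S)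
    (hdis : ∀ i j, i ≠ j → ∀ t ∈ Set.Ioo (l i) (r i), ∀ t' ∈ Set.Ioo (l j) (r j), γ i t ≠ γ j t') :
    ∃ ρ > 0, (∀ p ∈ S, ∀ q ∈ S, p ≠ q → 2 * (2 * ρ) < Dist.dist p q) ∧
    ∃ (A : I → List ℂ) (hd lt : I → ℂ), (∀ i, Simple (A i) ∧ (A i).head? = some (hd i) ∧
      (A i).getLast? = some (lt i) ∧ Dist.dist (hd i) (γ i (l i)) = ρ ∧ Dist.dist (lt i) (γ i (r i)) = ρ ∧
      (∀ z ∈ poly (A i), ∀ q ∈ S, ρ ≤ Dist.dist z q ∧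
        (Dist.dist z q = ρ → (γ i (l i) = q ∧ z = hd i) ∨ (γ i (r i) = q ∧ z = lt i)))) ∧
      ∀ i j, i ≠ j → Disjoint (poly (A i)) (poly (A j)) := by
  have hev : ∀ᶠ ρ in 𝓝[>] (0:ℝ), (∀ p ∈ S, ∀ q ∈ S, p ≠ q → 2 * (2 * ρ) < Dist.dist p q) ∧
      ∀ i, ∀ q ∈ S, q ≠ γ i (l i) → q ≠ γ i (r i) → ∀ t ∈ Set.Icc (l i) (r i), 2 * ρ < Dist.dist (γ i t) q := by
    refine Filter.Eventually.and ?_ ?_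
    · rw [Filter.eventually_all_finite hS]; intro p hp
      rw [Filter.eventually_all_finite hS]; intro q hq
      by_cases h : p = q
      · simp [h]
      have := dist_pos.2 h
      filter_upwards [Ioo_mem_nhdsGT (show (0:ℝ) < Dist.dist p q / 4 by linarith)] with ρ hρ _
      linarith [hρ.2]
    · rw [eventually_all]; intro i
      rw [Filter.eventually_all_finite hS]; intro q hq
      by_cases h1 : q = γ i (l i)
      · simp [h1]
      by_cases h2 : q = γ i (r i)
      · simp [h2]
      have hcl := (isCompact_Icc.image_of_continuousOn (hcont i)).isClosed
      have hq' : q ∈ (γ i '' Set.Icc (l i) (r i))ᶜ := by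
        rintro ⟨t, ht, rfl⟩
        rcases eq_or_lt_of_le ht.1 with h | h
        · rw [h] at h1; exact h1 rfl
        rcases eq_or_lt_of_le ht.2 with h' | h'
        · rw [h'] at h2; exact h2 rfl
        exact hav i t ⟨h, h'⟩ hq
      obtain ⟨ε, hε, hb⟩ := Metric.isOpen_iff.1 hcl.isOpen_compl q hq'
      filter_upwards [Ioo_mem_nhdsGT (show (0:ℝ) < ε / 2 by linarith)] with ρ hρ _ _ t ht
      by_contra hc
      exact hb (Metric.mem_ball.2 (show Dist.dist (γ i t) q < ε by linarith [hρ.2])) ⟨t, ht, rfl⟩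
  obtain ⟨ρ, ⟨hsep, hfar⟩, hρ : 0 < ρ⟩ := (hev.and self_mem_nhdsWithin).exists
  have hex : ∀ i, ∃ t1 t2, l i < t1 ∧ t1 ≤ t2 ∧ t2 < r i ∧ Dist.dist (γ i t1) (γ i (l i)) = 2 * ρ ∧
      Dist.dist (γ i t2) (γ i (r i)) = 2 * ρ ∧ ∀ t ∈ Set.Icc t1 t2, (2 * ρ ≤ Dist.dist (γ i t) (γ i (l i)) ∧
      (Dist.dist (γ i t) (γ i (l i)) = 2 * ρ → t = t1)) ∧ (2 * ρ ≤ Dist.dist (γ i t) (γ i (r i)) ∧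
      (Dist.dist (γ i t) (γ i (r i)) = 2 * ρ → t = t2)) := by
    intro i
    have hs := hsep _ (hl i) _ (hr i) (hne i)
    obtain ⟨t1, ht1, h1, h2⟩ := last_exit (p := γ i (l i)) (ρ := 2 * ρ) (hlr i).le (hcont i) (by simp; positivity)
      (by rw [_root_.dist_comm]; linarith)
    have htri := _root_.dist_triangle_left (γ i (l i)) (γ i (r i)) (γ i t1)
    obtain ⟨t2, ht2, h3, h4⟩ := first_entry (p := γ i (r i)) (ρ := 2 * ρ) ht1.2
      ((hcont i).mono (Set.Icc_subset_Icc_left ht1.1)) (by simp; positivity) (by linarith)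
    refine ⟨t1, t2, ?_, ht2.1, ?_, h1, h3, ?_⟩
    · apply lt_of_le_of_ne ht1.1
      rintro rfl; rw [_root_.dist_self] at h1; linarith
    · apply lt_of_le_of_ne ht2.2
      rintro rfl; rw [_root_.dist_self] at h3; linarith
    · intro t ht
      constructor
      · rcases eq_or_lt_of_le ht.1 with h | h
        · subst h; exact ⟨h1.ge, fun _ => rfl⟩
        · have := h2 t ⟨ht1.1.trans ht.1, ht.2.trans ht2.2⟩ h
          exact ⟨this.le, fun h => by linarith⟩
      · rcases eq_or_lt_of_le ht.2 with h | h
        · subst h; exact ⟨h3.ge, fun _ => rfl⟩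
        · have := h4 t ⟨ht.1, ht.2.trans ht2.2⟩ h
          exact ⟨this.le, fun h => by linarith⟩
  choose t1 t2 g1 g2 g3 g4 g5 g6 using hex
  have hsub : ∀ i, Set.Icc (t1 i) (t2 i) ⊆ Set.Ioo (l i) (r i) := fun i t ht =>
    ⟨(g1 i).trans_le ht.1, ht.2.trans_lt (g3 i)⟩
  let c : I → Bool → ℂ := fun i β => if β then γ i (r i) else γ i (l i)
  let tp : I → Bool → ℂ := fun i β => if β then γ i (t2 i) else γ i (t1 i)
  have hcm : ∀ i, ContinuousOn (γ i) (Set.Icc (t1 i) (t2 i)) := fun i =>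
    (hcont i).mono ((hsub i).trans Set.Ioo_subset_Icc_self)
  obtain ⟨A, hA, hA'⟩ := core S hS ρ hρ hsep (fun i => γ i '' Set.Icc (t1 i) (t2 i))
    (fun i => isCompact_Icc.image_of_continuousOn (hcm i)) (fun i => isPreconnected_Icc.image _ (hcm i)) c tp
    (by intro i β; cases β <;> simp [c, hl, hr])
    (by
      intro i β
      cases β
      · exact ⟨t1 i, ⟨le_rfl, g2 i⟩, rfl⟩
      · exact ⟨t2 i, ⟨g2 i, le_rfl⟩, rfl⟩)
    (by intro i β; cases β <;> simp [c, tp, g4, g5])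
    (by
      rintro i _ ⟨t, ht, rfl⟩ q hq
      by_cases h1 : q = γ i (l i)
      · subst h1
        refine ⟨(g6 i t ht).1.1, fun h => ⟨false, rfl, ?_⟩⟩
        rw [(g6 i t ht).1.2 h]; rfl
      by_cases h2 : q = γ i (r i)
      · subst h2
        refine ⟨(g6 i t ht).2.1, fun h => ⟨true, rfl, ?_⟩⟩
        rw [(g6 i t ht).2.2 h]; rfl
      have := hfar i q hq h1 h2 t (Set.Ioo_subset_Icc_self (hsub i ht))
      exact ⟨this.le, fun h => by linarith⟩)
    (by
      intro i j hij
      rw [Set.disjoint_left]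
      rintro _ ⟨t, ht, rfl⟩ ⟨t', ht', he⟩
      exact hdis i j hij t (hsub i ht) t' (hsub j ht') he.symm)
  have hmd : ∀ a b : ℂ, Dist.dist a b = 2 * ρ → Dist.dist (midpoint ℝ b a) b = ρ := by
    intro a b h
    rw [dist_midpoint_left, _root_.dist_comm, h]
    simp
  refine ⟨ρ, hρ, hsep, A, fun i => midpoint ℝ (γ i (l i)) (γ i (t1 i)), fun i => midpoint ℝ (γ i (r i)) (γ i (t2 i)),
    fun i => ⟨(hA i).1, (hA i).2.1, (hA i).2.2.1, hmd _ _ (g4 i), hmd _ _ (g5 i), ?_⟩, hA'⟩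
  intro z hz q hq
  obtain ⟨k1, k2⟩ := (hA i).2.2.2 z hz q hq
  refine ⟨k1, fun h => ?_⟩
  obtain ⟨β, h3, h4⟩ := k2 h
  cases β
  · exact Or.inl ⟨h3, h4⟩
  · exact Or.inr ⟨h3, h4⟩

end CrAux

namespace CrAux

/-! ## Assembling chains through small discs -/

lemma sphere_end {c x y z : ℂ} {ρ : ℝ} (hx : Dist.dist x c ≤ ρ) (hy : Dist.dist y c ≤ ρ) (hz : z ∈ segment ℝ x y)
    (h : ρ ≤ Dist.dist z c) : z = x ∨ z = y := by
  by_contra hc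
  push Not at hc
  by_cases hxy : x = y
  · subst hxy; rw [segment_same] at hz; exact hc.1 hz
  have hz' : z ∈ openSegment ℝ x y := mem_openSegment_of_ne_left_right hc.1.symm hc.2.symm hz
  have := (strictConvex_closedBall ℝ c ρ).openSegment_subset (Metric.mem_closedBall.2 hx)
    (Metric.mem_closedBall.2 hy) hxy hz'
  by_cases hρ : ρ = 0
  · subst hρ
    rw [Metric.closedBall_zero] at this
    have h2 := interior_subset this
    have : x = c := dist_le_zero.1 hx
    have h3 : y = c := dist_le_zero.1 hy
    exact hxy (this.trans h3.symm)
  rw [interior_closedBall _ hρ] at this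
  exact absurd (Metric.mem_ball.1 this) (not_lt.2 h)

/-- two spokes from an interior point -/
lemma spokes {p c w w' z : ℂ} {ρ : ℝ} (hc : Dist.dist c p < ρ) (hw : Dist.dist w p = ρ) (hw' : Dist.dist w' p = ρ)
    (hne : w ≠ w') (hz : z ∈ segment ℝ c w) (hz' : z ∈ segment ℝ c w') : z = c := by
  by_contra hzc
  obtain ⟨θ, h0, h1, e⟩ := mem_sg.1 hz
  obtain ⟨θ', h0', h1', e'⟩ := mem_sg.1 hz'
  have key : ∀ w w' : ℂ, Dist.dist w p = ρ → Dist.dist w' p = ρ → w ≠ w' → ∀ θ θ' : ℝ, 0 ≤ θ → 0 ≤ θ' → θ ≤ θ' →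
      z = c + θ • (w - c) → z = c + θ' • (w' - c) → False := by
    intro w w' hw hw' hne θ θ' h0 h0' hle e e'
    have hpos : 0 < θ' := by
      rcases h0'.eq_or_lt with h | h
      · rw [← h] at e'; simp at e'; exact absurd e' hzc
      · exact h
    have hm : w' ∈ segment ℝ c w := by
      refine mem_sg.2 ⟨θ / θ', by positivity, by rw [div_le_one hpos]; exact hle, ?_⟩
      have : θ' • (w' - c) = θ • (w - c) := add_left_cancel (e'.symm.trans e)
      have h2 : w' - c = (θ / θ') • (w - c) := by
        rw [div_eq_inv_mul, mul_smul, ← this, smul_smul, inv_mul_cancel₀ hpos.ne', one_smul]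
      rw [← h2]; ring
    rcases sphere_end hc.le hw.le hm hw'.ge with h | h
    · subst h; linarith
    · exact hne h.symm
  rcases le_total θ θ' with h | h
  · exact key w w' hw hw' hne θ θ' h0 h0' h e e'
  · exact key w' w hw' hw hne.symm θ' θ h0' h0 h e' e

/-- intersecting chords with distinct ends are transversal -/
lemma chords {p x y x' y' z : ℂ} {ρ : ℝ} (hx : Dist.dist x p = ρ) (hy : Dist.dist y p = ρ) (hx' : Dist.dist x' p = ρ)
    (hxy : x ≠ y) (h1 : x' ≠ x) (h2 : x' ≠ y) (h3 : x' ≠ y')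
    (hz : z ∈ segment ℝ x y) (hz' : z ∈ segment ℝ x' y') (hy' : Dist.dist y' p = ρ) : dt (y - x) (y' - x') ≠ 0 := by
  intro hd
  have hv : y - x ≠ 0 := sub_ne_zero.2 hxy.symm
  obtain ⟨θ, h0, hθ1, e⟩ := mem_sg.1 hz
  obtain ⟨θ', h0', hθ1', e'⟩ := mem_sg.1 hz'
  -- x' is on the line through x, y
  have hline : ∃ τ : ℝ, x' = x + τ • (y - x) := by
    have hn : 0 < Complex.normSq (y - x) := Complex.normSq_pos.2 hv
    obtain ⟨c, hc⟩ : ∃ c : ℝ, y' - x' = c • (y - x) := by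
      refine ⟨dp (y - x) (y' - x') / Complex.normSq (y - x), ?_⟩
      rw [eq_comm, div_eq_inv_mul, mul_smul, inv_smul_eq_iff₀ hn.ne']
      unfold dt at hd
      apply Complex.ext
      · simp [Complex.normSq_apply, dp] at hd ⊢
        linear_combination (y.im - x.im) * hd
      · simp [Complex.normSq_apply, dp] at hd ⊢
        linear_combination (-(y.re - x.re)) * hd
    refine ⟨θ - θ' * c, ?_⟩
    have : x' = z - θ' • (y' - x') := by rw [e']; ring
    rw [this, hc, e, smul_smul, sub_smul]; ring
  obtain ⟨τ, hτ⟩ := hline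
  -- three collinear points of the circle
  have q : ∀ s : ℝ, Complex.normSq (x + s • (y - x) - p) = Complex.normSq (x - p) + s * (2 * dp (x - p) (y - x)) +
      s ^ 2 * Complex.normSq (y - x) := by
    intro s
    simp [Complex.normSq_apply, dp]; ring
  have hn : ∀ w, Dist.dist w p = ρ → Complex.normSq (w - p) = ρ ^ 2 := by
    intro w hw
    rw [Complex.normSq_eq_norm_sq, ← dist_eq_norm, hw]
  have a1 := q 1
  rw [one_smul, add_sub_cancel, hn y hy, hn x hx] at a1
  have a2 := q τ
  rw [← hτ, hn x' hx', hn x hx] at a2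
  have hn' : 0 < Complex.normSq (y - x) := Complex.normSq_pos.2 hv
  have : τ * (τ - 1) * Complex.normSq (y - x) = 0 := by linear_combination τ * a1 - a2
  rcases mul_eq_zero.1 this with h | h
  · rcases mul_eq_zero.1 h with h | h
    · rw [h] at hτ; simp at hτ; exact h1 hτ
    · have : τ = 1 := by linarith
      rw [this] at hτ; simp at hτ; exact h2 hτ
  · exact hn'.ne' h

/-- data for chains running through discs -/
structure CD (V E : Type) where
  P : V → ℂ
  pos : V → ℂ
  S : Set ℂ
  s : E → V
  t : E → V
  k : E → ℕ
  ctr : E → ℕ → ℂ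
  B : E → ℕ → List ℂ
  hd : E → ℕ → ℂ
  lt : E → ℕ → ℂ
  ρ : ℝ
  ρpos : 0 < ρ
  sepS : ∀ p ∈ S, ∀ q ∈ S, p ≠ q → 2 * (2 * ρ) < Dist.dist p q
  PS : ∀ v, P v ∈ S
  P_inj : Function.Injective P
  near : ∀ v, Dist.dist (pos v) (P v) < ρ
  st : ∀ e, s e ≠ t e
  kpos : ∀ e, 0 < k e
  ctrS : ∀ e a, a ≤ k e → ctr e a ∈ S
  ctr_inj : ∀ e a b, a ≤ k e → b ≤ k e → ctr e a = ctr e b → a = b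
  ctr_zero : ∀ e, ctr e 0 = P (s e)
  ctr_k : ∀ e, ctr e (k e) = P (t e)
  ctrP : ∀ e a v, a ≤ k e → ctr e a = P v → v = s e ∨ v = t e
  once : ∀ e f a b a' b', e ≠ f → a ≤ k e → a' ≤ k e → b ≤ k f → b' ≤ k f → ctr e a = ctr f b →
    ctr e a' = ctr f b' → (∀ v, ctr e a ≠ P v) → (∀ v, ctr e a' ≠ P v) → a = a'
  nonadj : ∀ e f a b, e ≠ f → a ≤ k e → b ≤ k f → ctr e a = ctr f b → (∀ v, ctr e a ≠ P v) →
    (s e ≠ s f ∧ s e ≠ t f ∧ t e ≠ s f ∧ t e ≠ t f)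
  no3 : ∀ e f g a b c, e ≠ f → e ≠ g → f ≠ g → a ≤ k e → b ≤ k f → c ≤ k g → ctr e a = ctr f b → ctr f b = ctr g c →
    ∃ v, ctr e a = P v
  B_zero : ∀ e, B e 0 = [pos (s e)]
  B_last : ∀ e, B e (k e + 1) = [pos (t e)]
  B_hd : ∀ e i, i ≤ k e + 1 → (B e i).head? = some (hd e i)
  B_lt : ∀ e i, i ≤ k e + 1 → (B e i).getLast? = some (lt e i)
  B_simple : ∀ e i, i ≤ k e + 1 → Simple (B e i)
  far : ∀ e i, 0 < i → i ≤ k e → ∀ z ∈ poly (B e i), ∀ q ∈ S, ρ ≤ Dist.dist z q ∧ (Dist.dist z q = ρ →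
    (ctr e i = q ∧ z = lt e i) ∨ (∃ j, i = j + 1 ∧ ctr e j = q ∧ z = hd e i))
  lt_sph : ∀ e i, 0 < i → i ≤ k e → Dist.dist (lt e i) (ctr e i) = ρ
  hd_sph : ∀ e i, i < k e → Dist.dist (hd e (i + 1)) (ctr e i) = ρ
  dis : ∀ e f i j, 0 < i → i ≤ k e → 0 < j → j ≤ k f → (e ≠ f ∨ i ≠ j) → Disjoint (poly (B e i)) (poly (B f j))

namespace CD
variable {V E : Type} (D : CD V E)

lemma lt_zero (e : E) : D.lt e 0 = D.pos (D.s e) := by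
  have := D.B_lt e 0 (by omega)
  rw [D.B_zero] at this; simpa using this.symm

lemma hd_zero (e : E) : D.hd e 0 = D.pos (D.s e) := by
  have := D.B_hd e 0 (by omega)
  rw [D.B_zero] at this; simpa using this.symm

lemma hd_last (e : E) : D.hd e (D.k e + 1) = D.pos (D.t e) := by
  have := D.B_hd e _ le_rfl
  rw [D.B_last] at this; simpa using this.symm

lemma lt_last (e : E) : D.lt e (D.k e + 1) = D.pos (D.t e) := by
  have := D.B_lt e _ le_rfl
  rw [D.B_last] at this; simpa using this.symm

lemma eqS {p q z : ℂ} (hp : p ∈ D.S) (hq : q ∈ D.S) (h1 : Dist.dist z p ≤ D.ρ) (h2 : Dist.dist z q ≤ D.ρ) : p = q := by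
  by_contra h
  have := D.sepS p hp q hq h
  have t := _root_.dist_triangle_left p q z
  have := D.ρpos
  linarith

lemma pos_inj : Function.Injective D.pos := by
  intro v w h
  apply D.P_inj
  have h2 := D.near w
  rw [← h] at h2
  exact D.eqS (D.PS v) (D.PS w) (D.near v).le h2.le

lemma lt_ball (e : E) (i : ℕ) (hi : i ≤ D.k e) : Dist.dist (D.lt e i) (D.ctr e i) ≤ D.ρ := by
  rcases Nat.eq_zero_or_pos i with rfl | h
  · rw [D.lt_zero, D.ctr_zero]; exact (D.near _).le
  · exact (D.lt_sph e i h hi).le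

lemma hd_ball (e : E) (i : ℕ) (hi : i ≤ D.k e) : Dist.dist (D.hd e (i + 1)) (D.ctr e i) ≤ D.ρ := by
  rcases hi.eq_or_lt with rfl | h
  · rw [D.hd_last, D.ctr_k]; exact (D.near _).le
  · exact (D.hd_sph e i h).le

lemma conn_ball (e : E) (i : ℕ) (hi : i ≤ D.k e) {z : ℂ} (hz : z ∈ segment ℝ (D.lt e i) (D.hd e (i + 1))) :
    Dist.dist z (D.ctr e i) ≤ D.ρ :=
  Metric.mem_closedBall.1 ((convex_closedBall (D.ctr e i) D.ρ).segment_subset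
    (Metric.mem_closedBall.2 (D.lt_ball e i hi)) (Metric.mem_closedBall.2 (D.hd_ball e i hi)) hz)

lemma F (e : E) (j : ℕ) (hj : j ≤ D.k e + 1) {z q : ℂ} (hz : z ∈ poly (D.B e j)) (hq : q ∈ D.S)
    (h : Dist.dist z q ≤ D.ρ) : (j ≤ D.k e ∧ D.ctr e j = q ∧ z = D.lt e j) ∨
      (∃ j', j = j' + 1 ∧ D.ctr e j' = q ∧ z = D.hd e j) := by
  rcases Nat.eq_zero_or_pos j with rfl | h0
  · left
    rw [D.B_zero] at hz
    simp only [poly, Set.mem_singleton_iff] at hz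
    subst hz
    refine ⟨by omega, ?_, (D.lt_zero e).symm⟩
    rw [D.ctr_zero]; exact D.eqS (D.PS _) hq (D.near _).le h
  rcases hj.eq_or_lt with rfl | h1
  · right
    rw [D.B_last] at hz
    simp only [poly, Set.mem_singleton_iff] at hz
    subst hz
    refine ⟨_, rfl, ?_, (D.hd_last e).symm⟩
    rw [D.ctr_k]; exact D.eqS (D.PS _) hq (D.near _).le h
  · obtain ⟨k1, k2⟩ := D.far e j h0 (by omega) z hz q hq
    rcases k2 (le_antisymm h k1) with h | h
    · exact Or.inl ⟨by omega, h⟩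
    · exact Or.inr h

lemma mid_or (e : E) (j : ℕ) (hj : j ≤ D.k e + 1) {z : ℂ} (hz : z ∈ poly (D.B e j)) :
    (∃ v, z = D.pos v) ∨ (0 < j ∧ j ≤ D.k e) := by
  rcases Nat.eq_zero_or_pos j with rfl | h0
  · rw [D.B_zero] at hz
    exact Or.inl ⟨_, hz⟩
  rcases hj.eq_or_lt with rfl | h1
  · rw [D.B_last] at hz
    exact Or.inl ⟨_, hz⟩
  · exact Or.inr ⟨h0, by omega⟩

lemma Bdis (e : E) (i j : ℕ) (hij : i < j) (hj : j ≤ D.k e + 1) : Disjoint (poly (D.B e i)) (poly (D.B e j)) := by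
  rw [Set.disjoint_left]
  intro z hz hz'
  have key : ∀ i j, i ≠ j → i ≤ D.k e + 1 → j ≤ D.k e + 1 → z ∈ poly (D.B e i) → z ∈ poly (D.B e j) →
      ∀ v, z = D.pos v → False := by
    intro i j hij hi hj h1 h2 v hv
    have n := D.near v
    rw [← hv] at n
    have n1 : ∀ a, a ≤ D.k e + 1 → z ∈ poly (D.B e a) → a = 0 ∧ v = D.s e ∨ a = D.k e + 1 ∧ v = D.t e := by
      intro a ha hz
      rcases Nat.eq_zero_or_pos a with rfl | h0
      · rw [D.B_zero] at hz
        refine Or.inl ⟨rfl, D.pos_inj ?_⟩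
        rw [← hv]; exact hz
      rcases ha.eq_or_lt with rfl | h1
      · rw [D.B_last] at hz
        refine Or.inr ⟨rfl, D.pos_inj ?_⟩
        rw [← hv]; exact hz
      · have := (D.far e a h0 (by omega) z hz _ (D.PS v)).1
        linarith
    have := n1 i hi h1
    have := n1 j hj h2
    have := D.st e
    grind
  rcases D.mid_or e i (by omega) hz with ⟨v, hv⟩ | h
  · exact key i j hij.ne (by omega) hj hz hz' v hv
  rcases D.mid_or e j (by omega) hz' with ⟨v, hv⟩ | h'
  · exact key i j hij.ne (by omega) hj hz hz' v hv
  exact Set.disjoint_left.1 (D.dis e e i j h.1 h.2 h'.1 h'.2 (Or.inr hij.ne)) hz hz'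

/-- the chain of an edge -/
def L (e : E) : List ℂ := cat (D.B e) (D.k e + 1)

lemma conn_ne (e : E) (i : ℕ) (hi : i < D.k e + 1) : D.lt e i ≠ D.hd e (i + 1) := by
  intro h
  exact Set.disjoint_left.1 (D.Bdis e i (i + 1) (by omega) (by omega)) (last_mem (D.B_lt e i (by omega)))
    (h ▸ head_mem (D.B_hd e (i + 1) (by omega)))

lemma L_spec (e : E) : Simple (D.L e) ∧ (D.L e).head? = some (D.pos (D.s e)) ∧
    (D.L e).getLast? = some (D.pos (D.t e)) ∧
    (∀ x y, SegIn (D.L e) x y → (∃ i ≤ D.k e + 1, SegIn (D.B e i) x y) ∨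
      ∃ i ≤ D.k e, x = D.lt e i ∧ y = D.hd e (i + 1)) := by
  obtain ⟨h1, h2, h3, -, h5⟩ := cat_spec (D.B e) (D.hd e) (D.lt e) (D.k e + 1) (D.B_hd e) (D.B_lt e) (D.B_simple e)
    (D.Bdis e) (D.conn_ne e) (by
      rintro i j hi hj z ⟨hz1, hz2⟩
      have hb := D.conn_ball e i (by omega) hz1
      have hS := D.ctrS e i (by omega)
      rcases D.F e j hj hz2 hS hb with ⟨h, h', h''⟩ | ⟨j', rfl, h', h''⟩
      · have := D.ctr_inj e j i h (by omega) h'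
        subst this
        exact Or.inl ⟨rfl, h''⟩
      · have := D.ctr_inj e j' i (by omega) (by omega) h'
        subst this
        exact Or.inr ⟨rfl, h''⟩)
    (by
      intro i j hij hj
      rw [Set.disjoint_left]
      intro z hz hz'
      have := D.eqS (D.ctrS e i (by omega)) (D.ctrS e j (by omega)) (D.conn_ball e i (by omega) hz)
        (D.conn_ball e j (by omega) hz')
      exact hij.ne (D.ctr_inj e i j (by omega) (by omega) this))
  refine ⟨h1, ?_, ?_, ?_⟩
  · rw [L, h2, D.hd_zero]
  · rw [L, h3, D.lt_last]
  · intro x y h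
    rcases h5 x y h with h | ⟨i, hi, h⟩
    · exact Or.inl h
    · exact Or.inr ⟨i, by omega, h⟩

lemma L_len (e : E) : 2 ≤ (D.L e).length := by
  obtain ⟨-, h2, h3, -⟩ := D.L_spec e
  rcases h : D.L e with _ | ⟨x, _ | ⟨y, L⟩⟩
  · rw [h] at h2; simp at h2
  · rw [h] at h2 h3
    simp at h2 h3
    exact absurd (D.pos_inj (h2.symm.trans h3)) (D.st e)
  · simp

/-- positions in the chain -/
def pt (e : E) (i : ℕ) : ℂ := (D.L e).getD i 0

lemma loc {e : E} {x y : ℂ} (h : SegIn (D.L e) x y) :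
    (∃ i ≤ D.k e + 1, segment ℝ x y ⊆ poly (D.B e i)) ∨ ∃ i ≤ D.k e, x = D.lt e i ∧ y = D.hd e (i + 1) := by
  rcases (D.L_spec e).2.2.2 x y h with ⟨i, hi, h⟩ | h
  · exact Or.inl ⟨i, hi, segIn_sub h⟩
  · exact Or.inr h

lemma av {e : E} {x y q z : ℂ} (h : SegIn (D.L e) x y) (hz : z ∈ segment ℝ x y) (hq : q ∈ D.S)
    (hd : Dist.dist z q ≤ D.ρ) : ∃ a ≤ D.k e, D.ctr e a = q := by
  rcases D.loc h with ⟨i, hi, hs⟩ | ⟨i, hi, rfl, rfl⟩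
  · rcases D.F e i hi (hs hz) hq hd with ⟨h, h', h''⟩ | ⟨j', rfl, h', h''⟩
    · exact ⟨i, h, h'⟩
    · exact ⟨j', by omega, h'⟩
  · exact ⟨i, hi, D.eqS (D.ctrS e i hi) hq (D.conn_ball e i hi hz) hd⟩

lemma BB {e f : E} (hef : e ≠ f) {i j : ℕ} {z : ℂ} (hi : i ≤ D.k e + 1) (hj : j ≤ D.k f + 1)
    (hz : z ∈ poly (D.B e i)) (hz' : z ∈ poly (D.B f j)) : ∃ v, z = D.pos v := by
  rcases D.mid_or e i hi hz with h | h
  · exact h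
  rcases D.mid_or f j hj hz' with h' | h'
  · exact h'
  exact absurd hz' (Set.disjoint_left.1 (D.dis e f i j h.1 h.2 h'.1 h'.2 (Or.inl hef)) hz)

lemma BC {e f : E} (hef : e ≠ f) {i j : ℕ} {z : ℂ} (hi : i ≤ D.k e) (hj : j ≤ D.k f + 1)
    (hz : z ∈ segment ℝ (D.lt e i) (D.hd e (i + 1))) (hz' : z ∈ poly (D.B f j)) : ∃ v, z = D.pos v := by
  rcases D.mid_or f j hj hz' with h' | h'
  · exact h'
  have hb := D.conn_ball e i hi hz
  have := (D.far f j h'.1 h'.2 z hz' _ (D.ctrS e i hi)).1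
  rcases sphere_end (D.lt_ball e i hi) (D.hd_ball e i hi) hz this with h | h
  · exact D.BB hef (i := i) (by omega) hj (h ▸ last_mem (D.B_lt e i (by omega))) hz'
  · exact D.BB hef (i := i + 1) (by omega) hj (h ▸ head_mem (D.B_hd e (i + 1) (by omega))) hz'

/-- a connector at a vertex is a spoke -/
lemma spoke_at {e : E} {i : ℕ} {v : V} (hi : i ≤ D.k e) (h : D.ctr e i = D.P v) :
    ∃ w j, 0 < j ∧ j ≤ D.k e ∧ w ∈ poly (D.B e j) ∧ Dist.dist w (D.P v) = D.ρ ∧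
      segment ℝ (D.lt e i) (D.hd e (i + 1)) = segment ℝ (D.pos v) w := by
  rcases D.ctrP e i v hi h with rfl | rfl
  · rw [← D.ctr_zero] at h
    have := D.ctr_inj e i 0 hi (by omega) h
    subst this
    refine ⟨D.hd e 1, 1, by omega, D.kpos e, head_mem (D.B_hd e 1 (by omega)), ?_, ?_⟩
    · rw [← D.ctr_zero]; exact D.hd_sph e 0 (D.kpos e)
    · rw [D.lt_zero]
  · rw [← D.ctr_k] at h
    have := D.ctr_inj e i _ hi le_rfl h
    subst this
    refine ⟨D.lt e (D.k e), D.k e, D.kpos e, le_rfl, last_mem (D.B_lt e _ (by omega)), ?_, ?_⟩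
    · rw [← D.ctr_k]; exact D.lt_sph e _ (D.kpos e) le_rfl
    · rw [D.hd_last, segment_symm]

lemma CL {e f : E} (hef : e ≠ f) {x y x' y' z : ℂ} (h : SegIn (D.L e) x y) (h' : SegIn (D.L f) x' y')
    (hz : z ∈ segment ℝ x y) (hz' : z ∈ segment ℝ x' y') : (∃ v, z = D.pos v) ∨
    ∃ a b, a ≤ D.k e ∧ b ≤ D.k f ∧ D.ctr e a = D.ctr f b ∧ (∀ v, D.ctr e a ≠ D.P v) ∧
      x = D.lt e a ∧ y = D.hd e (a + 1) ∧ x' = D.lt f b ∧ y' = D.hd f (b + 1) := by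
  rcases D.loc h with ⟨i, hi, hs⟩ | ⟨i, hi, rfl, rfl⟩ <;> rcases D.loc h' with ⟨j, hj, hs'⟩ | ⟨j, hj, rfl, rfl⟩
  · exact Or.inl (D.BB hef hi hj (hs hz) (hs' hz'))
  · exact Or.inl (D.BC hef.symm hj hi hz' (hs hz))
  · exact Or.inl (D.BC hef hi hj hz (hs' hz'))
  · have hc : D.ctr e i = D.ctr f j :=
      D.eqS (D.ctrS e i hi) (D.ctrS f j hj) (D.conn_ball e i hi hz) (D.conn_ball f j hj hz')
    by_cases hv : ∃ v, D.ctr e i = D.P v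
    · left
      obtain ⟨v, hv⟩ := hv
      obtain ⟨w, a, ha, ha', hw, hwd, hws⟩ := D.spoke_at hi hv
      obtain ⟨w', b, hb, hb', hw', hwd', hws'⟩ := D.spoke_at hj (hc ▸ hv)
      rw [hws] at hz; rw [hws'] at hz'
      refine ⟨v, spokes (D.near v) hwd hwd' ?_ hz hz'⟩
      rintro rfl
      exact Set.disjoint_left.1 (D.dis e f a b ha ha' hb hb' (Or.inl hef)) hw hw'
    · push Not at hv
      exact Or.inr ⟨i, j, hi, hj, hc, hv, rfl, rfl, rfl, rfl⟩

lemma chord_ends {e : E} {a : ℕ} (ha : a ≤ D.k e) (hv : ∀ v, D.ctr e a ≠ D.P v) : 0 < a ∧ a < D.k e := by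
  constructor
  · rcases Nat.eq_zero_or_pos a with rfl | h
    · exact absurd (D.ctr_zero e) (hv _)
    · exact h
  · rcases ha.eq_or_lt with rfl | h
    · exact absurd (D.ctr_k e) (hv _)
    · exact h

lemma transv {e f : E} (hef : e ≠ f) {a b : ℕ} {z : ℂ} (ha : a ≤ D.k e) (hb : b ≤ D.k f)
    (hc : D.ctr e a = D.ctr f b) (hv : ∀ v, D.ctr e a ≠ D.P v)
    (hz : z ∈ segment ℝ (D.lt e a) (D.hd e (a + 1))) (hz' : z ∈ segment ℝ (D.lt f b) (D.hd f (b + 1))) :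
    dt (D.hd e (a + 1) - D.lt e a) (D.hd f (b + 1) - D.lt f b) ≠ 0 := by
  obtain ⟨a0, a1⟩ := D.chord_ends ha hv
  obtain ⟨b0, b1⟩ := D.chord_ends hb (hc ▸ hv)
  have m1 := last_mem (D.B_lt e a (by omega))
  have m2 := head_mem (D.B_hd e (a + 1) (by omega))
  have m3 := last_mem (D.B_lt f b (by omega))
  refine chords (p := D.ctr e a) (ρ := D.ρ) (z := z) (D.lt_sph e a a0 ha) (D.hd_sph e a a1) ?_ (D.conn_ne e a (by omega)) ?_ ?_
    (D.conn_ne f b (by omega)) hz hz' ?_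
  · rw [hc]; exact D.lt_sph f b b0 hb
  · intro h
    exact Set.disjoint_left.1 (D.dis e f a b a0 ha b0 hb (Or.inl hef)) m1 (h ▸ m3)
  · intro h
    exact Set.disjoint_left.1 (D.dis e f (a + 1) b (by omega) a1 b0 hb (Or.inl hef)) m2 (h ▸ m3)
  · rw [hc]; exact D.hd_sph f b b1

lemma idx_unique (e : E) {i i' : ℕ} (hi : i + 1 < (D.L e).length) (hi' : i' + 1 < (D.L e).length)
    (h : D.pt e i = D.pt e i') (h2 : D.pt e (i + 1) = D.pt e (i' + 1)) : i = i' := by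
  have key : ∀ i i', i' + 1 < (D.L e).length → i < i' → D.pt e i = D.pt e i' → D.pt e (i + 1) = D.pt e (i' + 1) →
      False := by
    intro i i' hi' hlt h h2
    have hs := (D.L_spec e).1
    rcases Nat.lt_or_ge (i + 1) i' with h3 | h3
    · have := simple_sep hs h3 hi'
      refine Set.disjoint_left.1 this (left_mem_segment _ _ _) ?_
      change D.pt e i ∈ segment ℝ (D.pt e i') _
      rw [h]; exact left_mem_segment _ _ _
    · obtain rfl : i' = i + 1 := by omega
      exact simple_ne hs (getD_segIn (i := i) (by omega)) h
  rcases lt_trichotomy i i' with h3 | h3 | h3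
  · exact (key i i' hi' h3 h h2).elim
  · exact h3
  · exact (key i' i hi h3 h.symm h2.symm).elim

theorem toPD : ∃ D' : PD V E, D'.pos = D.pos ∧ D'.s = D.s ∧ D'.t = D.t ∧ (∀ e, D'.ch e = D.pt e) ∧
    ∀ e f, (D.s e ≠ D.s f ∧ D.s e ≠ D.t f ∧ D.t e ≠ D.s f ∧ D.t e ≠ D.t f) → (D'.K e ∩ D'.K f).Nonempty →
      ∃ a b, a ≤ D.k e ∧ b ≤ D.k f ∧ D.ctr e a = D.ctr f b := by
  have hseg : ∀ e i, i < (D.L e).length - 1 → SegIn (D.L e) (D.pt e i) (D.pt e (i + 1)) := fun e i hi =>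
    getD_segIn (by omega)
  have havoid : ∀ e v i, i < (D.L e).length - 1 → D.pos v ∈ segment ℝ (D.pt e i) (D.pt e (i + 1)) →
      v = D.s e ∨ v = D.t e := by
    intro e v i hi hm
    obtain ⟨a, ha, h⟩ := D.av (hseg e i hi) hm (D.PS v) (D.near v).le
    exact D.ctrP e a v ha h
  let D' : PD V E :=
    { pos := D.pos
      s := D.s
      t := D.t
      N := fun e => (D.L e).length - 1
      ch := D.pt
      pos_inj := D.pos_inj
      st := D.st
      Npos := fun e => by have := D.L_len e; omega
      ch_zero := by
        intro e
        obtain ⟨-, h2, h3, -⟩ := D.L_spec e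
        unfold pt
        rw [List.getD_eq_getElem?_getD, ← List.head?_eq_getElem?, h2]; rfl
      ch_N := by
        intro e
        obtain ⟨-, h2, h3, -⟩ := D.L_spec e
        unfold pt
        rw [List.getD_eq_getElem?_getD, ← List.getLast?_eq_getElem?, h3]; rfl
      sep := fun e i j hij hj => simple_sep (D.L_spec e).1 hij (by omega)
      adj := fun e i hi => simple_adj (D.L_spec e).1 (by omega)
      ne := fun e i hi => simple_ne (D.L_spec e).1 (hseg e i hi)
      avoid := havoid
      pair := by
        intro e f hef i j z hi hj hz hz'
        rcases D.CL hef (hseg e i hi) (hseg f j hj) hz hz' with h | ⟨a, b, ha, hb, hc, hv, e1, e2, e3, e4⟩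
        · exact Or.inl h
        right
        have hna := D.nonadj e f a b hef ha hb hc hv
        refine ⟨?_, hna, ?_⟩
        · rw [e1, e2] at hz ⊢; rw [e3, e4] at hz' ⊢
          exact D.transv hef ha hb hc hv hz hz'
        · rintro i' j' hi' hj' ⟨w, hw, hw'⟩
          rcases D.CL hef (hseg e i' hi') (hseg f j' hj') hw hw' with ⟨v, rfl⟩ | ⟨a', b', ha', hb', hc', hv', e1', e2', e3', e4'⟩
          · have k1 := havoid e v i' hi' hw
            have k2 := havoid f v j' hj' hw'
            grind
          · have ea : a = a' := D.once e f a b a' b' hef ha ha' hb hb' hc hc' hv hv'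
            subst ea
            have eb : b = b' := D.ctr_inj f b b' hb hb' (hc.symm.trans hc')
            subst eb
            exact ⟨D.idx_unique e (by omega) (by omega) (e1'.trans e1.symm) (e2'.trans e2.symm),
              D.idx_unique f (by omega) (by omega) (e3'.trans e3.symm) (e4'.trans e4.symm)⟩
      triple := by
        intro e f g hef heg hfg i j k z hi hj hk hz hz' hz''
        rcases D.CL hef (hseg e i hi) (hseg f j hj) hz hz' with h | ⟨a, b, ha, hb, hc, hv, e1, e2, e3, e4⟩
        · exact h
        rcases D.CL hfg (hseg f j hj) (hseg g k hk) hz' hz'' with h | ⟨b', c, hb', hc1, hc', hv', e1', e2', e3', e4'⟩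
        · exact h
        exfalso
        have k1 := hz'
        rw [e3, e4] at k1
        have k2 := hz'
        rw [e1', e2'] at k2
        have := D.eqS (D.ctrS f b hb) (D.ctrS f b' hb') (D.conn_ball f b hb k1) (D.conn_ball f b' hb' k2)
        rw [← this] at hc'
        obtain ⟨v, hv2⟩ := D.no3 e f g a b c hef heg hfg ha hb hc1 hc hc'
        exact hv v hv2 }
  refine ⟨D', rfl, rfl, rfl, fun e => rfl, ?_⟩
  rintro e f hna ⟨z, ⟨i, hi, hz⟩, ⟨j, hj, hz'⟩⟩
  have hef : e ≠ f := by rintro rfl; exact hna.1 rfl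
  rcases D.CL hef (hseg e i hi) (hseg f j hj) hz hz' with ⟨v, rfl⟩ | ⟨a, b, ha, hb, hc, -⟩
  · have k1 := havoid e v i hi hz
    have k2 := havoid f v j hj hz'
    grind
  · exact ⟨a, b, ha, hb, hc⟩

lemma cat_shift (A : ℕ → List ℂ) (k : ℕ) : cat A (k + 1) = A 0 ++ cat (fun i => A (i + 1)) k := by
  induction k with
  | zero => rfl
  | succ k ih =>
    rw [cat, ih, List.append_assoc]; rfl

lemma cat_head (A : ℕ → List ℂ) (k : ℕ) {x : ℂ} (h : (A 0).head? = some x) : (cat A k).head? = some x := by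
  induction k with
  | zero => exact h
  | succ k ih => simp [cat, ih]

lemma pt_one (e : E) : D.pt e 1 = D.hd e 1 := by
  unfold pt L
  rw [cat_shift, D.B_zero]
  have h : (cat (fun i => D.B e (i + 1)) (D.k e)).head? = some (D.hd e 1) :=
    cat_head _ _ (D.B_hd e 1 (by omega))
  simp only [List.cons_append, List.nil_append, List.getD_cons_succ]
  rw [List.getD_eq_getElem?_getD, ← List.head?_eq_getElem?, h]; rfl

end CD
end CrAux

namespace CrAux

/-! ## From curves to polygonal drawings -/

lemma partition (T : Set ℝ) (hT : T.Finite) (hsub : T ⊆ Set.Icc 0 1) (h0 : (0:ℝ) ∈ T) (h1 : (1:ℝ) ∈ T) :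
    ∃ (k : ℕ) (τ : ℕ → ℝ), 0 < k ∧ τ 0 = 0 ∧ τ k = 1 ∧ (∀ i j, i < j → j ≤ k → τ i < τ j) ∧ (∀ i ≤ k, τ i ∈ T) ∧
      ∀ i < k, ∀ x ∈ Set.Ioo (τ i) (τ (i + 1)), x ∉ T := by
  classical
  lift T to Finset ℝ using hT
  have hc : 1 < T.card := Finset.one_lt_card.2 ⟨0, by simpa using h0, 1, by simpa using h1, by norm_num⟩
  obtain ⟨k, hk⟩ : ∃ k, T.card = k + 1 := ⟨T.card - 1, by omega⟩
  let em := T.orderEmbOfFin hk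
  have hmem : ∀ i, em i ∈ T := T.orderEmbOfFin_mem hk
  have hsurj : ∀ x ∈ T, ∃ i, em i = x := by
    intro x hx
    have : x ∈ Set.range em := by rw [T.range_orderEmbOfFin hk]; exact hx
    exact this
  refine ⟨k, fun i => if h : i < k + 1 then em ⟨i, h⟩ else 0, by omega, ?_, ?_, ?_, ?_, ?_⟩
  · simp only [Nat.zero_lt_succ, dif_pos]
    obtain ⟨i, hi⟩ := hsurj 0 (by simpa using h0)
    apply le_antisymm
    · rw [← hi]; exact em.monotone (Nat.zero_le _)
    · exact (hsub (by simpa using hmem _)).1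
  · simp only [Nat.lt_succ_self, dif_pos]
    obtain ⟨i, hi⟩ := hsurj 1 (by simpa using h1)
    apply le_antisymm
    · exact (hsub (by simpa using hmem _)).2
    · rw [← hi]; exact em.monotone (Nat.le_of_lt_succ i.2)
  · intro i j hij hj
    simp only [show i < k + 1 by omega, show j < k + 1 by omega, dif_pos]
    exact em.strictMono hij
  · intro i hi
    simp only [show i < k + 1 by omega, dif_pos]
    simpa using hmem _
  · intro i hi x hx hxT
    simp only [show i < k + 1 by omega, show i + 1 < k + 1 by omega, dif_pos] at hx
    obtain ⟨j, rfl⟩ := hsurj x (by simpa using hxT)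
    have a := em.lt_iff_lt.1 hx.1
    have b := em.lt_iff_lt.1 hx.2
    have a' : i < j.1 := a
    have b' : j.1 < i + 1 := b
    omega

theorem curves {V E : Type} [Finite V] [Finite E] (P : V → ℂ) (hP : Function.Injective P) (s t : E → V)
    (st : ∀ e, s e ≠ t e) (γ : E → ℝ → ℂ) (hcont : ∀ e, ContinuousOn (γ e) (Set.Icc 0 1))
    (hinj : ∀ e, Set.InjOn (γ e) (Set.Icc 0 1)) (h0 : ∀ e, γ e 0 = P (s e)) (h1 : ∀ e, γ e 1 = P (t e))
    (hav : ∀ e v, ∀ τ ∈ Set.Icc (0:ℝ) 1, γ e τ = P v → v = s e ∨ v = t e)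
    (X1 : ∀ e f, e ≠ f → ∀ τ ∈ Set.Icc (0:ℝ) 1, ∀ τ' ∈ Set.Icc (0:ℝ) 1, ∀ σ ∈ Set.Icc (0:ℝ) 1, ∀ σ' ∈ Set.Icc (0:ℝ) 1,
      γ e τ = γ f σ → γ e τ' = γ f σ' → (∀ v, γ e τ ≠ P v) → (∀ v, γ e τ' ≠ P v) → γ e τ = γ e τ')
    (X2 : ∀ e f, e ≠ f → ∀ τ ∈ Set.Icc (0:ℝ) 1, ∀ σ ∈ Set.Icc (0:ℝ) 1, γ e τ = γ f σ → (∀ v, γ e τ ≠ P v) →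
      (s e ≠ s f ∧ s e ≠ t f ∧ t e ≠ s f ∧ t e ≠ t f))
    (X3 : ∀ e f g, e ≠ f → e ≠ g → f ≠ g → ∀ τ ∈ Set.Icc (0:ℝ) 1, ∀ σ ∈ Set.Icc (0:ℝ) 1, ∀ υ ∈ Set.Icc (0:ℝ) 1,
      γ e τ = γ f σ → γ f σ = γ g υ → ∃ v, γ e τ = P v) :
    ∃ ρ > 0, ∃ z0 : E → ℂ, Function.Injective z0 ∧ (∀ e, Dist.dist (z0 e) (P (s e)) = ρ) ∧
      ∀ pos' : V → ℂ, (∀ v, Dist.dist (pos' v) (P v) < ρ) → ∃ D' : PD V E, D'.pos = pos' ∧ D'.s = s ∧ D'.t = t ∧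
        (∀ e, D'.ch e 1 = z0 e) ∧
        ∀ e f, (s e ≠ s f ∧ s e ≠ t f ∧ t e ≠ s f ∧ t e ≠ t f) → (D'.K e ∩ D'.K f).Nonempty →
          ∃ τ ∈ Set.Icc (0:ℝ) 1, ∃ σ ∈ Set.Icc (0:ℝ) 1, γ e τ = γ f σ := by
  classical
  let C : E → E → Set ℂ := fun e f => {z | e ≠ f ∧ (∀ v, z ≠ P v) ∧ ∃ τ ∈ Set.Icc (0:ℝ) 1, ∃ σ ∈ Set.Icc (0:ℝ) 1,
    z = γ e τ ∧ z = γ f σ}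
  let S : Set ℂ := Set.range P ∪ ⋃ e, ⋃ f, C e f
  have hS : S.Finite := by
    refine (Set.finite_range P).union (Set.finite_iUnion fun e => Set.finite_iUnion fun f => Set.Subsingleton.finite ?_)
    rintro z ⟨hef, hv, τ, hτ, σ, hσ, rfl, e2⟩ z' ⟨-, hv', τ', hτ', σ', hσ', rfl, e2'⟩
    exact X1 e f hef τ hτ τ' hτ' σ hσ σ' hσ' e2 e2' hv hv'
  have hPS : ∀ v, P v ∈ S := fun v => Or.inl ⟨v, rfl⟩
  have hCS : ∀ e f, e ≠ f → ∀ τ ∈ Set.Icc (0:ℝ) 1, ∀ σ ∈ Set.Icc (0:ℝ) 1, γ e τ = γ f σ → γ e τ ∈ S := by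
    intro e f hef τ hτ σ hσ h
    by_cases hv : ∃ v, γ e τ = P v
    · obtain ⟨v, hv⟩ := hv
      rw [hv]; exact hPS v
    · push Not at hv
      exact Or.inr (Set.mem_iUnion.2 ⟨e, Set.mem_iUnion.2 ⟨f, hef, hv, τ, hτ, σ, hσ, rfl, h⟩⟩)
  have hpart := fun e => partition (Set.Icc 0 1 ∩ γ e ⁻¹' S)
    (by
      apply Set.Finite.of_finite_image (f := γ e) (hS.subset ?_) ((hinj e).mono Set.inter_subset_left)
      rintro _ ⟨x, hx, rfl⟩; exact hx.2)
    Set.inter_subset_left ⟨⟨le_rfl, zero_le_one⟩, by rw [Set.mem_preimage, h0]; exact hPS _⟩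
    ⟨⟨zero_le_one, le_rfl⟩, by rw [Set.mem_preimage, h1]; exact hPS _⟩
  choose k τ kpos τ0 τ1 τmono τmem τno using hpart
  have hI : ∀ e i, i ≤ k e → τ e i ∈ Set.Icc (0:ℝ) 1 := fun e i hi => (τmem e i hi).1
  have hsubI : ∀ e i, i < k e → Set.Icc (τ e i) (τ e (i + 1)) ⊆ Set.Icc 0 1 := fun e i hi =>
    Set.Icc_subset_Icc (hI e i hi.le).1 (hI e (i + 1) hi).2
  have hinjτ : ∀ e a b, a ≤ k e → b ≤ k e → γ e (τ e a) = γ e (τ e b) → a = b := by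
    intro e a b ha hb h
    have := hinj e (hI e a ha) (hI e b hb) h
    rcases lt_trichotomy a b with h' | h' | h'
    · exact absurd this (τmono e a b h' hb).ne
    · exact h'
    · exact absurd this (τmono e b a h' ha).ne'
  obtain ⟨ρ, hρ, hsep, A, hd, lt, hA, hAd⟩ := polygonalize (I := Σ e, Fin (k e)) S hS (fun i => γ i.1)
    (fun i => τ i.1 i.2) (fun i => τ i.1 (i.2 + 1)) (fun i => τmono _ _ _ (Nat.lt_succ_self _) i.2.2)
    (fun i => (hcont i.1).mono (hsubI i.1 i.2 i.2.2))
    (fun i => (τmem i.1 i.2 i.2.2.le).2) (fun i => (τmem i.1 _ i.2.2).2)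
    (fun i h => by have := hinjτ i.1 _ _ i.2.2.le i.2.2 h; omega)
    (fun i x hx hxS => τno i.1 i.2 i.2.2 x hx ⟨hsubI i.1 i.2 i.2.2 (Set.Ioo_subset_Icc_self hx), hxS⟩)
    (by
      rintro ⟨e, i⟩ ⟨f, j⟩ hne x hx y hy h
      simp only at hx hy h
      have hx' := hsubI e i i.2 (Set.Ioo_subset_Icc_self hx)
      have hy' := hsubI f j j.2 (Set.Ioo_subset_Icc_self hy)
      by_cases hef : e = f
      · subst hef
        have := hinj e hx' hy' h
        subst this
        apply hne
        have : i = j := by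
          apply Fin.ext
          rcases lt_trichotomy i.1 j.1 with h' | h' | h'
          · exfalso
            have : τ e (i + 1) ≤ τ e j := by
              rcases (Nat.succ_le_of_lt h').eq_or_lt with h | h
              · rw [← h]
              · exact (τmono e _ _ h j.2.le).le
            linarith [hx.2, hy.1]
          · exact h'
          · exfalso
            have : τ e (j + 1) ≤ τ e i := by
              rcases (Nat.succ_le_of_lt h').eq_or_lt with h | h
              · rw [← h]
              · exact (τmono e _ _ h i.2.le).le
            linarith [hy.2, hx.1]
        rw [this]
      · exact τno e i i.2 x hx ⟨hx', hCS e f hef x hx' y hy' h⟩)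
  -- reindex
  let A' : E → ℕ → List ℂ := fun e i => if h : i < k e then A ⟨e, ⟨i, h⟩⟩ else []
  let hd' : E → ℕ → ℂ := fun e i => if h : i < k e then hd ⟨e, ⟨i, h⟩⟩ else 0
  let lt' : E → ℕ → ℂ := fun e i => if h : i < k e then lt ⟨e, ⟨i, h⟩⟩ else 0
  have hA' : ∀ e i, i < k e → Simple (A' e i) ∧ (A' e i).head? = some (hd' e i) ∧
      (A' e i).getLast? = some (lt' e i) ∧ Dist.dist (hd' e i) (γ e (τ e i)) = ρ ∧ Dist.dist (lt' e i) (γ e (τ e (i + 1))) = ρ ∧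
      (∀ z ∈ poly (A' e i), ∀ q ∈ S, ρ ≤ Dist.dist z q ∧
        (Dist.dist z q = ρ → (γ e (τ e i) = q ∧ z = hd' e i) ∨ (γ e (τ e (i + 1)) = q ∧ z = lt' e i))) := by
    intro e i h
    have := hA ⟨e, ⟨i, h⟩⟩
    simp only [A', hd', lt', h, dif_pos]
    exact this
  have hAd' : ∀ e f i j, i < k e → j < k f → (e ≠ f ∨ i ≠ j) → Disjoint (poly (A' e i)) (poly (A' f j)) := by
    intro e f i j hi hj h
    simp only [A', hi, hj, dif_pos]
    apply hAd
    intro h'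
    have h1 : e = f := congrArg Sigma.fst h'
    subst h1
    have h2 := eq_of_heq (Sigma.mk.inj h').2
    have h3 : i = j := congrArg Fin.val h2
    rcases h with h | h
    · exact h rfl
    · exact h h3
  clear_value A' hd' lt'
  have key : ∀ pos' : V → ℂ, (∀ v, Dist.dist (pos' v) (P v) < ρ) → ∃ D : CD V E, D.P = P ∧ D.pos = pos' ∧ D.s = s ∧ D.t = t ∧
      D.k = k ∧ (D.ctr = fun e a => γ e (τ e a)) ∧ (∀ e, D.hd e 1 = hd' e 0) := by
    intro pos' hpos
    let D : CD V E :=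
      { P := P, pos := pos', S := S, s := s, t := t, k := k, ctr := fun e a => γ e (τ e a),
        B := fun e i => if i = 0 then [pos' (s e)] else if i ≤ k e then A' e (i - 1) else [pos' (t e)]
        hd := fun e i => if i = 0 then pos' (s e) else if i ≤ k e then hd' e (i - 1) else pos' (t e)
        lt := fun e i => if i = 0 then pos' (s e) else if i ≤ k e then lt' e (i - 1) else pos' (t e)
        ρ := ρ, ρpos := hρ, sepS := hsep, PS := hPS, P_inj := hP, near := hpos, st := st, kpos := kpos
        ctrS := fun e a ha => (τmem e a ha).2
        ctr_inj := hinjτ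
        ctr_zero := fun e => by rw [τ0, h0]
        ctr_k := fun e => by rw [τ1, h1]
        ctrP := fun e a v ha h => hav e v _ (hI e a ha) h
        once := by
          intro e f a b a' b' hef ha ha' hb hb' h h' hv hv'
          exact hinjτ e a a' ha ha' (X1 e f hef _ (hI e a ha) _ (hI e a' ha') _ (hI f b hb) _ (hI f b' hb') h h' hv hv')
        nonadj := fun e f a b hef ha hb h hv => X2 e f hef _ (hI e a ha) _ (hI f b hb) h hv
        no3 := fun e f g a b c hef heg hfg ha hb hc h h' => X3 e f g hef heg hfg _ (hI e a ha) _ (hI f b hb) _ (hI g c hc) h h'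
        B_zero := fun e => by simp
        B_last := fun e => by simp
        B_hd := by
          intro e i hi
          rcases Nat.eq_zero_or_pos i with rfl | h
          · simp
          by_cases h' : i ≤ k e
          · simp only [h.ne', h', if_true, if_false]
            exact (hA' e (i - 1) (by omega)).2.1
          · simp [h.ne', h']
        B_lt := by
          intro e i hi
          rcases Nat.eq_zero_or_pos i with rfl | h
          · simp
          by_cases h' : i ≤ k e
          · simp only [h.ne', h', if_true, if_false]
            exact (hA' e (i - 1) (by omega)).2.2.1
          · simp [h.ne', h']
        B_simple := by
          intro e i hi
          rcases Nat.eq_zero_or_pos i with rfl | h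
          · simp [Simple]
          by_cases h' : i ≤ k e
          · simp only [h.ne', h', if_true, if_false]
            exact (hA' e (i - 1) (by omega)).1
          · simp [h.ne', h', Simple]
        far := by
          intro e i hi hi' z hz q hq
          obtain ⟨i, rfl⟩ : ∃ j, i = j + 1 := ⟨i - 1, by omega⟩
          simp only [Nat.succ_ne_zero, hi', if_true, if_false, Nat.add_sub_cancel] at hz ⊢
          obtain ⟨k1, k2⟩ := (hA' e i (by omega)).2.2.2.2.2 z hz q hq
          refine ⟨k1, fun h => ?_⟩
          rcases k2 h with h | h
          · exact Or.inr ⟨i, rfl, h⟩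
          · exact Or.inl h
        lt_sph := by
          intro e i hi hi'
          obtain ⟨i, rfl⟩ : ∃ j, i = j + 1 := ⟨i - 1, by omega⟩
          simp only [Nat.succ_ne_zero, hi', if_true, if_false, Nat.add_sub_cancel]
          exact (hA' e i (by omega)).2.2.2.2.1
        hd_sph := by
          intro e i hi
          simp only [Nat.succ_ne_zero, Nat.succ_le_of_lt hi, if_true, if_false, Nat.add_sub_cancel]
          exact (hA' e i (by omega)).2.2.2.1
        dis := by
          intro e f i j hi hi' hj hj' h
          obtain ⟨i, rfl⟩ : ∃ j, i = j + 1 := ⟨i - 1, by omega⟩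
          obtain ⟨j, rfl⟩ : ∃ i, j = i + 1 := ⟨j - 1, by omega⟩
          simp only [Nat.succ_ne_zero, hi', hj', if_true, if_false, Nat.add_sub_cancel]
          exact hAd' e f i j (by omega) (by omega) (h.imp id (by omega)) }
    refine ⟨D, rfl, rfl, rfl, rfl, rfl, rfl, fun e => ?_⟩
    simp [D, show 1 ≤ k e from kpos e]
  refine ⟨ρ, hρ, fun e => hd' e 0, ?_, ?_, ?_⟩
  · intro e f h
    by_contra hef
    refine Set.disjoint_left.1 (hAd' e f 0 0 (kpos e) (kpos f) (Or.inl hef)) (head_mem (hA' e 0 (kpos e)).2.1) ?_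
    simp only at h
    rw [h]; exact head_mem (hA' f 0 (kpos f)).2.1
  · intro e
    have := (hA' e 0 (kpos e)).2.2.2.1
    rwa [τ0, h0] at this
  · intro pos' hpos
    obtain ⟨D, e1, e2, e3, e4, e5, e6, e7⟩ := key pos' hpos
    obtain ⟨D', g1, g2, g3, g4, g5⟩ := D.toPD
    refine ⟨D', g1.trans e2, g2.trans e3, g3.trans e4, fun e => ?_, ?_⟩
    · rw [g4, D.pt_one, e7]
    · intro e f hna hne
      obtain ⟨a, b, ha, hb, h⟩ := g5 e f (by rw [e3, e4]; exact hna) hne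
      rw [e5] at ha hb
      rw [e6] at h
      exact ⟨_, hI e a ha, _, hI f b hb, h⟩

end CrAux

/-! ## From good drawings to polygonal drawings with a balanced star -/
namespace CrAux

/-- An orientation of the edges in which no edge points to `a`. -/
lemma orient {V : Type} (G : SimpleGraph V) (a : V) : ∃ s t : G.edgeSet → V,
    (∀ e, s(s e, t e) = e.1) ∧ ∀ e, t e ≠ a := by
  have : ∀ e : G.edgeSet, ∃ p : V × V, s(p.1, p.2) = e.1 ∧ p.2 ≠ a := by
    rintro ⟨e, he⟩
    induction e using Sym2.ind with
    | _ x y =>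
      have hxy : x ≠ y := G.ne_of_adj he
      by_cases h : y = a
      · exact ⟨(y, x), Sym2.eq_swap, fun h' => hxy (h'.trans h.symm)⟩
      · exact ⟨(x, y), rfl, h⟩
  choose p hp using this
  exact ⟨fun e => (p e).1, fun e => (p e).2, fun e => (hp e).1, fun e => (hp e).2⟩

lemma arc_crossing {V : Type} {G : SimpleGraph V} (D : Drawing G) {e f : Sym2 V} {a b c d : V}
    (he : s(a, b) = e) (hf : s(c, d) = f) (hab : G.Adj a b) (hcd : G.Adj c d) (hef : e ≠ f)
    {τ σ : ℝ} (hτ : τ ∈ Set.Icc (0 : ℝ) 1) (hσ : σ ∈ Set.Icc (0 : ℝ) 1)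
    (h : D.arc a b τ = D.arc c d σ) (hv : ∀ v, D.arc a b τ ≠ D.pos v) :
    D.IsCrossing e f (D.arc a b τ) := by
  subst he; subst hf
  refine ⟨hab, hcd, hef, ⟨a, b, rfl, hab, τ, hτ, rfl⟩, ⟨c, d, rfl, hcd, σ, hσ, h.symm⟩, ?_, ?_⟩
  · rintro ⟨v, -, h⟩; exact hv v h
  · rintro ⟨v, -, h⟩; exact hv v h

/-- `curves` applied to a good drawing. -/
theorem drawCurves {V : Type} [Finite V] {G : SimpleGraph V} (D : Drawing G) (hD : D.IsGood)
    (s t : G.edgeSet → V) (hst : ∀ e, s(s e, t e) = e.1) :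
    ∃ P : V → ℂ, ∃ ρ > 0, ∃ z0 : G.edgeSet → ℂ, Function.Injective z0 ∧
      (∀ e, Dist.dist (z0 e) (P (s e)) = ρ) ∧ ∀ pos' : V → ℂ, (∀ v, Dist.dist (pos' v) (P v) < ρ) →
      ∃ D' : PD V G.edgeSet, D'.pos = pos' ∧ D'.s = s ∧ D'.t = t ∧ (∀ e, D'.ch e 1 = z0 e) ∧
        ∀ e f : G.edgeSet, (s e ≠ s f ∧ s e ≠ t f ∧ t e ≠ s f ∧ t e ≠ t f) →
          (D'.K e ∩ D'.K f).Nonempty → ∃ p, D.IsCrossing e.1 f.1 p := by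
  have hadj : ∀ e, G.Adj (s e) (t e) := fun e => by
    have := e.2; rw [← hst e] at this; exact this
  let φ := Complex.equivRealProdCLM.symm
  have hφ : Function.Injective φ := φ.injective
  have hX : ∀ e f : G.edgeSet, e ≠ f → ∀ τ ∈ Set.Icc (0 : ℝ) 1, ∀ σ ∈ Set.Icc (0 : ℝ) 1,
      φ (D.arc (s e) (t e) τ) = φ (D.arc (s f) (t f) σ) →
      (∀ v, φ (D.arc (s e) (t e) τ) ≠ φ (D.pos v)) →
      D.IsCrossing e.1 f.1 (D.arc (s e) (t e) τ) := by
    intro e f hef τ hτ σ hσ h hv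
    exact arc_crossing D (hst e) (hst f) (hadj e) (hadj f) (fun h => hef (Subtype.ext h)) hτ hσ
      (hφ h) (fun v h => hv v (by rw [h]))
  have hav : ∀ (e : G.edgeSet) (v : V), ∀ τ ∈ Set.Icc (0 : ℝ) 1,
      φ (D.arc (s e) (t e) τ) = φ (D.pos v) → v = s e ∨ v = t e := by
    intro e v τ hτ h
    by_contra hc
    push Not at hc
    exact D.arc_avoid (hadj e) v hc.1 hc.2 ⟨τ, hτ, hφ h⟩
  obtain ⟨ρ, hρ, z0, hz, hz', H⟩ := curves (fun v => φ (D.pos v)) (hφ.comp D.pos_inj) s t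
    (fun e => (hadj e).ne) (fun e τ => φ (D.arc (s e) (t e) τ))
    (fun e => φ.continuous.comp_continuousOn (D.arc_cont (hadj e)))
    (fun e => hφ.comp_injOn (hD.arc_inj (hadj e)))
    (fun e => by simp only [D.arc_zero (hadj e)]) (fun e => by simp only [D.arc_one (hadj e)])
    hav
    (by
      intro e f hef τ hτ τ' hτ' σ hσ σ' hσ' h h' hv hv'
      rw [hD.cross_once e.1 f.1 (hX e f hef τ hτ σ hσ h hv) (hX e f hef τ' hτ' σ' hσ' h' hv')])
    (by
      intro e f hef τ hτ σ hσ h hv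
      have hc := hX e f hef τ hτ σ hσ h hv
      have key : ∀ v, v ∈ e.1 → v ∈ f.1 → False := fun v h1 h2 =>
        hD.adj_no_cross _ _ ⟨v, h1, h2⟩ _ hc
      rw [← hst e, ← hst f] at key
      simp only [Sym2.mem_iff] at key
      refine ⟨fun h => ?_, fun h => ?_, fun h => ?_, fun h => ?_⟩
      · exact key (s e) (Or.inl rfl) (Or.inl h)
      · exact key (s e) (Or.inl rfl) (Or.inr h)
      · exact key (t e) (Or.inr rfl) (Or.inl h)
      · exact key (t e) (Or.inr rfl) (Or.inr h))
    (by
      intro e f g hef heg hfg τ hτ σ hσ υ hυ h h'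
      by_contra hc
      push Not at hc
      have c1 := hX e f hef τ hτ σ hσ h hc
      have c2 := hX f g hfg σ hσ υ hυ h' (fun v => by rw [← h]; exact hc v)
      have c3 := hX e g heg τ hτ υ hυ (h.trans h') hc
      rw [← hφ h] at c2
      exact hD.no_triple _ e.1 f.1 g.1 (fun h => hef (Subtype.ext h)) (fun h => heg (Subtype.ext h))
        (fun h => hfg (Subtype.ext h)) ⟨c1, c2, c3⟩)
  refine ⟨fun v => φ (D.pos v), ρ, hρ, z0, hz, hz', fun pos' hp => ?_⟩
  obtain ⟨D', h1, h2, h3, h4, h5⟩ := H pos' hp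
  refine ⟨D', h1, h2, h3, h4, fun e f hef hK => ?_⟩
  obtain ⟨τ, hτ, σ, hσ, h⟩ := h5 e f hef hK
  refine ⟨_, hX e f (by rintro rfl; exact hef.1 rfl) τ hτ σ hσ h fun v hv => ?_⟩
  have h6 := hav e v τ hτ hv
  have h7 := hav f v σ hσ (h.symm.trans hv)
  rcases h6 with rfl | rfl
  · rcases h7 with h7 | h7
    · exact hef.1 h7
    · exact hef.2.1 h7
  · rcases h7 with h7 | h7
    · exact hef.2.2.1 h7
    · exact hef.2.2.2 h7

/-- A direction separating finitely many points. -/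
lemma exists_dir {ι : Type} [Finite ι] (z : ι → ℂ) (hz : Function.Injective z) :
    ∃ u : ℂ, u ≠ 0 ∧ Function.Injective (fun i => dt u (z i)) := by
  classical
  have hfin : (Set.range (fun p : ι × ι => ((z p.1).re - (z p.2).re) / ((z p.1).im - (z p.2).im))).Finite :=
    Set.finite_range _
  obtain ⟨c, hc⟩ := hfin.infinite_compl.nonempty
  have hfin2 : (Set.range (fun p : ι × ι => ((z p.1).im - (z p.2).im) / ((z p.1).re - (z p.2).re)) ∪ {0}).Finite :=
    (Set.finite_range _).union (Set.finite_singleton _)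
  obtain ⟨c, hc⟩ := hfin2.infinite_compl.nonempty
  simp only [Set.mem_compl_iff, Set.mem_union, Set.mem_range, Prod.exists, Set.mem_singleton_iff,
    not_or, not_exists] at hc
  refine ⟨⟨1, c⟩, fun h => by simpa using congrArg Complex.re h, fun i j hij => ?_⟩
  simp only [dt] at hij
  apply hz
  by_cases h : (z i).re - (z j).re = 0
  · apply Complex.ext
    · linarith
    · have : (z i).re = (z j).re := by linarith
      rw [this] at hij; linarith
  · exfalso
    apply hc.1 i j
    rw [div_eq_iff h]; linarith

/-- A level splitting a finite set of reals in two halves. -/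
lemma exists_level (H : Finset ℝ) (k : ℕ) (hk : 0 < k) (hH : H.card = 2 * k) (B : Set ℝ) (hB : B.Finite) :
    ∃ l ∈ H, ∃ h ∈ H, ∃ c, l < c ∧ c < h ∧ c ∉ B ∧ c ∉ H ∧ (H.filter (fun x => c < x)).card = k := by
  classical
  let o := H.orderEmbOfFin hH
  have hlt : o ⟨k - 1, by omega⟩ < o ⟨k, by omega⟩ := by
    rw [o.lt_iff_lt]; exact Fin.mk_lt_mk.2 (by omega)
  obtain ⟨c, ⟨hc1, hc2⟩, hc3⟩ := (Set.Ioo_infinite hlt).sdiff (hB.union H.finite_toSet) |>.nonempty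
  simp only [Set.mem_union, not_or, Finset.mem_coe] at hc3
  refine ⟨_, H.orderEmbOfFin_mem hH _, _, H.orderEmbOfFin_mem hH _, c, hc1, hc2, hc3.1, hc3.2, ?_⟩
  have : H.filter (fun x => c < x) = (Finset.univ.filter (fun i : Fin (2 * k) => k ≤ i.1)).map o.toEmbedding := by
    ext x
    simp only [Finset.mem_filter, Finset.mem_map, Finset.mem_univ, true_and]
    constructor
    · rintro ⟨hx, hcx⟩
      have : x ∈ Set.range o := by rw [H.range_orderEmbOfFin hH]; exact hx
      obtain ⟨i, rfl⟩ := this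
      refine ⟨i, ?_, rfl⟩
      by_contra hi
      have : o i ≤ o ⟨k - 1, by omega⟩ := o.le_iff_le.2 (Fin.mk_le_mk.2 (by omega))
      linarith
    · rintro ⟨i, hi, rfl⟩
      refine ⟨H.orderEmbOfFin_mem hH _, ?_⟩
      have : o ⟨k, by omega⟩ ≤ o i := o.le_iff_le.2 (Fin.mk_le_mk.2 hi)
      exact hc2.trans_le this
  rw [this, Finset.card_map]
  have h2 : Finset.univ.filter (fun i : Fin (2 * k) => k ≤ i.1) = Finset.Ici ⟨k, by omega⟩ := by
    ext i; simp [Fin.le_def]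
  rw [h2, Fin.card_Ici]; simp; omega

theorem drawPD {V : Type} [Finite V] {G : SimpleGraph V} (D : Drawing G) (hD : D.IsGood)
    (a : V) (S : Finset V) (hS : ∀ v ∈ S, G.Adj a v) (k : ℕ) (hk : 0 < k) (hcard : S.card = 2 * k) :
    ∃ (D' : PD V G.edgeSet) (u : ℂ), u ≠ 0 ∧ (∀ e, s(D'.s e, D'.t e) = e.1) ∧ (∀ e, D'.t e ≠ a) ∧
      (∀ e, D'.s e = a → dt u (D'.ch e 1 - D'.ch e 0) ≠ 0) ∧
      {e | D'.s e = a ∧ D'.t e ∈ S ∧ 0 < dt u (D'.ch e 1 - D'.ch e 0)}.ncard = k ∧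
      {e | D'.s e = a ∧ D'.t e ∈ S ∧ dt u (D'.ch e 1 - D'.ch e 0) < 0}.ncard = k ∧
      ∀ e f, (D'.s e ≠ D'.s f ∧ D'.s e ≠ D'.t f ∧ D'.t e ≠ D'.s f ∧ D'.t e ≠ D'.t f) →
          (D'.K e ∩ D'.K f).Nonempty → ∃ p, D.IsCrossing e.1 f.1 p := by
  classical
  obtain ⟨s, t, hst, hta⟩ := orient G a
  obtain ⟨P, ρ, hρ, z0, hz, hzs, H⟩ := drawCurves D hD s t hst
  obtain ⟨u, hu, hui⟩ := exists_dir z0 hz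
  have hex : ∀ v : S, ∃ e : G.edgeSet, s e = a ∧ t e = v := by
    rintro ⟨v, hv⟩
    refine ⟨⟨s(a, v), hS v hv⟩, ?_⟩
    have := hst ⟨s(a, v), hS v hv⟩
    simp only [Sym2.eq_iff] at this
    rcases this with h | h
    · exact h
    · exact absurd h.2 (hta _)
  choose ε hε1 hε2 using hex
  have hεi : Function.Injective ε := fun v w h => Subtype.ext (by rw [← hε2, ← hε2, h])
  have hεr : ∀ e, s e = a → t e ∈ S → ∃ v, ε v = e := by
    intro e h1 h2
    refine ⟨⟨t e, h2⟩, Subtype.ext ?_⟩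
    rw [← hst, ← hst e, hε1, hε2, h1]
  let hgt : G.edgeSet → ℝ := fun e => dt u (z0 e)
  let Hs : Finset ℝ := Finset.univ.image (fun v : S => hgt (ε v))
  have hinj : Function.Injective (fun v : S => hgt (ε v)) := hui.comp hεi
  have hHs : Hs.card = 2 * k := by
    rw [Finset.card_image_of_injective _ hinj]; simp [hcard]
  obtain ⟨l, hl, h, hh, c, hlc, hch, hcB, hcH, hcount⟩ := exists_level Hs k hk hHs (Set.range hgt) (Set.finite_range _)
  obtain ⟨vl, -, rfl⟩ := Finset.mem_image.1 hl
  obtain ⟨vh, -, rfl⟩ := Finset.mem_image.1 hh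
  have hd : 0 < hgt (ε vh) - hgt (ε vl) := by linarith
  let θ := (c - hgt (ε vl)) / (hgt (ε vh) - hgt (ε vl))
  have hθ0 : 0 < θ := div_pos (by linarith) hd
  have hθ1 : θ < 1 := (div_lt_one hd).2 (by linarith)
  let A : ℂ := (1 - θ) • z0 (ε vl) + θ • z0 (ε vh)
  have hA : Dist.dist A (P a) < ρ := by
    have := combo_mem_ball_of_ne (z := P a) (r := ρ) (x := z0 (ε vl)) (y := z0 (ε vh)) (a := 1 - θ) (b := θ)
      (by rw [Metric.mem_closedBall, ← hε1 vl, hzs]) (by rw [Metric.mem_closedBall, ← hε1 vh, hzs])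
      (fun h => by have : hgt (ε vl) = hgt (ε vh) := by simp only [hgt, h]
                   linarith) (by linarith) hθ0 (by ring)
    exact Metric.mem_ball.1 this
  have hAu : dt u A = c := by
    have h1 : dt u A = (1 - θ) * hgt (ε vl) + θ * hgt (ε vh) := by
      simp only [A, hgt, dt, Complex.add_re, Complex.add_im, Complex.real_smul, Complex.mul_re, Complex.mul_im,
        Complex.ofReal_re, Complex.ofReal_im]
      ring
    have h2 : θ * (hgt (ε vh) - hgt (ε vl)) = c - hgt (ε vl) := div_mul_cancel₀ _ hd.ne'
    rw [h1]; linarith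
  obtain ⟨D', e1, e2, e3, e4, e5⟩ := H (Function.update P a A) (by
    intro v
    by_cases hv : v = a
    · subst hv; simpa using hA
    · simpa [hv] using hρ)
  have hch : ∀ e, s e = a → dt u (D'.ch e 1 - D'.ch e 0) = hgt e - c := by
    intro e he
    rw [e4, D'.ch_zero, e1, e2, he, Function.update_self, ← hAu]
    simp only [hgt, dt, Complex.sub_re, Complex.sub_im]; ring
  have hsplit : (Finset.univ.filter (fun v : S => c < hgt (ε v))).card = k := by
    rw [← hcount, Finset.filter_image, Finset.card_image_of_injective _ hinj]
  have hsplit' : (Finset.univ.filter (fun v : S => hgt (ε v) < c)).card = k := by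
    have h1 := Finset.card_filter_add_card_filter_not (s := (Finset.univ : Finset S)) (fun v : S => c < hgt (ε v))
    rw [hsplit, Finset.card_univ, Fintype.card_coe, hcard] at h1
    have h2 : Finset.univ.filter (fun v : S => ¬ c < hgt (ε v)) = Finset.univ.filter (fun v : S => hgt (ε v) < c) := by
      apply Finset.filter_congr
      intro v _
      rw [not_lt]
      exact ⟨fun h => lt_of_le_of_ne h fun h => hcB ⟨_, h⟩, le_of_lt⟩
    rw [h2] at h1; omega
  refine ⟨D', u, hu, by rw [e2, e3]; exact hst, by rw [e3]; exact hta, ?_, ?_, ?_, by rw [e2, e3]; exact e5⟩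
  · intro e he
    rw [e2] at he
    rw [hch e he, sub_ne_zero]
    exact fun h => hcB ⟨e, h⟩
  · have : {e | D'.s e = a ∧ D'.t e ∈ S ∧ 0 < dt u (D'.ch e 1 - D'.ch e 0)} =
        ((Finset.univ.filter (fun v : S => c < hgt (ε v))).image ε : Finset _) := by
      ext e
      simp only [e2, e3, Set.mem_ofPred_eq, Finset.coe_image, Finset.coe_filter, Finset.mem_univ, true_and, Set.mem_image]
      constructor
      · rintro ⟨h1, h2, h3⟩
        obtain ⟨v, rfl⟩ := hεr e h1 h2
        rw [hch _ h1] at h3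
        exact ⟨v, by linarith, rfl⟩
      · rintro ⟨v, hv, rfl⟩
        refine ⟨hε1 v, by rw [hε2]; exact v.2, ?_⟩
        rw [hch _ (hε1 v)]; linarith
    rw [this, Set.ncard_coe_finset, Finset.card_image_of_injective _ hεi, hsplit]
  · have : {e | D'.s e = a ∧ D'.t e ∈ S ∧ dt u (D'.ch e 1 - D'.ch e 0) < 0} =
        ((Finset.univ.filter (fun v : S => hgt (ε v) < c)).image ε : Finset _) := by
      ext e
      simp only [e2, e3, Set.mem_ofPred_eq, Finset.coe_image, Finset.coe_filter, Finset.mem_univ, true_and, Set.mem_image]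
      constructor
      · rintro ⟨h1, h2, h3⟩
        obtain ⟨v, rfl⟩ := hεr e h1 h2
        rw [hch _ h1] at h3
        exact ⟨v, by linarith, rfl⟩
      · rintro ⟨v, hv, rfl⟩
        refine ⟨hε1 v, by rw [hε2]; exact v.2, ?_⟩
        rw [hch _ (hε1 v)]; linarith
    rw [this, Set.ncard_coe_finset, Finset.card_image_of_injective _ hεi, hsplit']

end CrAux

/-! ## Counting crossings, and duplicating a star twice -/
namespace CrAux

/-- The set of ordered pairs of crossing edges. -/
def crPairs {V : Type} {G : SimpleGraph V} (D : Drawing G) : Set (Sym2 V × Sym2 V) :=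
  {q | ∃ p, D.IsCrossing q.1 q.2 p}

lemma isCrossing_symm {V : Type} {G : SimpleGraph V} {D : Drawing G} {e f : Sym2 V} {p : ℝ × ℝ}
    (h : D.IsCrossing e f p) : D.IsCrossing f e p :=
  ⟨h.2.1, h.1, h.2.2.1.symm, h.2.2.2.2.1, h.2.2.2.1, h.2.2.2.2.2.2, h.2.2.2.2.2.1⟩

lemma two_crNum {V : Type} [Finite V] {G : SimpleGraph V} (D : Drawing G) (hD : D.IsGood) :
    2 * D.crNum = (crPairs D).ncard := by
  classical
  have : Fintype V := Fintype.ofFinite V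
  let H : SimpleGraph (Sym2 V) :=
    { Adj := fun e f => ∃ p, D.IsCrossing e f p
      symm := ⟨fun e f h => h.imp fun p hp => isCrossing_symm hp⟩
      loopless := ⟨fun e h => h.elim fun p hp => hp.2.2.1 rfl⟩ }
  have h1 : D.crNum = Nat.card H.edgeSet := by
    unfold Drawing.crNum Drawing.crBetween
    refine Nat.card_eq_of_bijective (fun q => ⟨q.1.2, ?_⟩) ⟨?_, ?_⟩
    · obtain ⟨⟨p, z⟩, e, f, h, -, -, hc⟩ := q
      simp only at h
      subst h
      exact ⟨p, hc⟩
    · rintro ⟨⟨p, z⟩, e, f, h, i1, i2, hc⟩ ⟨⟨p', z'⟩, e', f', h', i1', i2', hc'⟩ hh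
      simp only [Subtype.mk.injEq] at hh h h'
      subst hh
      subst h
      have hp : p = p' → (p, s(e, f)) = (p', s(e, f)) := fun h => by rw [h]
      refine Subtype.ext (hp ?_)
      rcases Sym2.eq_iff.1 h' with ⟨rfl, rfl⟩ | ⟨rfl, rfl⟩
      · exact hD.cross_once _ _ hc hc'
      · exact hD.cross_once _ _ hc (isCrossing_symm hc')
    · rintro ⟨z, hz⟩
      induction z using Sym2.ind with
      | _ e f =>
        obtain ⟨p, hp⟩ := hz
        exact ⟨⟨(p, s(e, f)), e, f, rfl, hp.1, hp.2.1, hp⟩, rfl⟩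
  have h2 : (crPairs D).ncard = Nat.card H.Dart := by
    rw [← Nat.card_coe_set_eq]
    refine Nat.card_eq_of_bijective (fun q => (⟨q.1, q.2⟩ : H.Dart)) ⟨?_, ?_⟩
    · intro q q' h
      exact Subtype.ext (congrArg SimpleGraph.Dart.toProd h)
    · rintro ⟨q, hq⟩; exact ⟨⟨q, hq⟩, rfl⟩
  rw [h1, h2, Nat.card_eq_fintype_card, Nat.card_eq_fintype_card, SimpleGraph.dart_card_eq_twice_card_edges,
    SimpleGraph.edgeFinset_card]

/-- The edges after duplicating a star twice: old edges, copies, and two short edges. -/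
inductive Q (E : Type) (X : Set E) : Type
  | o (e : E) : Q E X
  | c (x : X) (b : Bool) : Q E X
  | g (b : Bool) : Q E X

lemma K_congr {V E V' E' : Type} {D : PD V E} {D' : PD V' E'} {e : E} {e' : E'} (hN : D.N e = D'.N e')
    (hch : D.ch e = D'.ch e') : D.K e = D'.K e' := by
  unfold PD.K PD.sg
  rw [hN, hch]

/-- Nonadjacent edges whose carriers meet. -/
def PD.R {V E : Type} (D : PD V E) (e f : E) : Prop :=
  (D.s e ≠ D.s f ∧ D.s e ≠ D.t f ∧ D.t e ≠ D.s f ∧ D.t e ≠ D.t f) ∧ (D.K e ∩ D.K f).Nonempty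

lemma PD.R.symm {V E : Type} {D : PD V E} {e f : E} (h : D.R e f) : D.R f e :=
  ⟨⟨h.1.1.symm, h.1.2.2.1.symm, h.1.2.1.symm, h.1.2.2.2.symm⟩, by rw [Set.inter_comm]; exact h.2⟩

/-- The initial direction of an edge. -/
def PD.d {V E : Type} (D : PD V E) (e : E) : ℂ := D.ch e 1 - D.ch e 0

/-- The old edge corresponding to an edge. -/
def Q.pr {E : Type} {X : Set E} : Q E X → Option E
  | .o e => some e
  | .c x _ => some x
  | .g _ => none

/-- A sign. -/
def sgn (b : Bool) : ℝ := if b then -1 else 1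

/-- The local crossings at a duplicated vertex. -/
def Loc {E : Type} {X : Set E} (st : Set E) (d : E → ℂ) (u : ℂ) (q q' : Q E X) : Prop :=
  (∃ x b f, q = .c x b ∧ q' = .o f ∧ f ∈ st ∧ 0 < dt u (d x) * dt u (d f) ∧
      0 < sgn b * (dt u (d x) * dt (d f) (d x))) ∨
  (∃ x x', q = .c x true ∧ q' = .c x' false ∧ x ≠ x' ∧ 0 < dt u (d x') * dt u (d x) ∧
      0 < dt u (d x') * dt (d x) (d x'))

theorem dup2 {V E : Type} [Finite V] [Finite E] (D : PD V E) (a : V) (u : ℂ) (hu : u ≠ 0)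
    (hta : ∀ e, D.t e ≠ a) (hinj : ∀ e f, D.s e = a → D.s f = a → D.t e = D.t f → e = f)
    (X : Set E) (hXs : ∀ x ∈ X, D.s x = a) (hne : ∀ e, D.s e = a → dt u (D.d e) ≠ 0) :
    ∃ (E2 : Type) (D2 : PD (Option (Option V)) E2) (ι : Q E X → E2),
      (∀ e, D2.s (ι (.o e)) = some (some (D.s e)) ∧ D2.t (ι (.o e)) = some (some (D.t e))) ∧
      (∀ x b, D2.s (ι (.c x b)) = (if b then none else some none) ∧
        D2.t (ι (.c x b)) = some (some (D.t x))) ∧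
      (∀ b, D2.s (ι (.g b)) = some (some a) ∧ D2.t (ι (.g b)) = (if b then none else some none)) ∧
      ∀ q q', D2.R (ι q) (ι q') →
        (∃ e f, q.pr = some e ∧ q'.pr = some f ∧ D.R e f) ∨
          Loc {e | D.s e = a} D.d u q q' ∨ Loc {e | D.s e = a} D.d u q' q := by
  obtain ⟨D1, -, a2, a3, ⟨a4, a5, ε, hε, a6⟩, a7, a8, a9⟩ := dup D a u hu hta hinj X hXs
    (fun x hx => hne x (hXs x hx)) (fun f hf => Or.inl (hne f hf))
  have neg : ∀ w, dt (-u) w = - dt u w := fun w => by simp [dt]; ring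
  obtain ⟨D2, -, b2, b3, ⟨b4, b5, ε', hε', b6⟩, b7, b8, b9⟩ := dup D1 (some a) (-u) (neg_ne_zero.2 hu)
    (by
      rintro (e | x | ⟨⟩)
      · rw [(a2 e).2.1]; simpa using hta e
      · rw [(a3 x).2]; simpa using hta x
      · rw [a5]; simp)
    (by
      rintro (e | x | ⟨⟩) (f | y | ⟨⟩) h1 h2 h3
      · rw [(a2 e).1] at h1
        rw [(a2 f).1] at h2
        rw [(a2 e).2.1, (a2 f).2.1] at h3
        rw [hinj e f (Option.some.inj h1) (Option.some.inj h2) (Option.some.inj h3)]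
      · rw [(a3 y).1] at h2; cases h2
      · rw [a5, (a2 e).2.1] at h3; cases h3
      · rw [(a3 x).1] at h1; cases h1
      · rw [(a3 x).1] at h1; cases h1
      · rw [(a3 x).1] at h1; cases h1
      · rw [a5, (a2 f).2.1] at h3; cases h3
      · rw [(a3 y).1] at h2; cases h2
      · rfl)
    (Sum.inl '' X)
    (by rintro _ ⟨x, hx, rfl⟩; rw [(a2 x).1, hXs x hx])
    (by
      rintro _ ⟨x, hx, rfl⟩
      rw [(a2 x).2.2.2, neg, neg_ne_zero]
      exact hne x (hXs x hx))
    (by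
      rintro (e | x | ⟨⟩) h1
      · left
        rw [(a2 e).2.2.2, neg, neg_ne_zero]
        rw [(a2 e).1] at h1
        exact hne e (Option.some.inj h1)
      · rw [(a3 x).1] at h1; cases h1
      · right
        exact ⟨ε, hε, by rw [a6]; simp⟩)
  have K1 : ∀ e, D1.K (.inl e) = D.K e := fun e => K_congr (a2 e).2.2.1 (a2 e).2.2.2
  have K2 : ∀ e, D2.K (.inl e) = D1.K e := fun e => K_congr (b2 e).2.2.1 (b2 e).2.2.2
  let ι : Q E X → ((E ⊕ (X ⊕ Unit)) ⊕ ((Sum.inl '' X : Set (E ⊕ (X ⊕ Unit))) ⊕ Unit)) := fun q => match q with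
    | .o e => .inl (.inl e)
    | .c x false => .inl (.inr (.inl x))
    | .c x true => .inr (.inl ⟨.inl x.1, x.1, x.2, rfl⟩)
    | .g false => .inl (.inr (.inr ()))
    | .g true => .inr (.inr ())
  have so : ∀ e, D2.s (ι (.o e)) = some (some (D.s e)) ∧ D2.t (ι (.o e)) = some (some (D.t e)) := fun e => by
    simp only [ι, (b2 _).1, (b2 _).2.1, (a2 _).1, (a2 _).2.1, and_self]
  have sc : ∀ x b, D2.s (ι (.c x b)) = (if b then none else some none) ∧
        D2.t (ι (.c x b)) = some (some (D.t x)) := by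
    rintro x (_ | _)
    · simp [ι, (b2 _).1, (b2 _).2.1, (a3 _).1, (a3 _).2]
    · simp [ι, (b3 _).1, (b3 _).2, (a2 _).2.1]
  have sG : ∀ b, D2.s (ι (.g b)) = some (some a) ∧ D2.t (ι (.g b)) = (if b then none else some none) := by
    rintro (_ | _)
    · simp [ι, (b2 _).1, (b2 _).2.1, a4, a5]
    · simp [ι, b4, b5]
  refine ⟨_, D2, ι, so, sc, sG, ?_⟩
  -- the mixed cases
  have hco : ∀ x b f, D2.R (ι (.c x b)) (ι (.o f)) → D.R x f ∨ Loc {e | D.s e = a} D.d u (.c x b) (.o f) := by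
    intro x b f h
    obtain ⟨⟨h1, h2, h3, h4⟩, h5⟩ := h
    rw [(so f).1, (sc x b).2] at h3
    rw [(so f).2, (sc x b).2] at h4
    have h3' : D.t x ≠ D.s f := fun h => h3 (by rw [h])
    have h4' : D.t x ≠ D.t f := fun h => h4 (by rw [h])
    by_cases hf : D.s f = a
    · right; left
      refine ⟨x, b, f, rfl, rfl, hf, ?_⟩
      have hfx : f ≠ x := by rintro rfl; exact h4' rfl
      cases b
      · simp only [ι, K2] at h5
        have := a8 x f hf hfx h5
        simpa [sgn, PD.d] using this
      · simp only [ι] at h5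
        have := b8 _ (.inl f) (by rw [(a2 f).1, hf]) (by simpa using hfx) h5
        simp only [(a2 _).2.2.2, neg] at this
        simp only [sgn, PD.d, if_true]
        constructor
        · linarith [this.1]
        · linarith [this.2]
    · left
      refine ⟨⟨by rw [hXs x x.2]; exact Ne.symm hf, by rw [hXs x x.2]; exact (hta f).symm, h3', h4'⟩, ?_⟩
      cases b
      · simp only [ι, K2] at h5
        exact a7 x f hf h3' h4' h5
      · simp only [ι] at h5
        have := b7 _ (.inl f) (by rw [(a2 f).1]; simpa using hf) (by simpa [(a2 _).1, (a2 _).2.1] using h3')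
          (by simpa [(a2 _).2.1] using h4') h5
        simpa [K1] using this
  have hcc : ∀ x x', D2.R (ι (.c x true)) (ι (.c x' false)) →
      Loc {e | D.s e = a} D.d u (.c x true) (.c x' false) := by
    intro x x' h
    obtain ⟨⟨h1, h2, h3, h4⟩, h5⟩ := h
    rw [(sc x' false).2, (sc x true).2] at h4
    have h4' : D.t x ≠ D.t x' := fun h => h4 (by rw [h])
    have hxx : x ≠ x' := by rintro rfl; exact h4' rfl
    right
    refine ⟨x, x', rfl, rfl, hxx, ?_⟩
    simp only [ι] at h5
    have := b7 _ (.inr (.inl x')) (by rw [(a3 _).1]; simp) (by simp [(a3 _).1, (a2 _).2.1])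
      (by simpa [(a2 _).2.1, (a3 _).2] using h4') h5
    rw [Set.inter_comm] at this
    exact a8 x' x (hXs x x.2) (fun h => hxx (Subtype.ext h)) this
  have hgo : ∀ b f, ¬ D2.R (ι (.g b)) (ι (.o f)) := by
    rintro b f ⟨⟨h1, h2, h3, h4⟩, h5⟩
    rw [(sG b).1, (so f).1] at h1
    have hf : D.s f ≠ a := fun h => h1 (by rw [h])
    cases b
    · simp only [ι, K2] at h5
      rw [a9 f hf] at h5
      exact Set.not_nonempty_empty h5
    · simp only [ι] at h5
      rw [b9 (.inl f) (by rw [(a2 f).1]; simpa using hf)] at h5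
      exact Set.not_nonempty_empty h5
  have hgc : ∀ b x b', ¬ D2.R (ι (.g b)) (ι (.c x b')) := by
    rintro b x b' ⟨⟨h1, h2, h3, h4⟩, h5⟩
    rw [(sG b).2, (sc x b').1] at h3
    cases b <;> cases b'
    · simp at h3
    · simp only [ι] at h5
      rw [Set.inter_comm] at h5
      have := (b8 _ (.inr (.inr ())) a4 (by simp) h5).1
      have h0 : dt (-u) (ε • u) = 0 := by simp [dt]; ring
      rw [a6, h0, mul_zero] at this
      exact absurd this (lt_irrefl _)
    · simp only [ι] at h5
      rw [b9 _ (by rw [(a3 x).1]; simp)] at h5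
      exact Set.not_nonempty_empty h5
    · simp at h3
  intro q q' h
  rcases q with e | ⟨x, b⟩ | b <;> rcases q' with f | ⟨x', b'⟩ | b'
  · left
    refine ⟨e, f, rfl, rfl, ?_⟩
    obtain ⟨⟨h1, h2, h3, h4⟩, h5⟩ := h
    rw [(so e).1, (so f).1] at h1
    rw [(so e).1, (so f).2] at h2
    rw [(so e).2, (so f).1] at h3
    rw [(so e).2, (so f).2] at h4
    simp only [ι, K1, K2] at h5
    exact ⟨⟨fun h => h1 (by rw [h]), fun h => h2 (by rw [h]), fun h => h3 (by rw [h]), fun h => h4 (by rw [h])⟩, h5⟩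
  · rcases hco x' b' e h.symm with h' | h'
    · exact Or.inl ⟨_, _, rfl, rfl, h'.symm⟩
    · exact Or.inr (Or.inr h')
  · exact absurd h.symm (hgo _ _)
  · rcases hco x b f h with h' | h'
    · exact Or.inl ⟨_, _, rfl, rfl, h'⟩
    · exact Or.inr (Or.inl h')
  · cases b <;> cases b'
    · exact absurd ((sc x false).1.trans (sc x' false).1.symm) h.1.1
    · exact Or.inr (Or.inr (hcc _ _ h.symm))
    · exact Or.inr (Or.inl (hcc _ _ h))
    · exact absurd ((sc x true).1.trans (sc x' true).1.symm) h.1.1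
  · exact absurd h.symm (hgc _ _ _)
  · exact absurd h (hgo _ _)
  · exact absurd h (hgc _ _ _)
  · exact absurd ((sG b).1.trans (sG b').1.symm) h.1.1

end CrAux

/-! ## The counting lemma -/
namespace CrAux

instance {E : Type} [Finite E] {X : Set E} : Finite (Q E X) := by
  refine Finite.of_injective (β := E ⊕ ((X × Bool) ⊕ Bool))
    (fun q => match q with
      | .o e => .inl e
      | .c x b => .inr (.inl (x, b))
      | .g b => .inr (.inr b)) ?_
  rintro (e | ⟨x, b⟩ | b) (e' | ⟨x', b'⟩ | b') h <;> simp_all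

/-- The weighted pairs of crossing edges. -/
def wPairs {E : Type} (X B : Set E) (C : E → E → Prop) : Set ((E × E) × (Bool × Bool)) :=
  {r | C r.1.1 r.1.2 ∧ r.1.1 ∉ B ∧ r.1.2 ∉ B ∧ (r.2.1 = true → r.1.1 ∈ X) ∧ (r.2.2 = true → r.1.2 ∈ X)}

theorem count {E : Type} [Finite E] (X B st : Set E) (hXst : X ⊆ st) (hXB : ∀ x ∈ X, x ∉ B)
    (d : E → ℂ) (u : ℂ) (C : E → E → Prop) (Rq : Q E X → Q E X → Prop)
    (hR : ∀ q q', Rq q q' → (∃ e f, q.pr = some e ∧ q'.pr = some f ∧ C e f) ∨ Loc st d u q q' ∨ Loc st d u q' q)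
    (k l : ℕ) (hup : {e | e ∈ X ∧ 0 < dt u (d e)}.ncard = k) (hdn : {e | e ∈ X ∧ dt u (d e) < 0}.ncard = k)
    (hF : {e | e ∈ st ∧ e ∉ X ∧ e ∉ B}.ncard ≤ l) :
    {p : Q E X × Q E X | (∀ e, p.1 = .o e → e ∉ X ∧ e ∉ B) ∧ (∀ e, p.2 = .o e → e ∉ X ∧ e ∉ B) ∧ Rq p.1 p.2}.ncard
      ≤ (wPairs X B C).ncard + 2 * (l * k + (k * k - k)) := by
  classical
  let dec : E → Bool → Q E X := fun e b => if h : e ∈ X then .c ⟨e, h⟩ b else .o e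
  have decX : ∀ (x : X) b, dec x b = .c x b := fun x b => by simp [dec]
  have decO : ∀ e b, e ∉ X → dec e b = .o e := fun e b h => by simp [dec, h]
  let up : Set E := {e | e ∈ X ∧ 0 < dt u (d e)}
  let dn : Set E := {e | e ∈ X ∧ dt u (d e) < 0}
  let F : Set E := {e | e ∈ st ∧ e ∉ X ∧ e ∉ B}
  let M : Set (E × E) := {p | p.1 ∈ X ∧ p.2 ∈ F ∧ 0 < dt u (d p.1) * dt u (d p.2)}
  let N2 : Set (E × E) := {p | p.1 ∈ X ∧ p.2 ∈ X ∧ p.1 ≠ p.2 ∧ 0 < dt u (d p.2) * dt u (d p.1) ∧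
    0 < dt u (d p.2) * dt (d p.1) (d p.2)}
  let U : Q E X → Prop := fun q => ∀ e, q = .o e → e ∉ X ∧ e ∉ B
  let Gs : Set (Q E X × Q E X) := {p | U p.1 ∧ U p.2 ∧ ∃ e f, p.1.pr = some e ∧ p.2.pr = some f ∧ C e f}
  let Ls : Set (Q E X × Q E X) := {p | U p.1 ∧ U p.2 ∧ Loc st d u p.1 p.2}
  have hM : M.ncard ≤ l * k := by
    let Fu : Set E := {e | e ∈ F ∧ 0 < dt u (d e)}
    let Fd : Set E := {e | e ∈ F ∧ dt u (d e) < 0}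
    have h1 : M ⊆ (up ×ˢ Fu) ∪ (dn ×ˢ Fd) := by
      rintro ⟨x, f⟩ ⟨h1, h2, h3⟩
      rcases pos_and_pos_or_neg_and_neg_of_mul_pos h3 with ⟨h4, h5⟩ | ⟨h4, h5⟩
      · exact Or.inl ⟨⟨h1, h4⟩, h2, h5⟩
      · exact Or.inr ⟨⟨h1, h4⟩, h2, h5⟩
    have h2 : Fu.ncard + Fd.ncard ≤ l := by
      refine le_trans ?_ hF
      rw [← Set.ncard_union_eq]
      · apply Set.ncard_le_ncard _ (Set.toFinite _)
        rintro e (h | h)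
        · exact h.1
        · exact h.1
      · rw [Set.disjoint_left]
        rintro e ⟨-, h⟩ ⟨-, h'⟩
        exact lt_asymm h h'
    calc M.ncard ≤ _ := Set.ncard_le_ncard h1 (Set.toFinite _)
      _ ≤ _ := Set.ncard_union_le _ _
      _ = k * Fu.ncard + k * Fd.ncard := by rw [Set.ncard_prod, Set.ncard_prod, hup, hdn]
      _ = (Fu.ncard + Fd.ncard) * k := by ring
      _ ≤ l * k := Nat.mul_le_mul_right _ h2
  have hN : N2.ncard ≤ k * k - k := by
    have o1 : ∀ S : Set E, S.ncard = k → S.offDiag.ncard = k * k - k := by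
      intro S hS
      have : Fintype E := Fintype.ofFinite E
      have h1 : S.offDiag = (S.toFinset.offDiag : Finset _) := by
        simp
      rw [h1, Set.ncard_coe_finset, Finset.offDiag_card, ← Set.ncard_eq_toFinset_card', hS]
    have h1 : N2 ∪ Prod.swap '' N2 ⊆ up.offDiag ∪ dn.offDiag := by
      have : N2 ⊆ up.offDiag ∪ dn.offDiag := by
        rintro ⟨x, y⟩ ⟨h1, h2, h3, h4, -⟩
        rcases pos_and_pos_or_neg_and_neg_of_mul_pos h4 with ⟨h5, h6⟩ | ⟨h5, h6⟩
        · exact Or.inl ⟨⟨h1, h6⟩, ⟨h2, h5⟩, h3⟩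
        · exact Or.inr ⟨⟨h1, h6⟩, ⟨h2, h5⟩, h3⟩
      refine Set.union_subset this ?_
      rintro _ ⟨⟨x, y⟩, h, rfl⟩
      rcases this h with ⟨h1, h2, h3⟩ | ⟨h1, h2, h3⟩
      · exact Or.inl ⟨h2, h1, fun h => h3 h.symm⟩
      · exact Or.inr ⟨h2, h1, fun h => h3 h.symm⟩
    have h2 : Disjoint N2 (Prod.swap '' N2) := by
      rw [Set.disjoint_left]
      rintro _ ⟨h1, h2, h3, h4, h5⟩ ⟨⟨x, y⟩, ⟨g1, g2, g3, g4, g5⟩, rfl⟩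
      simp only [Prod.swap] at h4 h5 g4 g5
      have : dt (d y) (d x) = - dt (d x) (d y) := by simp only [dt]; ring
      rw [this] at h5
      have h6 := mul_pos h5 g5
      have h7 := mul_nonneg h4.le (mul_self_nonneg (dt (d x) (d y)))
      nlinarith
    have h3 := Set.ncard_le_ncard h1 (Set.toFinite _)
    rw [Set.ncard_union_eq h2, Set.ncard_image_of_injective _ Prod.swap_injective] at h3
    have h4 := Set.ncard_union_le up.offDiag dn.offDiag
    rw [o1 up hup, o1 dn hdn] at h4
    omega
  have hL : Ls.ncard ≤ l * k + (k * k - k) := by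
    let bt : E × E → Bool := fun p => if 0 < dt u (d p.1) * dt (d p.2) (d p.1) then false else true
    have : Ls ⊆ ((fun p : E × E => (dec p.1 (bt p), (Q.o p.2 : Q E X))) '' M) ∪
        ((fun p : E × E => (dec p.1 true, dec p.2 false)) '' N2) := by
      rintro ⟨q, q'⟩ ⟨h1, h2, h⟩
      rcases h with ⟨x, b, f, hq, hq', h3, h4, h5⟩ | ⟨x, x', hq, hq', h3, h4, h5⟩
      · simp only at hq hq' h1 h2
        subst hq; subst hq'
        left
        refine ⟨(x.1, f), ⟨x.2, ⟨h3, h2 f rfl⟩, h4⟩, ?_⟩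
        have : bt (x.1, f) = b := by
          cases b
          · simp only [sgn, Bool.false_eq_true, if_false, one_mul] at h5
            simp [bt, h5]
          · simp only [sgn, if_true] at h5
            simp only [bt]
            rw [if_neg (by linarith)]
        simp only [this, decX]
      · simp only at hq hq' h1 h2
        subst hq; subst hq'
        right
        refine ⟨(x.1, x'.1), ⟨x.2, x'.2, fun h => h3 (Subtype.ext h), h4, h5⟩, ?_⟩
        simp only [decX]
    calc Ls.ncard ≤ _ := Set.ncard_le_ncard this (Set.toFinite _)
      _ ≤ _ := Set.ncard_union_le _ _
      _ ≤ M.ncard + N2.ncard := add_le_add (Set.ncard_image_le (Set.toFinite _)) (Set.ncard_image_le (Set.toFinite _))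
      _ ≤ _ := add_le_add hM hN
  have hG : Gs.ncard ≤ (wPairs X B C).ncard := by
    have code : ∀ q : Q E X, U q → ∀ e, q.pr = some e → ∃ b, dec e b = q ∧ e ∉ B ∧ (b = true → e ∈ X) := by
      rintro (e | ⟨x, b⟩ | b) hU f hf
      · simp only [Q.pr, Option.some.injEq] at hf
        subst hf
        exact ⟨false, decO _ _ (hU e rfl).1, (hU e rfl).2, by simp⟩
      · simp only [Q.pr, Option.some.injEq] at hf
        subst hf
        exact ⟨b, decX _ _, hXB _ x.2, fun _ => x.2⟩
      · simp [Q.pr] at hf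
    have : Gs ⊆ (fun r : (E × E) × (Bool × Bool) => (dec r.1.1 r.2.1, dec r.1.2 r.2.2)) '' wPairs X B C := by
      rintro ⟨q, q'⟩ ⟨h1, h2, e, f, he, hf, hC⟩
      obtain ⟨b, hb1, hb2, hb3⟩ := code q h1 e he
      obtain ⟨b', hb1', hb2', hb3'⟩ := code q' h2 f hf
      exact ⟨((e, f), (b, b')), ⟨hC, hb2, hb2', hb3, hb3'⟩, by simp only [hb1, hb1']⟩
    exact (Set.ncard_le_ncard this (Set.toFinite _)).trans (Set.ncard_image_le (Set.toFinite _))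
  have hsub : {p : Q E X × Q E X | (∀ e, p.1 = .o e → e ∉ X ∧ e ∉ B) ∧ (∀ e, p.2 = .o e → e ∉ X ∧ e ∉ B) ∧ Rq p.1 p.2}
      ⊆ Gs ∪ (Ls ∪ Prod.swap '' Ls) := by
    rintro ⟨q, q'⟩ ⟨h1, h2, h⟩
    rcases hR q q' h with h | h | h
    · exact Or.inl ⟨h1, h2, h⟩
    · exact Or.inr (Or.inl ⟨h1, h2, h⟩)
    · exact Or.inr (Or.inr ⟨(q', q), ⟨h2, h1, h⟩, rfl⟩)
  have e1 := Set.ncard_le_ncard hsub (Set.toFinite _)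
  have e2 := Set.ncard_union_le Gs (Ls ∪ Prod.swap '' Ls)
  have e3 := Set.ncard_union_le Ls (Prod.swap '' Ls)
  rw [Set.ncard_image_of_injective _ Prod.swap_injective] at e3
  omega

/-- The two weightings together count each crossing at most twice. -/
theorem wsum {E : Type} [Finite E] (X B : Set E) (C : E → E → Prop) (hXB : ∀ x ∈ X, x ∉ B)
    (hX : ∀ e ∈ X, ∀ f ∈ X, ¬ C e f) (hB : ∀ e ∈ B, ∀ f ∈ B, ¬ C e f) :
    (wPairs X B C).ncard + (wPairs B X C).ncard ≤ 2 * {p : E × E | C p.1 p.2}.ncard := by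
  classical
  have : Fintype E := Fintype.ofFinite E
  have key : ∀ X B : Set E, (wPairs X B C).ncard = ∑ p ∈ (Finset.univ.filter fun p : E × E => C p.1 p.2),
      ((Finset.univ : Finset (Bool × Bool)).filter fun r => p.1 ∉ B ∧ p.2 ∉ B ∧ (r.1 = true → p.1 ∈ X) ∧
        (r.2 = true → p.2 ∈ X)).card := by
    intro X B
    rw [← Finset.card_sigma, Set.ncard_eq_toFinset_card']
    refine Finset.card_bij' (fun r _ => ⟨r.1, r.2⟩) (fun r _ => (r.1, r.2)) ?_ ?_ ?_ ?_
    · intro r hr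
      rw [Set.mem_toFinset] at hr
      simp only [Finset.mem_sigma, Finset.mem_filter, Finset.mem_univ, true_and]
      exact hr
    · intro r hr
      rw [Set.mem_toFinset]
      simp only [Finset.mem_sigma, Finset.mem_filter, Finset.mem_univ, true_and] at hr
      exact hr
    · intros; rfl
    · intros; rfl
  rw [key, key, ← Finset.sum_add_distrib]
  have h2 : {p : E × E | C p.1 p.2}.ncard = (Finset.univ.filter fun p : E × E => C p.1 p.2).card := by
    rw [← Set.ncard_coe_finset]; simp
  rw [h2, mul_comm, ← smul_eq_mul]
  apply Finset.sum_le_card_nsmul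
  rintro ⟨e, f⟩ h
  have hC : C e f := by simpa using h
  have h3 := hX e; have h4 := hX f; have h5 := hB e; have h6 := hB f
  have h7 := hXB e; have h8 := hXB f
  by_cases a1 : e ∈ X <;> by_cases a2 : f ∈ X <;> by_cases a3 : e ∈ B <;> by_cases a4 : f ∈ B <;>
    simp only [a1, a2, a3, a4, not_true_eq_false, not_false_eq_true, true_and, false_and, and_true, and_false,
      imp_false, imp_true_iff, Bool.not_eq_true, Finset.filter_true, Finset.filter_false] <;>
    first
    | exact absurd a3 (h7 a1)
    | exact absurd a4 (h8 a2)
    | exact absurd hC (h3 a1 f a2)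
    | exact absurd hC (h5 a3 f a4)
    | decide

end CrAux

/-! ## The main inequality for one of the two derived drawings -/
namespace CrAux

/-- The first side of the derived complete bipartite graph. -/
def LS {V : Type} {m : ℕ} (a : V) (x : Fin m → V) (z : Option (Option V)) : Prop :=
  z = some (some a) ∨ ∃ i, z = some (some (x i))

/-- The second side of the derived complete bipartite graph. -/
def RS {V : Type} {n : ℕ} (b : V) (y : Fin n → V) (z : Option (Option V)) : Prop :=
  z = none ∨ z = some none ∨ z = some (some b) ∨ ∃ j, z = some (some (y j))

/-- The edges between `a` and a family of vertices. -/
def starE {V : Type} (G : SimpleGraph V) {m : ℕ} (a : V) (x : Fin m → V) : Set G.edgeSet :=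
  {e | ∃ i, e.1 = s(a, x i)}

theorem main1 {V W : Type} [Finite V] [Finite W] {G : SimpleGraph V} (D : Drawing G) (hD : D.IsGood)
    {m n : ℕ} (a b : V) (x : Fin m → V) (y : Fin n → V) (hx : Function.Injective x)
    (hab : a ≠ b) (hax : ∀ i, a ≠ x i) (hay : ∀ j, a ≠ y j)
    (hbx : ∀ i, b ≠ x i) (hby : ∀ j, b ≠ y j) (hxy : ∀ i j, x i ≠ y j)
    (hV : ∀ v, v = a ∨ v = b ∨ (∃ i, v = x i) ∨ ∃ j, v = y j)
    (Aab : G.Adj a b) (Aax : ∀ i, G.Adj a (x i)) (Aay : ∀ j, G.Adj a (y j)) (Abx : ∀ i, G.Adj b (x i))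
    (Axy : ∀ i j, G.Adj (x i) (y j)) (k : ℕ) (hk : 0 < k) (hm : m = 2 * k)
    (H : SimpleGraph W) (f : W → Option (Option V)) (hf : Function.Injective f)
    (hH : ∀ w w', H.Adj w w' → (LS a x (f w) ∧ RS b y (f w')) ∨ (RS b y (f w) ∧ LS a x (f w'))) :
    ∃ D' : Drawing H, D'.IsGood ∧ 2 * D'.crNum ≤
      (wPairs (starE G a x) (starE G b y) (fun e f => ∃ p, D.IsCrossing e.1 f.1 p)).ncard +
        2 * ((n + 1) * k + (k * k - k)) := by
  classical
  obtain ⟨D0, u, hu, hst, hta, hne, hup, hdn, hcr⟩ := drawPD D hD a (Finset.univ.image x)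
    (by intro v hv; obtain ⟨i, -, rfl⟩ := Finset.mem_image.1 hv; exact Aax i) k hk
    (by rw [Finset.card_image_of_injective _ hx]; simp [hm])
  set X : Set G.edgeSet := starE G a x with hXd
  set B : Set G.edgeSet := starE G b y with hBd
  have hsa : ∀ (e : G.edgeSet) v, e.1 = s(a, v) → D0.s e = a ∧ D0.t e = v := by
    intro e v h
    rw [← hst e] at h
    rcases Sym2.eq_iff.1 h with h | h
    · exact h
    · exact absurd h.2 (hta e)
  have hX : ∀ e, e ∈ X ↔ D0.s e = a ∧ D0.t e ∈ Finset.univ.image x := by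
    intro e
    constructor
    · rintro ⟨i, hi⟩
      obtain ⟨h1, h2⟩ := hsa e _ hi
      exact ⟨h1, by rw [h2]; exact Finset.mem_image_of_mem _ (Finset.mem_univ _)⟩
    · rintro ⟨h1, h2⟩
      obtain ⟨i, -, hi⟩ := Finset.mem_image.1 h2
      exact ⟨i, by rw [← hst e, h1, hi]⟩
  have hXB : ∀ e ∈ X, e ∉ B := by
    rintro e ⟨i, hi⟩ ⟨j, hj⟩
    rw [hi] at hj
    rcases Sym2.eq_iff.1 hj with h | h
    · exact hab h.1
    · exact hay j h.1
  obtain ⟨E2, D2, ι, so, sc, sG, hR⟩ := dup2 D0 a u hu hta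
    (by
      intro e f h1 h2 h3
      apply Subtype.ext
      rw [← hst e, ← hst f, h1, h2, h3])
    X (fun e he => ((hX e).1 he).1) hne
  let U : Q G.edgeSet X → Prop := fun q => ∀ e, q = .o e → e ∉ X ∧ e ∉ B
  -- every edge of the new graph is represented
  have oEdge : ∀ e : G.edgeSet, e ∉ X → e ∉ B → ∀ v w, e.1 = s(v, w) →
      ∃ q, U q ∧ s(D2.s (ι q), D2.t (ι q)) = s(some (some v), some (some w)) := by
    intro e h1 h2 v w h
    refine ⟨.o e, ?_, ?_⟩
    · intro e' he'
      cases he'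
      exact ⟨h1, h2⟩
    · rw [(so e).1, (so e).2]
      have := congrArg (Sym2.map (fun v => some (some v))) ((hst e).trans h)
      simpa using this
  have cEdge : ∀ i (b : Bool), ∃ q, U q ∧ s(D2.s (ι q), D2.t (ι q)) =
      s(some (some (x i)), (if b then none else some none)) := by
    intro i b
    refine ⟨.c ⟨⟨s(a, x i), Aax i⟩, i, rfl⟩ b, fun e he => by simp at he, ?_⟩
    rw [(sc _ b).1, (sc _ b).2, (hsa ⟨s(a, x i), Aax i⟩ (x i) rfl).2]
    exact Sym2.eq_swap
  have gEdge : ∀ b : Bool, ∃ q, U q ∧ s(D2.s (ι q), D2.t (ι q)) =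
      s(some (some a), (if b then none else some none)) := by
    intro b
    refine ⟨.g b, fun e he => by simp at he, ?_⟩
    rw [(sG b).1, (sG b).2]
  have rep : ∀ z z', LS a x z → RS b y z' → ∃ q, U q ∧ s(D2.s (ι q), D2.t (ι q)) = s(z, z') := by
    rintro z z' (rfl | ⟨i, rfl⟩) (rfl | rfl | rfl | ⟨j, rfl⟩)
    · simpa using gEdge true
    · simpa using gEdge false
    · refine oEdge ⟨s(a, b), Aab⟩ ?_ ?_ _ _ rfl
      · rintro ⟨i, hi⟩
        rcases Sym2.eq_iff.1 hi with h | h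
        · exact hbx i h.2
        · exact hab h.2.symm
      · rintro ⟨j, hj⟩
        rcases Sym2.eq_iff.1 hj with h | h
        · exact hab h.1
        · exact hay j h.1
    · refine oEdge ⟨s(a, y j), Aay j⟩ ?_ ?_ _ _ rfl
      · rintro ⟨i, hi⟩
        rcases Sym2.eq_iff.1 hi with h | h
        · exact hxy i j h.2.symm
        · exact hax i h.1
      · rintro ⟨j', hj⟩
        rcases Sym2.eq_iff.1 hj with h | h
        · exact hab h.1
        · exact hay j' h.1
    · simpa using cEdge i true
    · simpa using cEdge i false
    · refine oEdge ⟨s(x i, b), (Abx i).symm⟩ ?_ ?_ _ _ rfl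
      · rintro ⟨i', hi⟩
        rcases Sym2.eq_iff.1 hi with h | h
        · exact hax i h.1.symm
        · exact hab h.2.symm
      · rintro ⟨j', hj⟩
        rcases Sym2.eq_iff.1 hj with h | h
        · exact hbx i h.1.symm
        · exact hxy i j' h.1
    · refine oEdge ⟨s(x i, y j), Axy i j⟩ ?_ ?_ _ _ rfl
      · rintro ⟨i', hi⟩
        rcases Sym2.eq_iff.1 hi with h | h
        · exact hax i h.1.symm
        · exact hay j h.2.symm
      · rintro ⟨j', hj⟩
        rcases Sym2.eq_iff.1 hj with h | h
        · exact hbx i h.1.symm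
        · exact hby j h.2.symm
  have rep' : ∀ σ : H.edgeSet, ∃ q, U q ∧ s(D2.s (ι q), D2.t (ι q)) = σ.1.map f := by
    rintro ⟨σ, hσ⟩
    induction σ using Sym2.ind with
    | _ w w' =>
      rcases hH w w' hσ with ⟨h1, h2⟩ | ⟨h1, h2⟩
      · exact rep _ _ h1 h2
      · obtain ⟨q, h3, h4⟩ := rep _ _ h2 h1
        exact ⟨q, h3, h4.trans Sym2.eq_swap⟩
  choose η hηU hη using rep'
  obtain ⟨D', hD', hcross⟩ := toDrawing D2 H f hf (fun σ => ι (η σ)) hη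
  refine ⟨D', hD', ?_⟩
  have hinj : Function.Injective η := by
    intro σ τ h
    have h1 := hη σ
    rw [h, hη τ] at h1
    exact (Subtype.ext (Sym2.map.injective hf h1)).symm
  have hcount := count X B {e | D0.s e = a} (fun e he => ((hX e).1 he).1) hXB D0.d u
    (fun e f => ∃ p, D.IsCrossing e.1 f.1 p) (fun q q' => D2.R (ι q) (ι q'))
    (by
      intro q q' h
      rcases hR q q' h with ⟨e, f, h1, h2, h3⟩ | h
      · exact Or.inl ⟨e, f, h1, h2, hcr e f h3.1 h3.2⟩
      · exact Or.inr h)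
    k (n + 1)
    (by
      rw [← hup]; congr 1; ext e
      simp only [Set.mem_ofPred_eq, hX e, PD.d, and_assoc])
    (by
      rw [← hdn]; congr 1; ext e
      simp only [Set.mem_ofPred_eq, hX e, PD.d, and_assoc])
    (by
      let g : Option (Fin n) → G.edgeSet := fun o => match o with
        | none => ⟨s(a, b), Aab⟩
        | some j => ⟨s(a, y j), Aay j⟩
      have hsub : {e | e ∈ {e | D0.s e = a} ∧ e ∉ X ∧ e ∉ B} ⊆ g '' Set.univ := by
        rintro e ⟨h1, h2, -⟩
        have h1 : D0.s e = a := h1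
        rcases hV (D0.t e) with h | h | ⟨i, h⟩ | ⟨j, h⟩
        · exact absurd h (hta e)
        · exact ⟨none, trivial, Subtype.ext (by rw [← hst e, h1, h])⟩
        · exact absurd ⟨i, by rw [← hst e, h1, h]⟩ h2
        · exact ⟨some j, trivial, Subtype.ext (by rw [← hst e, h1, h])⟩
      refine (Set.ncard_le_ncard hsub (Set.toFinite _)).trans ((Set.ncard_image_le (Set.toFinite _)).trans ?_)
      rw [Set.ncard_univ]; simp)
  refine le_trans ?_ hcount
  rw [two_crNum D' hD']
  have hmem : ∀ q ∈ crPairs D', q.1 ∈ H.edgeSet ∧ q.2 ∈ H.edgeSet := fun q ⟨p, hp⟩ => ⟨hp.1, hp.2.1⟩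
  refine Set.ncard_le_ncard_of_injOn
    (fun q => if h : q.1 ∈ H.edgeSet ∧ q.2 ∈ H.edgeSet then (η ⟨q.1, h.1⟩, η ⟨q.2, h.2⟩) else (.g true, .g true))
    ?_ ?_ (Set.toFinite _)
  · intro q hq
    have hm := hmem q hq
    obtain ⟨p, hp⟩ := hq
    simp only [hm, and_self, dif_pos]
    exact ⟨hηU _, hηU _, hcross ⟨q.1, hm.1⟩ ⟨q.2, hm.2⟩ ⟨p, hp⟩⟩
  · intro q hq q' hq' h
    simp only [hmem q hq, hmem q' hq', and_self, dif_pos, Prod.mk.injEq] at h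
    exact Prod.ext (congrArg Subtype.val (hinj h.1)) (congrArg Subtype.val (hinj h.2))

end CrAux

/-! ## Existence of good drawings -/
namespace CrAux

lemma exists_generic {E : Type} [Finite E] (d : E → ℂ) (hd : ∀ e, d e ≠ 0) :
    ∃ u : ℂ, u ≠ 0 ∧ ∀ e, dt u (d e) ≠ 0 := by
  have : Finite (insert 0 (Set.range d) : Set ℂ) := Set.Finite.insert 0 (Set.finite_range d)
  obtain ⟨u, hu, h⟩ := exists_dir (fun z : (insert 0 (Set.range d) : Set ℂ) => z.1) Subtype.val_injective
  refine ⟨u, hu, fun e he => hd e ?_⟩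
  have h1 : dt u 0 = 0 := by simp [dt]
  have := @h ⟨d e, Set.mem_insert_of_mem _ ⟨e, rfl⟩⟩ ⟨0, Set.mem_insert _ _⟩ (by simp only [he, h1])
  exact congrArg Subtype.val this

/-- Polygonal drawings of complete graphs of every order exist. -/
theorem exists_PD (N : ℕ) : ∃ (V E : Type) (_ : Finite V) (_ : Finite E) (D : PD V E) (a : V),
    Nat.card V = N + 1 ∧ (∀ e, D.t e ≠ a) ∧ (∀ e f, D.s e = a → D.s f = a → D.t e = D.t f → e = f) ∧
    ∀ v w, v ≠ w → ∃ e, s(D.s e, D.t e) = s(v, w) := by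
  induction N with
  | zero =>
    refine ⟨Unit, Empty, inferInstance, inferInstance,
      { pos := fun _ => 0, s := fun e => e.elim, t := fun e => e.elim, N := fun e => e.elim,
        ch := fun e => e.elim, pos_inj := fun _ _ _ => rfl, st := fun e => e.elim, Npos := fun e => e.elim,
        ch_zero := fun e => e.elim, ch_N := fun e => e.elim, sep := fun e => e.elim, adj := fun e => e.elim,
        ne := fun e => e.elim, avoid := fun e => e.elim, pair := fun e => e.elim, triple := fun e => e.elim },
      (), by simp, fun e => e.elim, fun e => e.elim, fun v w h => absurd rfl h⟩
  | succ N ih =>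
    obtain ⟨V, E, hV, hE, D, a, hc, hta, hinj, hall⟩ := ih
    obtain ⟨u, hu, hg⟩ := exists_generic D.d (fun e => sub_ne_zero.2 (D.ne e 0 (D.Npos e)).symm)
    obtain ⟨D1, -, a2, a3, ⟨a4, a5, -⟩, -⟩ := dup D a u hu hta hinj {e | D.s e = a} (fun x hx => hx)
      (fun x _ => hg x) (fun f _ => Or.inl (hg f))
    have hco : ∀ v, v ≠ a → ∃ e : E, D.s e = a ∧ D.t e = v := by
      intro v hv
      obtain ⟨e, he⟩ := hall a v hv.symm
      rcases Sym2.eq_iff.1 he with h | h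
      · exact ⟨e, h⟩
      · exact absurd h.2 (hta e)
    have hnew : ∀ v : V, ∃ e, s(D1.s e, D1.t e) = s(none, some v) := by
      intro v
      by_cases h : v = a
      · subst h
        exact ⟨_, by rw [a4, a5]; exact Sym2.eq_swap⟩
      · obtain ⟨e, h1, h2⟩ := hco v h
        exact ⟨.inr (.inl ⟨e, h1⟩), by rw [(a3 _).1, (a3 _).2, h2]⟩
    refine ⟨Option V, _, inferInstance, inferInstance, D1, some a, ?_, ?_, ?_, ?_⟩
    · rw [Finite.card_option, hc]
    · rintro (e | x | ⟨⟩)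
      · rw [(a2 e).2.1]; simpa using hta e
      · rw [(a3 x).2]; simpa using hta x
      · rw [a5]; simp
    · rintro (e | x | ⟨⟩) (f | y | ⟨⟩) h1 h2 h3
      · rw [(a2 e).1] at h1
        rw [(a2 f).1] at h2
        rw [(a2 e).2.1, (a2 f).2.1] at h3
        rw [hinj e f (Option.some.inj h1) (Option.some.inj h2) (Option.some.inj h3)]
      · rw [(a3 y).1] at h2; cases h2
      · rw [a5, (a2 e).2.1] at h3; cases h3
      · rw [(a3 x).1] at h1; cases h1
      · rw [(a3 x).1] at h1; cases h1
      · rw [(a3 x).1] at h1; cases h1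
      · rw [a5, (a2 f).2.1] at h3; cases h3
      · rw [(a3 y).1] at h2; cases h2
      · rfl
    · rintro (_ | v) (_ | w) h
      · exact absurd rfl h
      · exact hnew w
      · obtain ⟨e, he⟩ := hnew v
        exact ⟨e, he.trans Sym2.eq_swap⟩
      · obtain ⟨e, he⟩ := hall v w (fun h' => h (by rw [h']))
        refine ⟨.inl e, ?_⟩
        rw [(a2 e).1, (a2 e).2.1]
        simpa using congrArg (Sym2.map some) he

theorem exists_good {W : Type} [Finite W] (G : SimpleGraph W) : ∃ D : Drawing G, D.IsGood := by
  obtain ⟨V, E, hV, hE, D, a, hc, -, -, hall⟩ := exists_PD (Nat.card W)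
  have : Nonempty (W ↪ V) := by
    have := Fintype.ofFinite W
    have := Fintype.ofFinite V
    apply Function.Embedding.nonempty_of_card_le
    rw [← Nat.card_eq_fintype_card, ← Nat.card_eq_fintype_card, hc]
    exact Nat.le_succ _
  obtain ⟨f⟩ := this
  have : ∀ σ : G.edgeSet, ∃ e, s(D.s e, D.t e) = σ.1.map f := by
    rintro ⟨σ, hσ⟩
    induction σ using Sym2.ind with
    | _ w w' => exact hall _ _ (fun h => G.ne_of_adj hσ (f.injective h))
  choose η hη using this
  obtain ⟨D', hD', -⟩ := toDrawing D G f f.injective η hη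
  exact ⟨D', hD'⟩

lemma crossingNumber_le {W : Type} {G : SimpleGraph W} (D : Drawing G) (hD : D.IsGood) :
    crossingNumber G ≤ D.crNum := Nat.sInf_le ⟨D, hD, rfl⟩

lemma crossingNumber_attained {W : Type} [Finite W] (G : SimpleGraph W) :
    ∃ D : Drawing G, D.IsGood ∧ D.crNum = crossingNumber G := by
  obtain ⟨D, hD⟩ := exists_good G
  exact Nat.sInf_mem (s := {n | ∃ D : Drawing G, D.IsGood ∧ D.crNum = n}) ⟨_, D, hD, rfl⟩

/-- The map realizing the vertices of the derived bipartite graph. -/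
def vmap {V : Type} {m n : ℕ} (a b : V) (x : Fin m → V) (y : Fin n → V) : Fin (m + 1) ⊕ Fin (n + 3) → Option (Option V)
  | .inl i => Fin.lastCases (motive := fun _ => Option (Option V)) (some (some a)) (fun i => some (some (x i))) i
  | .inr j => Fin.addCases (motive := fun _ => Option (Option V)) (fun j => some (some (y j)))
      (fun c => ![some (some b), some none, none] c) j

lemma vmap_L {V : Type} {m n : ℕ} (a b : V) (x : Fin m → V) (y : Fin n → V) (i : Fin (m + 1)) :
    LS a x (vmap a b x y (.inl i)) := by
  induction i using Fin.lastCases with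
  | last => left; simp [vmap]
  | cast i => right; exact ⟨i, by simp [vmap]⟩

lemma vmap_R {V : Type} {m n : ℕ} (a b : V) (x : Fin m → V) (y : Fin n → V) (j : Fin (n + 3)) :
    RS b y (vmap a b x y (.inr j)) := by
  induction j using Fin.addCases with
  | left j => exact Or.inr (Or.inr (Or.inr ⟨j, by simp [vmap]⟩))
  | right c => fin_cases c <;> simp [vmap, RS]

lemma vmap_inj {V : Type} {m n : ℕ} (a b : V) (x : Fin m → V) (y : Fin n → V) (hx : Function.Injective x)
    (hy : Function.Injective y)
    (hab : a ≠ b) (hax : ∀ i, a ≠ x i) (hay : ∀ j, a ≠ y j)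
    (hbx : ∀ i, b ≠ x i) (hby : ∀ j, b ≠ y j) (hxy : ∀ i j, x i ≠ y j) :
    Function.Injective (vmap a b x y) := by
  have hLR : ∀ z, LS a x z → ¬ RS b y z := by
    rintro z (rfl | ⟨i, rfl⟩) (h | h | h | ⟨j, h⟩)
    · simp at h
    · simp at h
    · simp at h; exact hab h
    · simp at h; exact hay j h
    · simp at h
    · simp at h
    · simp at h; exact hbx i h.symm
    · simp at h; exact hxy i j h
  rintro (i | j) (i' | j') h
  · congr 1
    induction i using Fin.lastCases with
    | last =>
      induction i' using Fin.lastCases with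
      | last => rfl
      | cast i' => simp [vmap] at h; exact absurd h (hax i')
    | cast i =>
      induction i' using Fin.lastCases with
      | last => simp [vmap] at h; exact absurd h.symm (hax i)
      | cast i' => simp [vmap] at h; rw [hx h]
  · exact absurd (h ▸ vmap_R a b x y j' : RS b y (vmap a b x y (.inl i))) (hLR _ (vmap_L a b x y i))
  · exact absurd (h ▸ vmap_R a b x y j : RS b y (vmap a b x y (.inl i'))) (hLR _ (vmap_L a b x y i'))
  · congr 1
    induction j using Fin.addCases with
    | left j =>
      induction j' using Fin.addCases with
      | left j' => simp [vmap] at h; rw [hy h]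
      | right c => fin_cases c <;> simp [vmap] at h; exact absurd h.symm (hby j)
    | right c =>
      induction j' using Fin.addCases with
      | left j' => fin_cases c <;> simp [vmap] at h; exact absurd h (hby j')
      | right c' => fin_cases c <;> fin_cases c' <;> simp [vmap] at h ⊢

end CrAux

/-! ## The theorem -/
namespace CrAux

instance quadFinite (a b c d : ℕ) : Finite (Σ i : Fin 4, ![Fin a, Fin b, Fin c, Fin d] i) := by
  have : ∀ i : Fin 4, Finite (![Fin a, Fin b, Fin c, Fin d] i) := by
    intro i
    fin_cases i
    · exact inferInstanceAs (Finite (Fin a))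
    · exact inferInstanceAs (Finite (Fin b))
    · exact inferInstanceAs (Finite (Fin c))
    · exact inferInstanceAs (Finite (Fin d))
  infer_instance

theorem final {V : Type} [Finite V] (G : SimpleGraph V) {m n : ℕ} (a b : V) (x : Fin m → V) (y : Fin n → V)
    (hx : Function.Injective x) (hy : Function.Injective y)
    (hV : ∀ v, v = a ∨ v = b ∨ (∃ i, v = x i) ∨ ∃ j, v = y j)
    (Aab : G.Adj a b) (Aax : ∀ i, G.Adj a (x i)) (Aay : ∀ j, G.Adj a (y j)) (Abx : ∀ i, G.Adj b (x i))
    (Aby : ∀ j, G.Adj b (y j)) (Axy : ∀ i j, G.Adj (x i) (y j)) (k l : ℕ) (hk : 0 < k) (hm : m = 2 * k)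
    (hl : 0 < l) (hn : n = 2 * l) :
    crossingNumber (bipK (m + 1) (n + 3)) + crossingNumber (bipK (m + 3) (n + 1)) ≤
      2 * crossingNumber G + (((n + 1) * k + (k * k - k)) + ((m + 1) * l + (l * l - l))) := by
  obtain ⟨D, hD, hDc⟩ := crossingNumber_attained G
  have hab := Aab.ne
  have hax := fun i => (Aax i).ne
  have hay := fun i => (Aay i).ne
  have hbx := fun i => (Abx i).ne
  have hby := fun i => (Aby i).ne
  have hxy := fun i j => (Axy i j).ne
  obtain ⟨D1, hD1, h1⟩ := main1 D hD a b x y hx hab hax hay hbx hby hxy hV Aab Aax Aay Abx Axy k hk hm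
    (bipK (m + 1) (n + 3)) (vmap a b x y) (vmap_inj a b x y hx hy hab hax hay hbx hby hxy)
    (by
      rintro (i | j) (i' | j') h
      · simp at h
      · exact Or.inl ⟨vmap_L _ _ _ _ _, vmap_R _ _ _ _ _⟩
      · exact Or.inr ⟨vmap_R _ _ _ _ _, vmap_L _ _ _ _ _⟩
      · simp at h)
  obtain ⟨D2, hD2, h2⟩ := main1 D hD b a y x hy hab.symm hby hbx hay hax (fun i j => (hxy j i).symm)
    (fun v => by rcases hV v with h | h | h | h <;> tauto) Aab.symm Aby Abx Aay (fun i j => (Axy j i).symm) l hl hn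
    (bipK (m + 3) (n + 1)) (fun w => vmap b a y x w.swap)
    ((vmap_inj b a y x hy hx hab.symm hby hbx hay hax (fun i j => (hxy j i).symm)).comp
      (Equiv.sumComm _ _).injective)
    (by
      rintro (i | j) (i' | j') h
      · simp at h
      · exact Or.inr ⟨vmap_R _ _ _ _ _, vmap_L _ _ _ _ _⟩
      · exact Or.inl ⟨vmap_L _ _ _ _ _, vmap_R _ _ _ _ _⟩
      · simp at h)
  have h3 := wsum (starE G a x) (starE G b y) (fun e f => ∃ p, D.IsCrossing e.1 f.1 p)
    (by
      rintro e ⟨i, hi⟩ ⟨j, hj⟩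
      rw [hi] at hj
      rcases Sym2.eq_iff.1 hj with h | h
      · exact hab h.1
      · exact hay j h.1)
    (by
      rintro e ⟨i, hi⟩ f ⟨j, hj⟩ ⟨p, hp⟩
      exact hD.adj_no_cross _ _ ⟨a, by rw [hi]; simp, by rw [hj]; simp⟩ p hp)
    (by
      rintro e ⟨i, hi⟩ f ⟨j, hj⟩ ⟨p, hp⟩
      exact hD.adj_no_cross _ _ ⟨b, by rw [hi]; simp, by rw [hj]; simp⟩ p hp)
  have h4 : {p : G.edgeSet × G.edgeSet | ∃ q, D.IsCrossing p.1.1 p.2.1 q}.ncard ≤ 2 * D.crNum := by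
    rw [two_crNum D hD]
    refine Set.ncard_le_ncard_of_injOn (fun p => (p.1.1, p.2.1)) (fun p hp => hp) ?_ (Set.toFinite _)
    intro p _ q _ h
    simp only [Prod.mk.injEq] at h
    exact Prod.ext (Subtype.ext h.1) (Subtype.ext h.2)
  have h5 := crossingNumber_le D1 hD1
  have h6 := crossingNumber_le D2 hD2
  rw [← hDc]
  omega

end CrAux

/-- If `m` and `n` are both even positive integers, then
`cr(K_{1,1,m,n}) ≥ ½(cr(K_{m+1,n+3}) + cr(K_{m+3,n+1}) − mn − ¼(m² + n²))`. -/
theorem statement4 (m n : ℕ) (hm : 0 < m) (hn : 0 < n)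
    (hme : Even m) (hne : Even n) :
    (crossingNumber (quadK 1 1 m n) : ℝ) ≥
      (1 / 2) * ((crossingNumber (bipK (m + 1) (n + 3)) : ℝ)
        + (crossingNumber (bipK (m + 3) (n + 1)) : ℝ)
        - (m : ℝ) * n - (1 / 4) * ((m : ℝ) ^ 2 + (n : ℝ) ^ 2)) := by
  obtain ⟨k, hk⟩ := hme
  obtain ⟨l, hl⟩ := hne
  have key := CrAux.final (quadK 1 1 m n) (m := m) (n := n) ⟨0, (0 : Fin 1)⟩ ⟨1, (0 : Fin 1)⟩
    (fun i => ⟨2, (i : Fin m)⟩) (fun j => ⟨3, (j : Fin n)⟩)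
    (fun i j h => eq_of_heq (Sigma.mk.inj h).2) (fun i j h => eq_of_heq (Sigma.mk.inj h).2)
    (by
      rintro ⟨i, v⟩
      fin_cases i
      · left
        have : v = (0 : Fin 1) := Subsingleton.elim (α := Fin 1) _ _
        subst this; rfl
      · right; left
        have : v = (0 : Fin 1) := Subsingleton.elim (α := Fin 1) _ _
        subst this; rfl
      · right; right; left; exact ⟨v, rfl⟩
      · right; right; right; exact ⟨v, rfl⟩)
    (by simp) (by simp) (by simp) (by simp) (by simp) (by simp)
    k l (by omega) (by omega) (by omega) (by omega)
  have e1 : (n + 1) * k + (k * k - k) = n * k + k * k := by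
    have : k ≤ k * k := Nat.le_mul_self k
    rw [add_mul, one_mul]; omega
  have e2 : (m + 1) * l + (l * l - l) = m * l + l * l := by
    have : l ≤ l * l := Nat.le_mul_self l
    rw [add_mul, one_mul]; omega
  rw [e1, e2] at key
  have key' : ((crossingNumber (bipK (m + 1) (n + 3)) : ℝ) + (crossingNumber (bipK (m + 3) (n + 1)) : ℝ)) ≤
      2 * (crossingNumber (quadK 1 1 m n) : ℝ) + ((n * k + k * k) + (m * l + l * l)) := by
    exact_mod_cast key
  have hk' : (m : ℝ) = k + k := by exact_mod_cast hk
  have hl' : (n : ℝ) = l + l := by exact_mod_cast hl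
  rw [hk', hl'] at key' ⊢
  nlinarith
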